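/- Fix t ∈ ℚ with t ∉ {−1, 0, 1}. Define H_t(p) = t⁸(1 + t⁴)²p⁴ + 4t⁵(1 + 2t⁴ + 2t⁸ + t¹²)p³ − 2t⁴(4 + 3t² + 9t⁴ + 4t⁶ + 9t⁸ + 3t¹⁰ + 4t¹²)p² + 4t³(1 − t² + t⁴)(1 + t² + t⁴)²p + t⁴(1 + t² + t⁴)² and H′_t(p) = t¹⁰(1 + t⁴)²p⁴ + 4t⁵(1 + t² + 2t⁴ + 2t⁶ + 2t⁸ + 2t¹⁰ + 2t¹² + t¹⁴ + t¹⁶)p³ − 2t⁴(4 + 6t² + 11t⁴ + 11t⁶ + 12t⁸ + 11t¹⁰ + 11t¹² + 6t¹⁴ + 4t¹⁶)p² + 4t³(1 + 2t² + 3t⁴ + 3t⁶ + 3t⁸ + 3t¹⁰ + 3t¹² + 2t¹⁴ + t¹⁶)p + t⁶(1 + t² + t⁴)². Then the set {(p, S, S′) ∈ ℚ³ : S² = H_t(p) and S′² = H′_t(p)} is finite. -/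

import Mathlib

open Polynomial

/-- A submultiplicative `ℕ`-valued size function on a commutative ring. -/
structure RingSize (R : Type*) [CommRing R] where
  toFun : R → ℕ
  zero' : toFun 0 = 0
  one' : toFun 1 ≤ 1
  neg' : ∀ a, toFun (-a) = toFun a
  add' : ∀ a b, toFun (a + b) ≤ toFun a + toFun b
  mul' : ∀ a b, toFun (a * b) ≤ toFun a * toFun b

namespace RingSize

variable {R : Type*} [CommRing R]

instance : CoeFun (RingSize R) (fun _ => R → ℕ) := ⟨toFun⟩

variable (ν : RingSize R)

@[simp] theorem zero : ν 0 = 0 := ν.zero'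
theorem one : ν 1 ≤ 1 := ν.one'
@[simp] theorem neg (a : R) : ν (-a) = ν a := ν.neg' a
theorem add (a b : R) : ν (a + b) ≤ ν a + ν b := ν.add' a b
theorem mul (a b : R) : ν (a * b) ≤ ν a * ν b := ν.mul' a b

theorem sub (a b : R) : ν (a - b) ≤ ν a + ν b := by
  rw [sub_eq_add_neg]; exact (ν.add a (-b)).trans (by simp)

theorem pow (a : R) (n : ℕ) : ν (a ^ n) ≤ ν a ^ n := by
  induction n with
  | zero => simpa using ν.one
  | succ k ih =>
    rw [pow_succ, pow_succ]
    exact (ν.mul _ _).trans (by gcongr)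

theorem sum {ι : Type*} (s : Finset ι) (f : ι → R) : ν (∑ i ∈ s, f i) ≤ ∑ i ∈ s, ν (f i) := by
  classical
  induction s using Finset.induction_on with
  | empty => simp
  | insert a s ha ih =>
    rw [Finset.sum_insert ha, Finset.sum_insert ha]
    exact (ν.add _ _).trans (by gcongr)

theorem natCast (n : ℕ) : ν (n : R) ≤ n := by
  induction n with
  | zero => simp
  | succ k ih =>
    rw [Nat.cast_succ]
    exact (ν.add _ _).trans (by gcongr; exact ν.one)

/-- The absolute value on `ℤ`. -/
@[simps] def int : RingSize ℤ where
  toFun := Int.natAbs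
  zero' := rfl
  one' := le_rfl
  neg' := Int.natAbs_neg
  add' := Int.natAbs_add_le
  mul' a b := (Int.natAbs_mul a b).le

/-- The `ℓ¹`-size of a polynomial. -/
def l1 (p : R[X]) : ℕ := p.sum fun _ a => ν a

theorem l1_eq_of_natDegree_lt {p : R[X]} {n : ℕ} (h : p.natDegree < n) :
    ν.l1 p = ∑ i ∈ Finset.range n, ν (p.coeff i) :=
  Polynomial.sum_over_range' p (fun _ => ν.zero) n h

theorem l1_monomial (n : ℕ) (a : R) : ν.l1 (monomial n a) = ν a :=
  Polynomial.sum_monomial_index a _ ν.zero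

theorem l1_add (p q : R[X]) : ν.l1 (p + q) ≤ ν.l1 p + ν.l1 q := by
  have hp : p.natDegree < max p.natDegree q.natDegree + 1 := by omega
  have hq : q.natDegree < max p.natDegree q.natDegree + 1 := by omega
  have hpq : (p + q).natDegree < max p.natDegree q.natDegree + 1 :=
    Nat.lt_succ_of_le (natDegree_add_le p q)
  rw [ν.l1_eq_of_natDegree_lt hp, ν.l1_eq_of_natDegree_lt hq, ν.l1_eq_of_natDegree_lt hpq,
    ← Finset.sum_add_distrib]
  gcongr with i _
  rw [coeff_add]; exact ν.add _ _

theorem l1_sum {ι : Type*} (s : Finset ι) (f : ι → R[X]) :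
    ν.l1 (∑ i ∈ s, f i) ≤ ∑ i ∈ s, ν.l1 (f i) := by
  classical
  induction s using Finset.induction_on with
  | empty => simp [l1]
  | insert a s ha ih =>
    rw [Finset.sum_insert ha, Finset.sum_insert ha]
    exact (ν.l1_add _ _).trans (by gcongr)

theorem l1_mul (p q : R[X]) : ν.l1 (p * q) ≤ ν.l1 p * ν.l1 q := by
  rw [mul_eq_sum_sum]
  simp only [Polynomial.sum_def]
  refine (ν.l1_sum _ _).trans ?_
  rw [l1, Polynomial.sum_def, Finset.sum_mul]
  gcongr with i _
  refine (ν.l1_sum _ _).trans ?_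
  rw [show ν.l1 q = ∑ j ∈ q.support, ν (q.coeff j) from q.sum_def _, Finset.mul_sum]
  gcongr with j _
  rw [l1_monomial]; exact ν.mul _ _

/-- The `ℓ¹`-size on polynomials as a `RingSize`. -/
def poly : RingSize R[X] where
  toFun := ν.l1
  zero' := by simp [l1]
  one' := by
    rw [← C_1, ← monomial_zero_left, l1_monomial]; exact ν.one
  neg' p := by
    simp [ν.l1_eq_of_natDegree_lt (Nat.lt_succ_self _)]
  add' := ν.l1_add
  mul' := ν.l1_mul

theorem poly_eq_of_natDegree_lt {p : R[X]} {n : ℕ} (h : p.natDegree < n) :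
    ν.poly p = ∑ i ∈ Finset.range n, ν (p.coeff i) := ν.l1_eq_of_natDegree_lt h

theorem poly_eq_sum (p : R[X]) :
    ν.poly p = ∑ i ∈ Finset.range (p.natDegree + 1), ν (p.coeff i) :=
  ν.poly_eq_of_natDegree_lt (Nat.lt_succ_self _)

@[simp] theorem poly_monomial (n : ℕ) (a : R) : ν.poly (monomial n a) = ν a := ν.l1_monomial n a

@[simp] theorem poly_C (a : R) : ν.poly (C a) = ν a := by
  rw [← monomial_zero_left]; exact ν.l1_monomial 0 a

theorem poly_X : ν.poly X ≤ 1 := by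
  rw [X, poly_monomial]; exact ν.one

theorem poly_X_pow (n : ℕ) : ν.poly (X ^ n) ≤ 1 := by
  rw [X_pow_eq_monomial, poly_monomial]; exact ν.one

theorem coeff_le (p : R[X]) (i : ℕ) : ν (p.coeff i) ≤ ν.poly p := by
  rcases lt_or_ge p.natDegree i with h | h
  · simp [coeff_eq_zero_of_natDegree_lt h]
  · rw [poly_eq_sum]
    exact Finset.single_le_sum (f := fun i => ν (p.coeff i)) (fun _ _ => Nat.zero_le _)
      (Finset.mem_range.2 (Nat.lt_succ_of_le h))

/-- Size of the value of a polynomial. -/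
theorem eval₂_le {S : Type*} [CommRing S] (μ : RingSize S) (φ : R →+* S) {x : S} {p : R[X]}
    {n B : ℕ} (hn : p.natDegree ≤ n) (hφ : ∀ i, μ (φ (p.coeff i)) ≤ ν (p.coeff i))
    (hB : 1 ≤ B) (hx : μ x ≤ B) : μ (p.eval₂ φ x) ≤ B ^ n * ν.poly p := by
  rw [eval₂_eq_sum_range' φ (Nat.lt_succ_of_le hn) x,
    ν.poly_eq_of_natDegree_lt (Nat.lt_succ_of_le hn), Finset.mul_sum]
  refine (μ.sum _ _).trans (Finset.sum_le_sum fun i hi => ?_)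
  rw [mul_comm (B ^ n)]
  refine (μ.mul _ _).trans (Nat.mul_le_mul (hφ i) ((μ.pow _ _).trans ?_))
  exact (Nat.pow_le_pow_left hx i).trans
    (Nat.pow_le_pow_right hB (Nat.lt_succ_iff.1 (Finset.mem_range.1 hi)))

theorem taylor_le {p : R[X]} {n B : ℕ} (hn : p.natDegree ≤ n) (r : R) (hB : 1 + ν r ≤ B) :
    ν.poly (taylor r p) ≤ B ^ n * ν.poly p := by
  rw [taylor_apply, comp]
  refine ν.eval₂_le ν.poly C hn (fun i => by simp) (by omega) ?_
  exact (ν.poly.add _ _).trans ((add_le_add ν.poly_X (by simp)).trans hB)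

theorem divX_pow_le (p : R[X]) (e : ℕ) : ν.poly (divX^[e] p) ≤ ν.poly p := by
  have key : ∀ q : R[X], ν.poly (divX q) ≤ ν.poly q := fun q => by
    have h1 : (divX q).natDegree < q.natDegree + 1 := by
      rw [natDegree_divX_eq_natDegree_tsub_one]; omega
    rw [ν.poly_eq_of_natDegree_lt h1,
      ν.poly_eq_of_natDegree_lt (show q.natDegree < q.natDegree + 1 + 1 by omega),
      Finset.sum_range_succ' _ (q.natDegree + 1)]
    simp
  induction e with
  | zero => simp
  | succ k ih => rw [Function.iterate_succ_apply']; exact (key _).trans ih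

end RingSize

/-- Evaluation of a polynomial at `x + c τ`, as a power series in `τ`. -/
noncomputable def shiftHom {R : Type*} [CommRing R] (x c : R) : R[X] →+* PowerSeries R :=
  ((PowerSeries.rescale c).comp Polynomial.coeToPowerSeries.ringHom).comp
    (taylorAlgHom x : R[X] →+* R[X])

section shift
variable {R : Type*} [CommRing R] (x c : R)

theorem shiftHom_apply (p : R[X]) :
    shiftHom x c p = PowerSeries.rescale c ((taylor x p : R[X]) : PowerSeries R) := rfl

theorem coeff_shiftHom (p : R[X]) (n : ℕ) :
    PowerSeries.coeff n (shiftHom x c p) = c ^ n * (taylor x p).coeff n := by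
  rw [shiftHom_apply, PowerSeries.coeff_rescale, Polynomial.coeff_coe]

@[simp] theorem shiftHom_C (r : R) : shiftHom x c (C r) = PowerSeries.C r := by
  ext n
  rw [coeff_shiftHom, taylor_C, coeff_C, PowerSeries.coeff_C]
  split_ifs with h <;> simp [h]

@[simp] theorem shiftHom_X :
    shiftHom x c X = PowerSeries.C x + PowerSeries.C c * PowerSeries.X := by
  have h := shiftHom_C x c x
  rw [shiftHom_apply, taylor_C] at h
  rw [shiftHom_apply, taylor_X, Polynomial.coe_add, map_add, h, Polynomial.coe_X,
    PowerSeries.rescale_X, add_comm]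

@[simp] theorem constantCoeff_shiftHom (p : R[X]) :
    PowerSeries.constantCoeff (shiftHom x c p) = p.eval x := by
  rw [← PowerSeries.coeff_zero_eq_constantCoeff_apply, coeff_shiftHom]; simp

end shift

theorem taylor_X_map_C_coeff (f : ℤ[X]) (n : ℕ) :
    (taylor X (f.map (C : ℤ →+* ℤ[X]))).coeff n = hasseDeriv n f := by
  have : hasseDeriv n (f.map (C : ℤ →+* ℤ[X])) = (hasseDeriv n f).map C := by
    ext1 k; simp [hasseDeriv_coeff]
  rw [taylor_coeff, this, eval_map, eval₂_C_X]

/-- A square root of `1 + 4y` for a power series `y` without constant term. -/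
theorem exists_quadratic_series {R : Type*} [CommRing R] (y : PowerSeries R)
    (hy : PowerSeries.constantCoeff y = 0) :
    ∃ w : PowerSeries R, PowerSeries.constantCoeff w = 0 ∧ w = y - w ^ 2 := by
  have hs : PowerSeries.HasSubst (-y) := PowerSeries.HasSubst.of_constantCoeff_zero' (by simp [hy])
  set c : PowerSeries R := (PowerSeries.catalanSeries.map (Nat.castRingHom R)).subst (-y) with hc
  have h := congrArg (fun s : PowerSeries ℕ => (s.map (Nat.castRingHom R)).subst (-y))
    PowerSeries.catalanSeries_sq_mul_X_add_one
  simp only [map_add, map_mul, map_pow, map_one, PowerSeries.map_X] at h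
  rw [PowerSeries.subst_add hs, PowerSeries.subst_mul hs, PowerSeries.subst_pow hs,
    PowerSeries.subst_X hs, ← hc,
    show (1 : PowerSeries R).subst (-y) = 1 from by
      rw [← PowerSeries.coe_substAlgHom hs, map_one]] at h
  refine ⟨y * c, by simp [hy], ?_⟩
  linear_combination (-y) * h

open Finset in
/-- Degree and size bounds for the solution of `w = y - w²`. -/
theorem quadratic_series_bounds {y w : PowerSeries ℤ[X]} {M e : ℕ}
    (hw0 : PowerSeries.constantCoeff w = 0) (hw : w = y - w ^ 2)
    (hdeg : ∀ n, (PowerSeries.coeff n y).natDegree ≤ e * n)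
    (hsize : ∀ n, 4 * RingSize.int.poly (PowerSeries.coeff n y) ≤ M ^ n) (n : ℕ) :
    (PowerSeries.coeff n w).natDegree ≤ e * n ∧
      2 * RingSize.int.poly (PowerSeries.coeff n w) ≤ M ^ n * catalan (n - 1) := by
  have hw0' : PowerSeries.coeff 0 w = 0 := by simpa using hw0
  induction n using Nat.strong_induction_on with
  | _ n ih =>
  rcases n with _ | n
  · simp [hw0']
  have hrec : PowerSeries.coeff (n + 1) w = PowerSeries.coeff (n + 1) y -
      ∑ p ∈ antidiagonal (n + 1), PowerSeries.coeff p.1 w * PowerSeries.coeff p.2 w := by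
    conv_lhs => rw [hw]
    rw [map_sub, sq, PowerSeries.coeff_mul]
  constructor
  · rw [hrec]
    refine (natDegree_sub_le _ _).trans (max_le (hdeg _) (natDegree_sum_le_of_forall_le _ _ ?_))
    rintro ⟨i, j⟩ hij
    replace hij := HasAntidiagonal.mem_antidiagonal.1 hij
    simp only at hij ⊢
    rcases Nat.eq_zero_or_pos i with rfl | hi
    · simp [hw0']
    rcases Nat.eq_zero_or_pos j with rfl | hj
    · simp [hw0']
    calc _ ≤ _ := natDegree_mul_le
      _ ≤ e * i + e * j := add_le_add (ih i (by omega)).1 (ih j (by omega)).1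
      _ = e * (n + 1) := by rw [← mul_add, hij]
  · have hy := hsize (n + 1)
    rcases n with _ | n
    · rw [hrec]
      simp only [zero_add, Finset.Nat.antidiagonal_succ, pow_one] at hy ⊢
      simp [hw0']
      omega
    replace hrec : PowerSeries.coeff (n + 2) w = PowerSeries.coeff (n + 2) y -
      ∑ p ∈ antidiagonal (n + 2), PowerSeries.coeff p.1 w * PowerSeries.coeff p.2 w := hrec
    replace hy : 4 * RingSize.int.poly (PowerSeries.coeff (n + 2) y) ≤ M ^ (n + 2) := hy
    have hsum : 4 * RingSize.int.poly (∑ p ∈ antidiagonal (n + 2),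
        PowerSeries.coeff p.1 w * PowerSeries.coeff p.2 w) ≤ M ^ (n + 2) * catalan (n + 1) := by
      refine (Nat.mul_le_mul_left 4 (RingSize.int.poly.sum _ _)).trans ?_
      rw [Nat.sum_antidiagonal_succ, Nat.sum_antidiagonal_succ', catalan_succ', mul_add, mul_add,
        mul_sum, mul_sum]
      simp only [hw0', zero_mul, mul_zero, RingSize.zero, zero_add]
      refine sum_le_sum ?_
      rintro ⟨i, j⟩ hij
      replace hij := HasAntidiagonal.mem_antidiagonal.1 hij
      simp only at hij ⊢
      have h1 := (ih (i + 1) (by omega)).2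
      have h2 := (ih (j + 1) (by omega)).2
      simp only [Nat.add_sub_cancel] at h1 h2
      calc _ ≤ 4 * (RingSize.int.poly (PowerSeries.coeff (i + 1) w) *
            RingSize.int.poly (PowerSeries.coeff (j + 1) w)) := by
            gcongr; exact RingSize.int.poly.mul _ _
        _ = (2 * RingSize.int.poly (PowerSeries.coeff (i + 1) w)) *
            (2 * RingSize.int.poly (PowerSeries.coeff (j + 1) w)) := by ring
        _ ≤ (M ^ (i + 1) * catalan i) * (M ^ (j + 1) * catalan j) := Nat.mul_le_mul h1 h2
        _ = _ := by rw [← hij]; ring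
    have hcat : 1 ≤ catalan (n + 1) := by
      rw [catalan_succ']
      refine le_trans ?_ (single_le_sum (f := fun ij : ℕ × ℕ => catalan ij.1 * catalan ij.2)
        (fun _ _ => Nat.zero_le _) (a := (0, n))
        (HasAntidiagonal.mem_antidiagonal.2 (zero_add n)))
      simp only [catalan_zero, one_mul]
      exact Nat.pos_of_ne_zero fun h => by
        have := succ_mul_catalan_eq_centralBinom n
        rw [h, mul_zero] at this
        exact (Nat.centralBinom_pos n).ne this
    have hsub := RingSize.int.poly.sub (PowerSeries.coeff (n + 2) y) (∑ p ∈ antidiagonal (n + 2),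
        PowerSeries.coeff p.1 w * PowerSeries.coeff p.2 w)
    have : M ^ (n + 2) ≤ M ^ (n + 2) * catalan (n + 1) := Nat.le_mul_of_pos_right _ hcat
    change 2 * RingSize.int.poly (PowerSeries.coeff (n + 2) w) ≤ M ^ (n + 2) * catalan (n + 1)
    rw [hrec]
    omega

theorem hasseDeriv_size_le {f : ℤ[X]} (hf : f.natDegree ≤ 6) (n : ℕ) :
    RingSize.int.poly (hasseDeriv n f) ≤ 64 * RingSize.int.poly f := by
  have h := RingSize.int.poly.taylor_le (p := f.map (C : ℤ →+* ℤ[X])) (B := 2)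
    ((natDegree_map_le).trans hf) X (by have := RingSize.int.poly_X; omega)
  have h2 : RingSize.int.poly.poly (f.map (C : ℤ →+* ℤ[X])) = RingSize.int.poly f := by
    rw [RingSize.poly_eq_of_natDegree_lt _ (Nat.lt_succ_of_le natDegree_map_le),
      RingSize.poly_eq_sum]
    exact Finset.sum_congr rfl fun i _ => by rw [coeff_map, RingSize.poly_C]
  rw [h2] at h
  rw [← taylor_X_map_C_coeff]
  exact (RingSize.coeff_le _ _ _).trans h

/-- The power series `q` with `f q² = f(u + 4 f τ)`. -/
theorem exists_sqrt_series {f : ℤ[X]} (hf : f.natDegree ≤ 6) (hf0 : f ≠ 0) :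
    ∃ q : PowerSeries ℤ[X], PowerSeries.C f * q ^ 2 = shiftHom X (4 * f) (f.map C) ∧
      PowerSeries.constantCoeff q = 1 ∧
      (∀ n, (PowerSeries.coeff n q).natDegree ≤ 5 * n) ∧
      ∀ n, RingSize.int.poly (PowerSeries.coeff n q) ≤ (1024 * RingSize.int.poly f) ^ n := by
  have hL : 1 ≤ RingSize.int.poly f := Nat.one_le_iff_ne_zero.2 fun h => hf0 <| by
    ext i
    have := RingSize.int.coeff_le f i
    simp only [h, RingSize.int_toFun, Nat.le_zero, Int.natAbs_eq_zero] at this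
    simpa using this
  set y : PowerSeries ℤ[X] := PowerSeries.mk fun n =>
    if n = 0 then 0 else (4 * f) ^ (n - 1) * hasseDeriv n f with hy
  have hy0 : PowerSeries.constantCoeff y = 0 := by
    rw [← PowerSeries.coeff_zero_eq_constantCoeff_apply]; simp [hy]
  have hfy : PowerSeries.C f * (1 + 4 * y) = shiftHom X (4 * f) (f.map C) := by
    ext1 n
    rw [coeff_shiftHom, taylor_X_map_C_coeff, PowerSeries.coeff_C_mul, map_add,
      show (4 : PowerSeries ℤ[X]) = PowerSeries.C 4 from (map_ofNat _ 4).symm,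
      PowerSeries.coeff_C_mul, hy, PowerSeries.coeff_mk, PowerSeries.coeff_one]
    rcases n with _ | n
    · simp
    · simp; ring
  obtain ⟨w, hw0, hw⟩ := exists_quadratic_series y hy0
  have hb := quadratic_series_bounds (M := 256 * RingSize.int.poly f) (e := 5) hw0 hw
    (fun n => by
      rw [hy, PowerSeries.coeff_mk]
      split_ifs with hn
      · simp
      have h4 : (4 * f).natDegree ≤ 6 := by
        have := natDegree_C_mul_le (4 : ℤ) f
        rw [map_ofNat] at this
        exact this.trans hf
      rcases lt_or_ge 6 n with h6 | h6
      · rw [hasseDeriv_eq_zero_of_lt_natDegree f n (hf.trans_lt h6)]; simp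
      calc _ ≤ _ := natDegree_mul_le
        _ ≤ (n - 1) * 6 + (6 - n) := add_le_add
            (natDegree_pow_le.trans (Nat.mul_le_mul_left _ h4))
            ((natDegree_hasseDeriv_le f n).trans (by omega))
        _ ≤ 5 * n := by omega)
    (fun n => by
      rw [hy, PowerSeries.coeff_mk]
      split_ifs with hn
      · simp
      obtain ⟨k, rfl⟩ := Nat.exists_eq_succ_of_ne_zero hn
      have h4 : RingSize.int.poly (4 * f) ≤ 4 * RingSize.int.poly f :=
        (RingSize.mul _ _ _).trans (Nat.mul_le_mul_right _ (RingSize.natCast _ 4))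
      calc 4 * RingSize.int.poly ((4 * f) ^ (k.succ - 1) * hasseDeriv k.succ f)
          ≤ 4 * ((4 * RingSize.int.poly f) ^ k * (64 * RingSize.int.poly f)) := by
            gcongr
            exact (RingSize.mul _ _ _).trans (Nat.mul_le_mul
              ((RingSize.pow _ _ _).trans (Nat.pow_le_pow_left h4 _)) (hasseDeriv_size_le hf _))
        _ ≤ 4 * ((256 * RingSize.int.poly f) ^ k * (64 * RingSize.int.poly f)) := by
            gcongr; omega
        _ = (256 * RingSize.int.poly f) ^ k.succ := by rw [pow_succ]; ring)
  refine ⟨1 + 2 * w, ?_, by simp [hw0], fun n => ?_, fun n => ?_⟩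
  · rw [← hfy]; linear_combination 4 * PowerSeries.C f * hw
  all_goals
    rw [map_add, show (2 : PowerSeries ℤ[X]) = PowerSeries.C 2 from (map_ofNat _ 2).symm,
      PowerSeries.coeff_C_mul, PowerSeries.coeff_one]
    obtain ⟨h1, h2⟩ := hb n
    rcases n with _ | n
  · simp [hw0]
  · have := natDegree_C_mul_le (2 : ℤ) (PowerSeries.coeff (n + 1) w)
    rw [map_ofNat] at this
    simpa using this.trans h1
  · simpa [hw0] using RingSize.one _
  · have hc : catalan n ≤ 4 ^ n := by
      rw [catalan_eq_centralBinom_div]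
      refine (Nat.div_le_self _ _).trans ?_
      rw [Nat.centralBinom_eq_two_mul_choose]
      calc (2 * n).choose n ≤ 2 ^ (2 * n) := Nat.choose_le_two_pow _ _
        _ = 4 ^ n := by rw [pow_mul]; norm_num
    simp only [Nat.succ_ne_zero, if_false, zero_add]
    calc _ ≤ 2 * RingSize.int.poly (PowerSeries.coeff (n + 1) w) :=
          (RingSize.mul _ _ _).trans (Nat.mul_le_mul_right _ (RingSize.natCast _ 2))
      _ ≤ (256 * RingSize.int.poly f) ^ (n + 1) * 4 ^ (n + 1) :=
          h2.trans (Nat.mul_le_mul_left _ (hc.trans (Nat.pow_le_pow_right (by norm_num)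
            (Nat.le_succ n))))
      _ = _ := by rw [← mul_pow]; ring

/-- `q` is the power series over `ℤ[u]` with constant term `1` and `f q² = f(u + 4 f τ)`. -/
structure IsSqrtSeries (f : ℤ[X]) (q : PowerSeries ℤ[X]) : Prop where
  eq : PowerSeries.C f * q ^ 2 = shiftHom X (4 * f) (f.map C)
  const : PowerSeries.constantCoeff q = 1
  deg : ∀ n, (PowerSeries.coeff n q).natDegree ≤ 5 * n
  size : ∀ n, RingSize.int.poly (PowerSeries.coeff n q) ≤ (1024 * RingSize.int.poly f) ^ n

/-- The total degree of a bivariate polynomial is at most `N`. -/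
def TotDegLE (A : ℤ[X][X]) (N : ℤ) : Prop :=
  ∀ i j : ℕ, (A.coeff i).coeff j ≠ 0 → (i + j : ℤ) ≤ N

namespace TotDegLE

theorem mono {A : ℤ[X][X]} {N M : ℤ} (hA : TotDegLE A N) (h : N ≤ M) : TotDegLE A M :=
  fun i j hij => (hA i j hij).trans h

theorem add {A B : ℤ[X][X]} {N : ℤ} (hA : TotDegLE A N) (hB : TotDegLE B N) :
    TotDegLE (A + B) N := fun i j hij => by
  by_contra hlt
  refine hij ?_
  have h1 : (A.coeff i).coeff j = 0 := by_contra fun h => hlt (hA i j h)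
  have h2 : (B.coeff i).coeff j = 0 := by_contra fun h => hlt (hB i j h)
  simp [h1, h2]

theorem mul {A B : ℤ[X][X]} {N M : ℤ} (hA : TotDegLE A N) (hB : TotDegLE B M) :
    TotDegLE (A * B) (N + M) := fun i j hij => by
  by_contra hlt
  refine hij ?_
  rw [coeff_mul, finsetSum_coeff]
  refine Finset.sum_eq_zero fun p hp => ?_
  rw [coeff_mul]
  refine Finset.sum_eq_zero fun r hr => ?_
  rw [Finset.HasAntidiagonal.mem_antidiagonal] at hp hr
  by_contra hne
  have h1 := hA _ _ (left_ne_zero_of_mul hne)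
  have h2 := hB _ _ (right_ne_zero_of_mul hne)
  omega

theorem derivative {A : ℤ[X][X]} {N : ℤ} (hA : TotDegLE A N) :
    TotDegLE (derivative A) (N - 1) := fun i j hij => by
  rw [coeff_derivative, show ((i : ℤ[X]) + 1) = C ((i : ℤ) + 1) by simp, coeff_mul_C] at hij
  have := hA _ _ (left_ne_zero_of_mul hij)
  push_cast at this
  omega

theorem C_mul {A : ℤ[X][X]} {N : ℤ} (a : ℤ) (hA : TotDegLE A N) :
    TotDegLE (C (C a) * A) N := fun i j hij => by
  rw [coeff_C_mul, coeff_C_mul] at hij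
  exact hA i j (right_ne_zero_of_mul hij)

theorem map_C {f : ℤ[X]} {n : ℕ} (hf : f.natDegree ≤ n) : TotDegLE (f.map C) n := fun i j hij => by
  rw [coeff_map, coeff_C] at hij
  split_ifs at hij with hj
  · have := (le_natDegree_of_ne_zero hij).trans hf
    omega
  · exact absurd rfl hij

theorem eval_coeff {A : ℤ[X][X]} {N : ℤ} (hA : TotDegLE A N) {l : ℕ} (hl : N < l) :
    (A.eval X).coeff l = 0 := by
  rw [eval_eq_sum_range, finsetSum_coeff]
  refine Finset.sum_eq_zero fun i _ => ?_
  rw [coeff_mul_X_pow']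
  split_ifs with h
  · by_contra hne
    have := hA _ _ hne
    omega
  · rfl

end TotDegLE

section derivation

variable {f : ℤ[X]} {q : PowerSeries ℤ[X]}

/-- The derivation `q d/dτ` of `ℤ[u]⟦τ⟧`. -/
noncomputable def qDeriv (q g : PowerSeries ℤ[X]) : PowerSeries ℤ[X] :=
  q * PowerSeries.derivative ℤ[X] g

theorem qDeriv_add (g h : PowerSeries ℤ[X]) : qDeriv q (g + h) = qDeriv q g + qDeriv q h := by
  simp [qDeriv, mul_add]

theorem qDeriv_mul (g h : PowerSeries ℤ[X]) :
    qDeriv q (g * h) = qDeriv q g * h + g * qDeriv q h := by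
  simp only [qDeriv, Derivation.leibniz, smul_eq_mul]; ring

theorem qDeriv_C_mul (a : ℤ[X]) (h : PowerSeries ℤ[X]) :
    qDeriv q (PowerSeries.C a * h) = PowerSeries.C a * qDeriv q h := by
  rw [qDeriv_mul]
  simp [qDeriv, PowerSeries.derivative_C]

theorem qDeriv_coeff (hq : PowerSeries.constantCoeff q = 1) {k : ℕ} {g : PowerSeries ℤ[X]}
    (hg : PowerSeries.X ^ (k + 1) ∣ g) :
    PowerSeries.X ^ k ∣ qDeriv q g ∧
      PowerSeries.coeff k (qDeriv q g) = (k + 1) * PowerSeries.coeff (k + 1) g := by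
  rw [PowerSeries.X_pow_dvd_iff] at hg
  have hd : PowerSeries.X ^ k ∣ PowerSeries.derivative ℤ[X] g := by
    rw [PowerSeries.X_pow_dvd_iff]
    intro m hm
    rw [PowerSeries.coeff_derivative, hg _ (by omega), zero_mul]
  refine ⟨hd.mul_left q, ?_⟩
  obtain ⟨h, hh⟩ := hd
  have h0 : PowerSeries.coeff k (PowerSeries.derivative ℤ[X] g) = PowerSeries.constantCoeff h := by
    rw [hh, PowerSeries.coeff_X_pow_mul', if_pos le_rfl]; simp
  have h1 : PowerSeries.coeff k (qDeriv q g) = PowerSeries.constantCoeff h := by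
    rw [qDeriv, hh, mul_left_comm, PowerSeries.coeff_X_pow_mul', if_pos le_rfl]
    simp [hq]
  rw [h1, ← h0, PowerSeries.coeff_derivative, mul_comm]

theorem constantCoeff_iterate_qDeriv (hq : PowerSeries.constantCoeff q = 1) {k : ℕ}
    {g : PowerSeries ℤ[X]} (hg : PowerSeries.X ^ k ∣ g) :
    PowerSeries.constantCoeff ((qDeriv q)^[k] g) = k.factorial * PowerSeries.coeff k g := by
  induction k generalizing g with
  | zero => simp
  | succ k ih =>
    obtain ⟨h1, h2⟩ := qDeriv_coeff hq hg
    rw [Function.iterate_succ_apply, ih h1, h2, Nat.factorial_succ]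
    push_cast; ring

theorem qDeriv_shiftHom (A : ℤ[X][X]) :
    qDeriv q (shiftHom X (4 * f) A) =
      4 * (PowerSeries.C f * q) * shiftHom X (4 * f) (derivative A) := by
  have : PowerSeries.derivative ℤ[X] (shiftHom X (4 * f) A) =
      PowerSeries.C (4 * f) * shiftHom X (4 * f) (derivative A) := by
    ext1 n
    rw [PowerSeries.coeff_derivative, coeff_shiftHom, PowerSeries.coeff_C_mul, coeff_shiftHom,
      taylor_coeff, taylor_coeff, ← hasseDeriv_one', ← LinearMap.comp_apply, hasseDeriv_comp]
    have hs : ((n + 1).choose n • hasseDeriv (R := ℤ[X]) (n + 1)) A =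
        C ((n : ℤ[X]) + 1) * hasseDeriv (n + 1) A := by
      rw [LinearMap.smul_apply, Nat.choose_succ_self_right, nsmul_eq_mul]; simp
    rw [hs, eval_mul, eval_C]
    ring
  rw [qDeriv, this, map_mul, show (PowerSeries.C (4 : ℤ[X])) = 4 from map_ofNat _ 4]
  ring

theorem qDeriv_sqrt (hq : IsSqrtSeries f q) (hf0 : f ≠ 0) :
    qDeriv q (PowerSeries.C f * q) =
      2 * PowerSeries.C f * shiftHom X (4 * f) (derivative (f.map C)) := by
  have h := congrArg (qDeriv q) hq.eq
  rw [sq, qDeriv_shiftHom, qDeriv_C_mul, qDeriv_mul] at h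
  rw [qDeriv_C_mul]
  have hq0 : q ≠ 0 := fun h => by simpa [h] using hq.const
  have hC : PowerSeries.C f ≠ 0 := fun h => hf0 (PowerSeries.C_injective (by simpa using h))
  have h2 : (2 : PowerSeries ℤ[X]) ≠ 0 := fun h => by
    have := congrArg PowerSeries.constantCoeff h
    rw [map_ofNat, map_zero] at this
    exact two_ne_zero this
  refine mul_left_cancel₀ (mul_ne_zero h2 hq0) ?_
  linear_combination h

/-- The odd part of the invariant derivation. -/
noncomputable def oddOp (F B : ℤ[X][X]) : ℤ[X][X] :=
  C (C 4) * (F * derivative B) + C (C 2) * (derivative F * B)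

theorem qDeriv_even (hq : IsSqrtSeries f q) (hf0 : f ≠ 0) (A B : ℤ[X][X]) :
    qDeriv q (shiftHom X (4 * f) A + shiftHom X (4 * f) B * (PowerSeries.C f * q)) =
      PowerSeries.C f * shiftHom X (4 * f) (oddOp (f.map C) B) +
        shiftHom X (4 * f) (C (C 4) * derivative A) * (PowerSeries.C f * q) := by
  rw [qDeriv_add, qDeriv_mul, qDeriv_shiftHom, qDeriv_shiftHom, qDeriv_sqrt hq hf0, oddOp]
  simp only [map_add, map_mul, map_ofNat]
  linear_combination 4 * PowerSeries.C f * shiftHom X (4 * f) (derivative B) * hq.eq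

theorem qDeriv_odd (hq : IsSqrtSeries f q) (hf0 : f ≠ 0) (A B : ℤ[X][X]) :
    qDeriv q (PowerSeries.C f * shiftHom X (4 * f) B +
        shiftHom X (4 * f) A * (PowerSeries.C f * q)) =
      PowerSeries.C f * (shiftHom X (4 * f) (oddOp (f.map C) A) +
        shiftHom X (4 * f) (C (C 4) * derivative B) * (PowerSeries.C f * q)) := by
  rw [qDeriv_add, qDeriv_C_mul, qDeriv_mul, qDeriv_shiftHom, qDeriv_shiftHom, qDeriv_sqrt hq hf0,
    oddOp]
  simp only [map_add, map_mul, map_ofNat]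
  linear_combination 4 * PowerSeries.C f * shiftHom X (4 * f) (derivative A) * hq.eq

theorem TotDegLE.oddOp {F B : ℤ[X][X]} {N : ℤ} (hF : TotDegLE F 6) (hB : TotDegLE B N) :
    TotDegLE (oddOp F B) (N + 5) :=
  (((hF.mul hB.derivative).mono (by omega)).C_mul 4).add
    (((hF.derivative.mul hB).mono (by omega)).C_mul 2)

/-- The iterates of the square of the invariant derivation. -/
theorem qDeriv_iterate (hq : IsSqrtSeries f q) (hf0 : f ≠ 0) (hf : f.natDegree ≤ 6) {A B : ℤ[X][X]}
    {N : ℤ} (hA : TotDegLE A N) (hB : TotDegLE B (N - 6)) (j : ℕ) :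
    ∃ A' B' : ℤ[X][X], TotDegLE A' (N + 4 * j) ∧ TotDegLE B' (N + 4 * j - 6) ∧
      (qDeriv q)^[2 * j] (shiftHom X (4 * f) A + shiftHom X (4 * f) B * (PowerSeries.C f * q)) =
        PowerSeries.C (f ^ j) *
          (shiftHom X (4 * f) A' + shiftHom X (4 * f) B' * (PowerSeries.C f * q)) := by
  induction j with
  | zero => exact ⟨A, B, hA.mono (by simp), hB.mono (by simp), by simp⟩
  | succ j ih =>
    obtain ⟨A', B', hA', hB', h⟩ := ih
    have hF : TotDegLE (f.map C) 6 := (TotDegLE.map_C hf).mono (by simp)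
    refine ⟨oddOp (f.map C) (C (C 4) * Polynomial.derivative A'),
      C (C 4) * Polynomial.derivative (oddOp (f.map C) B'),
      (TotDegLE.oddOp hF (hA'.derivative.C_mul 4)).mono (by push_cast; omega),
      ((TotDegLE.oddOp hF hB').derivative.C_mul 4).mono (by push_cast; omega), ?_⟩
    rw [show 2 * (j + 1) = 2 * j + 1 + 1 by ring, Function.iterate_succ_apply',
      Function.iterate_succ_apply', h, qDeriv_C_mul, qDeriv_even hq hf0, qDeriv_C_mul,
      qDeriv_odd hq hf0, ← mul_assoc, ← map_mul, pow_succ]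

theorem constantCoeff_qDeriv_iterate (hq : IsSqrtSeries f q) (hf0 : f ≠ 0) (hf : f.natDegree ≤ 6)
    {A B : ℤ[X][X]} {N : ℤ} (hA : TotDegLE A N) (hB : TotDegLE B (N - 6)) (k : ℕ) :
    ∃ (e : ℕ) (P : ℤ[X]), (∀ l : ℕ, N + 2 * k < l → P.coeff l = 0) ∧
      PowerSeries.constantCoeff ((qDeriv q)^[k]
        (shiftHom X (4 * f) A + shiftHom X (4 * f) B * (PowerSeries.C f * q))) = f ^ e * P := by
  have hF : TotDegLE (f.map C) 6 := (TotDegLE.map_C hf).mono (by simp)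
  obtain ⟨j, rfl | rfl⟩ := k.even_or_odd'
  all_goals obtain ⟨A', B', hA', hB', h⟩ := qDeriv_iterate hq hf0 hf hA hB j
  · refine ⟨j, (A' + B' * f.map C).eval X, fun l hl => TotDegLE.eval_coeff
      (hA'.add ((hB'.mul hF).mono (by omega))) (by omega), ?_⟩
    rw [h]
    simp [hq.const, eval_map, eval₂_C_X]
  · refine ⟨j + 1, (oddOp (f.map C) B' + C (C 4) * Polynomial.derivative A').eval X, fun l hl =>
      TotDegLE.eval_coeff (((TotDegLE.oddOp hF hB').mono
        (show _ ≤ N + 4 * j + 2 by omega)).add ((hA'.derivative.C_mul 4).mono (by omega)))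
        (by push_cast at hl; omega), ?_⟩
    rw [Function.iterate_succ_apply', h, qDeriv_C_mul, qDeriv_even hq hf0]
    simp [hq.const]
    ring

/-- Vanishing to high order along the diagonal is implied by few linear conditions. -/
theorem X_pow_dvd_of_coeff_eq_zero (hq : IsSqrtSeries f q) (hf0 : f.coeff 0 ≠ 0)
    (hf : f.natDegree ≤ 6) {A B : ℤ[X][X]} {N d : ℕ} (hA : TotDegLE A N) (hB : TotDegLE B (N - 6))
    (h : ∀ k < d, ∀ l ≤ N + 2 * k, (PowerSeries.coeff k (shiftHom X (4 * f) A +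
      shiftHom X (4 * f) B * (PowerSeries.C f * q))).coeff l = 0) :
    PowerSeries.X ^ d ∣ shiftHom X (4 * f) A + shiftHom X (4 * f) B * (PowerSeries.C f * q) := by
  have hf0' : f ≠ 0 := fun h => hf0 (by simp [h])
  induction d with
  | zero => simp
  | succ k ih =>
    have hk := ih fun k' hk' => h k' (by omega)
    suffices PowerSeries.coeff k (shiftHom X (4 * f) A +
        shiftHom X (4 * f) B * (PowerSeries.C f * q)) = 0 by
      rw [PowerSeries.X_pow_dvd_iff] at hk ⊢
      intro m hm
      rcases Nat.lt_succ_iff_lt_or_eq.1 hm with hm | rfl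
      · exact hk m hm
      · exact this
    obtain ⟨e, P, hP, heq⟩ := constantCoeff_qDeriv_iterate hq hf0' hf hA hB k
    rw [constantCoeff_iterate_qDeriv hq.const hk] at heq
    have hdvd : (X : ℤ[X]) ^ (N + 2 * k + 1) ∣ f ^ e * P := by
      rw [← heq, ← nsmul_eq_mul, X_pow_dvd_iff]
      intro l hl
      rw [coeff_smul, h k (by omega) l (by omega), smul_zero]
    have hP0 : P = 0 := by
      have : (X : ℤ[X]) ^ (N + 2 * k + 1) ∣ P := by
        refine prime_X.pow_dvd_of_dvd_mul_left _ (fun hX => ?_) hdvd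
        exact hf0 (X_dvd_iff.1 (prime_X.dvd_of_dvd_pow hX))
      ext l
      rcases lt_or_ge l (N + 2 * k + 1) with hl | hl
      · simpa using X_pow_dvd_iff.1 this l hl
      · simpa using hP l (by omega)
    rw [hP0, mul_zero] at heq
    exact (mul_eq_zero.1 heq).resolve_left (by exact_mod_cast Nat.factorial_ne_zero k)

end derivation

attribute [local instance] Matrix.seminormedAddCommGroup in
/-- Siegel's lemma with natural number bounds. -/
theorem exists_small_solution {α β : Type*} [Fintype α] [Fintype β] (A : Matrix α β ℤ)
    {K E N : ℕ} (hK : 1 ≤ K) (hA : ∀ i j, (A i j).natAbs ≤ K) (h0 : 0 < Fintype.card α)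
    (hlt : Fintype.card α < Fintype.card β)
    (hE : Fintype.card α ≤ E * (Fintype.card β - Fintype.card α)) (hN : Fintype.card β ≤ N) :
    ∃ t : β → ℤ, t ≠ 0 ∧ A.mulVec t = 0 ∧ ∀ j, (t j).natAbs ≤ (N * K) ^ E := by
  obtain ⟨t, ht0, htA, ht⟩ := Int.Matrix.exists_ne_zero_int_vec_norm_le A hlt h0
  refine ⟨t, ht0, htA, fun j => ?_⟩
  have hnorm : ‖A‖ ≤ K := by
    rw [Matrix.norm_le_iff (by positivity)]
    intro i j
    rw [Int.norm_eq_abs, ← Int.cast_abs, Int.abs_eq_natAbs]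
    exact_mod_cast hA i j
  have hK' : (1 : ℝ) ≤ K := by exact_mod_cast hK
  have hN' : (Fintype.card β : ℝ) ≤ N := by exact_mod_cast hN
  have hβ : (1 : ℝ) ≤ Fintype.card β := by exact_mod_cast (by omega : 1 ≤ Fintype.card β)
  have hbase : (Fintype.card β : ℝ) * max 1 ‖A‖ ≤ N * K :=
    mul_le_mul hN' (max_le hK' hnorm) (by positivity) (by positivity)
  have hexp : (Fintype.card α : ℝ) / ((Fintype.card β : ℝ) - Fintype.card α) ≤ E := by
    rw [div_le_iff₀ (by rw [sub_pos]; exact_mod_cast hlt)]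
    rw [← Nat.cast_sub hlt.le]
    exact_mod_cast hE
  have hone : (1 : ℝ) ≤ N * K := by nlinarith
  have hj : ‖t j‖ ≤ ((N * K : ℕ) : ℝ) ^ E := by
    refine (norm_le_pi_norm t j).trans (ht.trans ?_)
    calc _ ≤ ((N : ℝ) * K) ^ ((Fintype.card α : ℝ) / ((Fintype.card β : ℝ) - Fintype.card α)) := by
          refine Real.rpow_le_rpow (by positivity) hbase ?_
          exact div_nonneg (by positivity) (by rw [sub_nonneg]; exact_mod_cast hlt.le)
      _ ≤ ((N : ℝ) * K) ^ (E : ℝ) := Real.rpow_le_rpow_of_exponent_le hone hexp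
      _ = _ := by rw [Real.rpow_natCast]; push_cast; rfl
  rw [Int.norm_eq_abs, ← Int.cast_abs, Int.abs_eq_natAbs] at hj
  exact_mod_cast hj

/-- The degree in the inner variable is at most `M` and that in the outer variable at most `N`. -/
def BiDegLE {R : Type*} [Semiring R] (a : R[X][X]) (M N : ℕ) : Prop :=
  ∀ i j : ℕ, (a.coeff i).coeff j ≠ 0 → j ≤ M ∧ i ≤ N

/-- The bivariate integer polynomial with a given matrix of coefficients. -/
noncomputable def polyOfCoeffs {M N : ℕ} (t : Fin M × Fin N → ℤ) : ℤ[X][X] :=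
  ∑ v, t v • monomial (v.2 : ℕ) (X ^ (v.1 : ℕ) : ℤ[X])

section polyOfCoeffs

variable {M N : ℕ} (t : Fin M × Fin N → ℤ)

theorem coeff_polyOfCoeffs (v : Fin M × Fin N) :
    ((polyOfCoeffs t).coeff v.2).coeff v.1 = t v := by
  classical
  rw [polyOfCoeffs, finsetSum_coeff, finsetSum_coeff, Finset.sum_eq_single v]
  · simp
  · intro w _ hw
    rw [coeff_smul, coeff_monomial]
    split_ifs with h2
    · rw [coeff_smul, coeff_X_pow, if_neg, smul_zero]
      intro h1
      exact hw (Prod.ext (Fin.ext h1.symm) (Fin.ext h2))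
    · simp
  · simp

theorem biDegLE_polyOfCoeffs {M N : ℕ} (t : Fin (M + 1) × Fin (N + 1) → ℤ) :
    BiDegLE (polyOfCoeffs t) M N := by
  intro i j h
  by_contra hlt
  refine h ?_
  rw [polyOfCoeffs, finsetSum_coeff, finsetSum_coeff]
  refine Finset.sum_eq_zero fun v _ => ?_
  rw [coeff_smul, coeff_monomial]
  have := v.1.2
  have := v.2.2
  split_ifs with h2
  · rw [coeff_smul, coeff_X_pow, if_neg (by omega), smul_zero]
  · simp

theorem poly_polyOfCoeffs_le {K : ℕ} (h : ∀ v, (t v).natAbs ≤ K) :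
    RingSize.int.poly.poly (polyOfCoeffs t) ≤ M * N * K := by
  refine (RingSize.sum _ _ _).trans ?_
  calc _ ≤ ∑ _v : Fin M × Fin N, K := by
        refine Finset.sum_le_sum fun v _ => ?_
        rw [smul_monomial, RingSize.poly_monomial, zsmul_eq_mul,
          show ((t v : ℤ) : ℤ[X]) = C (t v) by simp]
        refine (RingSize.mul _ _ _).trans ?_
        rw [RingSize.poly_C]
        exact (Nat.mul_le_mul_left _ (RingSize.poly_X_pow _ _)).trans (by simpa using h v)
    _ = _ := by simp [mul_comm, mul_left_comm]

end polyOfCoeffs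

/-- The expansion of `A + Bσ` along the diagonal. -/
noncomputable def diagExpansion (f : ℤ[X]) (q : PowerSeries ℤ[X]) (A B : ℤ[X][X]) :
    PowerSeries ℤ[X] :=
  shiftHom X (4 * f) A + shiftHom X (4 * f) B * (PowerSeries.C f * q)

section entries

variable {f : ℤ[X]} {q : PowerSeries ℤ[X]}

theorem one_le_poly_size (hf0 : f ≠ 0) : 1 ≤ RingSize.int.poly f :=
  Nat.one_le_iff_ne_zero.2 fun h => hf0 <| by
    ext i
    have := RingSize.int.coeff_le f i
    simp only [h, RingSize.int_toFun, Nat.le_zero, Int.natAbs_eq_zero] at this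
    simpa using this

theorem size_coeff_shiftHom_monomial (i j k : ℕ) :
    RingSize.int.poly (PowerSeries.coeff k (shiftHom X (4 * f) (monomial j (X ^ i)))) ≤
      (4 * RingSize.int.poly f) ^ k * 2 ^ j := by
  rw [coeff_shiftHom]
  refine (RingSize.mul _ _ _).trans (Nat.mul_le_mul ((RingSize.pow _ _ _).trans
    (Nat.pow_le_pow_left ((RingSize.mul _ _ _).trans
      (Nat.mul_le_mul_right _ (RingSize.natCast _ 4))) _)) ?_)
  refine (RingSize.coeff_le _ _ _).trans ((RingSize.taylor_le RingSize.int.poly (B := 2)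
    (natDegree_monomial_le _) X ?_).trans ?_)
  · have := RingSize.int.poly_X; omega
  · rw [RingSize.poly_monomial]
    exact (Nat.mul_le_mul_left _ (RingSize.poly_X_pow _ _)).trans (by simp)

theorem size_coeff_shiftHom_monomial_mul (hq : IsSqrtSeries f q) (hf0 : f ≠ 0) (i j k : ℕ) :
    RingSize.int.poly (PowerSeries.coeff k
      (shiftHom X (4 * f) (monomial j (X ^ i)) * (PowerSeries.C f * q))) ≤
      (2048 * RingSize.int.poly f) ^ (k + j + 1) := by
  have hL := one_le_poly_size hf0
  set L := RingSize.int.poly f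
  rw [PowerSeries.coeff_mul]
  refine (RingSize.sum _ _ _).trans ?_
  calc _ ≤ ∑ p ∈ Finset.HasAntidiagonal.antidiagonal k, (1024 * L) ^ k * (2 ^ j * L) := by
        refine Finset.sum_le_sum fun p hp => ?_
        rw [Finset.HasAntidiagonal.mem_antidiagonal] at hp
        refine (RingSize.mul _ _ _).trans ?_
        rw [PowerSeries.coeff_C_mul]
        calc _ ≤ ((4 * L) ^ p.1 * 2 ^ j) * (L * (1024 * L) ^ p.2) :=
              Nat.mul_le_mul (size_coeff_shiftHom_monomial _ _ _) ((RingSize.mul _ _ _).trans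
                (Nat.mul_le_mul_left _ (hq.size _)))
          _ ≤ ((1024 * L) ^ p.1 * 2 ^ j) * (L * (1024 * L) ^ p.2) := by gcongr; omega
          _ = _ := by rw [← hp, pow_add]; ring
    _ = (k + 1) * ((1024 * L) ^ k * (2 ^ j * L)) := by simp
    _ ≤ 2 ^ k * ((1024 * L) ^ k * (2 ^ j * L)) := by gcongr; exact Nat.lt_two_pow_self
    _ = (2048 * L) ^ k * (2 ^ j * L) := by rw [← mul_assoc, ← mul_pow]; ring_nf
    _ ≤ (2048 * L) ^ k * ((2048 * L) ^ j * (2048 * L)) := by gcongr <;> omega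
    _ = _ := by ring

end entries

/-- The sections vanishing to high order along the diagonal, with small coefficients. -/
theorem exists_auxiliary_section {f : ℤ[X]} {q : PowerSeries ℤ[X]} (hq : IsSqrtSeries f q)
    (hf0 : f.coeff 0 ≠ 0) (hf : f.natDegree ≤ 6) :
    ∃ C₀ : ℕ, 1 ≤ C₀ ∧ ∀ m n d D₁ D₂ : ℕ, 2 * m + 6 = D₁ + d → 2 * n + 6 = D₂ + d → 0 < d →
      2 ≤ n → 2 ≤ m → D₂ ≤ D₁ → D₂ ≤ 2 * d → 16 * d ^ 2 ≤ 5 * (D₁ * D₂) → 100 * (m + n + 6) ≤ d ^ 2 →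
      2 * ((m + 4) * (n + 4)) ≤ 2 ^ d →
      ∃ A B : ℤ[X][X], (A ≠ 0 ∨ B ≠ 0) ∧ BiDegLE A (m + 3) (n + 3) ∧ BiDegLE B m n ∧
        PowerSeries.X ^ d ∣ diagExpansion f q A B ∧
        RingSize.int.poly.poly A ≤ C₀ ^ D₁ ∧ RingSize.int.poly.poly B ≤ C₀ ^ D₁ := by
  have hf0' : f ≠ 0 := fun h => hf0 (by simp [h])
  set L := RingSize.int.poly f with hLdef
  have hL : 1 ≤ L := one_le_poly_size hf0'
  obtain ⟨P, hP⟩ : ∃ P, P = (2048 * L) ^ 4 := ⟨_, rfl⟩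
  have hP0 : 0 < P := by rw [hP]; positivity
  refine ⟨2 * P ^ 49, Nat.mul_pos two_pos (by positivity), ?_⟩
  intro m n d D₁ D₂ hm hn hd hn2 hm2 hD hD2 hDD hdd h2d
  let β := (Fin (m + 3 + 1) × Fin (n + 3 + 1)) ⊕ (Fin (m + 1) × Fin (n + 1))
  let α := Σ k : Fin d, Fin (m + 3 + (n + 3) + 2 * k + 1)
  let φ : β → PowerSeries ℤ[X] := Sum.elim
    (fun v => shiftHom X (4 * f) (monomial (v.2 : ℕ) (X ^ (v.1 : ℕ))))
    (fun v => shiftHom X (4 * f) (monomial (v.2 : ℕ) (X ^ (v.1 : ℕ))) * (PowerSeries.C f * q))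
  let A : Matrix α β ℤ := fun r v => (PowerSeries.coeff (r.1 : ℕ) (φ v)).coeff r.2
  have hcα : Fintype.card α = d * (m + n + 6) + d ^ 2 := by
    simp only [α, Fintype.card_sigma, Fintype.card_fin]
    rw [Fin.sum_univ_eq_sum_range (fun k => m + 3 + (n + 3) + 2 * k + 1)]
    clear * -
    induction d with
    | zero => simp
    | succ d ih => rw [Finset.sum_range_succ, ih]; ring
  have hcβ : Fintype.card β = (m + 4) * (n + 4) + (m + 1) * (n + 1) := by
    simp [β]
  have hgap : d ^ 2 ≤ 20 * (Fintype.card β - Fintype.card α) := by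
    rw [hcα, hcβ]
    suffices d ^ 2 + 20 * (d * (m + n + 6) + d ^ 2) ≤
      20 * ((m + 4) * (n + 4) + (m + 1) * (n + 1)) by omega
    have h1 : 4 * ((m + 3) * (n + 3)) = (D₁ + d) * (D₂ + d) := by rw [← hm, ← hn]; ring
    have h2 : 2 * (d * (m + n + 6)) = d * (D₁ + d) + d * (D₂ + d) := by rw [← hm, ← hn]; ring
    nlinarith
  have hcard0 : 0 < Fintype.card α := by rw [hcα]; positivity
  have hlt : Fintype.card α < Fintype.card β := by
    have : 0 < d ^ 2 := by positivity
    omega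
  have hD1d : 3 * d ≤ 2 * D₁ := by
    by_contra hlt
    nlinarith
  set E := 48 * D₁ / d + 1 with hE
  have hEd : E * d ≤ 49 * D₁ := by
    have := Nat.div_mul_le_self (48 * D₁) d
    rw [hE, add_mul]; omega
  have hEd' : 48 * D₁ ≤ E * d := by
    rw [hE, mul_comm _ d]; exact (Nat.lt_mul_div_succ _ hd).le
  have hEα : Fintype.card α ≤ E * (Fintype.card β - Fintype.card α) := by
    have h1 : 20 * Fintype.card α ≤ 48 * D₁ * d := by
      have h2 : 2 * (d * (m + n + 6)) = d * D₁ + d * D₂ + 2 * d ^ 2 := by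
        have : 2 * (m + n + 6) = D₁ + d + (D₂ + d) := by omega
        calc _ = d * (2 * (m + n + 6)) := by ring
          _ = _ := by rw [this]; ring
      have h3 : d * D₂ ≤ d * D₁ := Nat.mul_le_mul_left _ hD
      have h4 : 3 * d * d ≤ 2 * D₁ * d := Nat.mul_le_mul_right _ hD1d
      rw [hcα]
      linarith
    refine Nat.le_of_mul_le_mul_left (?_ : 20 * _ ≤ 20 * _) (by norm_num)
    calc _ ≤ 48 * D₁ * d := h1
      _ ≤ E * d * d := Nat.mul_le_mul_right _ hEd'
      _ = E * d ^ 2 := by ring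
      _ ≤ E * (20 * (Fintype.card β - Fintype.card α)) := Nat.mul_le_mul_left _ hgap
      _ = _ := by ring
  have hA : ∀ r v, (A r v).natAbs ≤ (2048 * L) ^ (3 * d) := by
    rintro ⟨k, l⟩ v
    refine (RingSize.int.coeff_le _ _).trans ?_
    have hk := k.2
    rcases v with v | v
    · have := v.2.2
      refine (size_coeff_shiftHom_monomial _ _ _).trans ?_
      calc (4 * L) ^ (k : ℕ) * 2 ^ (v.2 : ℕ) ≤ (2048 * L) ^ (k : ℕ) * (2048 * L) ^ (v.2 : ℕ) := by
            gcongr <;> omega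
        _ ≤ _ := by
            rw [← pow_add]; exact Nat.pow_le_pow_right (by omega) (by omega)
    · have := v.2.2
      exact (size_coeff_shiftHom_monomial_mul hq hf0' _ _ _).trans
        (Nat.pow_le_pow_right (by omega) (by omega))
  have hNβ : Fintype.card β ≤ 2 ^ d := by
    rw [hcβ]; nlinarith
  obtain ⟨t, ht0, htA, ht⟩ := exists_small_solution A (Nat.one_le_pow _ _ (by omega)) hA hcard0 hlt
    hEα hNβ
  have hbound : ∀ v, (t v).natAbs ≤ P ^ (49 * D₁) := fun v => by
    refine (ht v).trans ?_
    calc (2 ^ d * (2048 * L) ^ (3 * d)) ^ E ≤ ((2048 * L) ^ d * (2048 * L) ^ (3 * d)) ^ E := by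
          gcongr; omega
      _ = P ^ (E * d) := by rw [hP, ← pow_add, ← pow_mul, ← pow_mul]; congr 1; ring
      _ ≤ _ := Nat.pow_le_pow_right hP0 hEd
  have hcount : (m + 4) * (n + 4) ≤ 2 ^ D₁ := by
    have : 2 ^ d ≤ 2 ^ D₁ := Nat.pow_le_pow_right two_pos (by omega)
    omega
  have hfin : (m + 4) * (n + 4) * P ^ (49 * D₁) ≤
      (2 * P ^ 49) ^ D₁ := by
    rw [mul_pow, ← pow_mul]
    exact Nat.mul_le_mul_right _ hcount
  refine ⟨polyOfCoeffs fun v => t (.inl v), polyOfCoeffs fun v => t (.inr v), ?_,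
    biDegLE_polyOfCoeffs _, biDegLE_polyOfCoeffs _, ?_,
    (poly_polyOfCoeffs_le _ fun v => hbound _).trans hfin,
    (poly_polyOfCoeffs_le _ fun v => hbound _).trans (le_trans ?_ hfin)⟩
  · by_contra! h
    refine ht0 (funext ?_)
    rintro (v | v)
    · rw [← coeff_polyOfCoeffs (fun v => t (.inl v)) v, h.1]; simp
    · rw [← coeff_polyOfCoeffs (fun v => t (.inr v)) v, h.2]; simp
  · have hexp : diagExpansion f q (polyOfCoeffs fun v => t (.inl v))
        (polyOfCoeffs fun v => t (.inr v)) = ∑ v, t v • φ v := by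
      rw [Fintype.sum_sum_type, diagExpansion, polyOfCoeffs, polyOfCoeffs, map_sum, map_sum,
        Finset.sum_mul]
      simp only [map_zsmul, smul_mul_assoc, φ, Sum.elim_inl, Sum.elim_inr]
    refine X_pow_dvd_of_coeff_eq_zero (N := m + n + 6) hq hf0 hf ?_ ?_ ?_
    · intro i j h
      have := biDegLE_polyOfCoeffs _ i j h
      push_cast; omega
    · intro i j h
      have := biDegLE_polyOfCoeffs _ i j h
      push_cast; omega
    · intro k hk l hl
      change (PowerSeries.coeff k (diagExpansion f q _ _)).coeff l = 0
      have := congrFun htA ⟨⟨k, hk⟩, ⟨l, by simp only; omega⟩⟩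
      simp only [Matrix.mulVec, dotProduct, A, Pi.zero_apply] at this
      rw [hexp, map_sum, finsetSum_coeff, ← this]
      refine Finset.sum_congr rfl fun v _ => ?_
      rw [map_zsmul, coeff_smul, smul_eq_mul, mul_comm]
  · gcongr <;> omega

theorem coeff_coeff_swap {R : Type*} [CommRing R] (a : R[X][X]) (i j : ℕ) :
    ((Bivariate.swap a).coeff i).coeff j = (a.coeff j).coeff i := by
  induction a using Polynomial.induction_on' with
  | add p q hp hq => simp [hp, hq]
  | monomial n p =>
    induction p using Polynomial.induction_on' with
    | add p q hp hq => simp only [map_add, coeff_add, hp, hq]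
    | monomial m r =>
      rw [Bivariate.swap_monomial_monomial]
      simp only [coeff_monomial]
      split_ifs <;> simp_all [coeff_monomial]

namespace BiDegLE

section

variable {R : Type*} [CommRing R] {a b : R[X][X]} {M N M' N' : ℕ}

theorem iff_natDegree : BiDegLE a M N ↔ a.natDegree ≤ N ∧ (Bivariate.swap a).natDegree ≤ M := by
  constructor
  · intro h
    constructor
    · rw [natDegree_le_iff_coeff_eq_zero]
      intro i hi
      ext j
      by_contra hne
      exact absurd (h i j (by simpa using hne)).2 (by omega)
    · rw [natDegree_le_iff_coeff_eq_zero]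
      intro i hi
      ext j
      rw [coeff_coeff_swap]
      by_contra hne
      exact absurd (h j i (by simpa using hne)).1 (by omega)
  · rintro ⟨h1, h2⟩ i j hij
    refine ⟨?_, (le_natDegree_of_ne_zero fun h => hij (by simp [h])).trans h1⟩
    rw [← coeff_coeff_swap] at hij
    exact (le_natDegree_of_ne_zero fun h => hij (by simp [h])).trans h2

theorem mono (h : BiDegLE a M N) (hM : M ≤ M') (hN : N ≤ N') : BiDegLE a M' N' :=
  fun i j hij => ⟨(h i j hij).1.trans hM, (h i j hij).2.trans hN⟩

theorem add (ha : BiDegLE a M N) (hb : BiDegLE b M N) : BiDegLE (a + b) M N := by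
  rw [iff_natDegree] at *
  rw [map_add]
  exact ⟨natDegree_add_le_of_degree_le ha.1 hb.1, natDegree_add_le_of_degree_le ha.2 hb.2⟩

theorem neg (ha : BiDegLE a M N) : BiDegLE (-a) M N := fun i j h => ha i j (by simpa using h)

theorem sub (ha : BiDegLE a M N) (hb : BiDegLE b M N) : BiDegLE (a - b) M N := by
  rw [sub_eq_add_neg]; exact ha.add hb.neg

theorem mul (ha : BiDegLE a M N) (hb : BiDegLE b M' N') : BiDegLE (a * b) (M + M') (N + N') := by
  rw [iff_natDegree] at *
  rw [map_mul]
  exact ⟨natDegree_mul_le_of_le ha.1 hb.1, natDegree_mul_le_of_le ha.2 hb.2⟩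

theorem pow (ha : BiDegLE a M N) (k : ℕ) : BiDegLE (a ^ k) (k * M) (k * N) := by
  rw [iff_natDegree] at *
  rw [map_pow]
  exact ⟨natDegree_pow_le_of_le k ha.1, natDegree_pow_le_of_le k ha.2⟩

theorem C_of_natDegree {f : R[X]} (hf : f.natDegree ≤ M) : BiDegLE (C f : R[X][X]) M 0 := by
  rw [iff_natDegree, Bivariate.swap_C]
  exact ⟨by simp, natDegree_map_le.trans hf⟩

theorem map_C_of_natDegree {f : R[X]} (hf : f.natDegree ≤ N) :
    BiDegLE (f.map C : R[X][X]) 0 N := by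
  rw [iff_natDegree, Bivariate.swap_map_C]
  exact ⟨natDegree_map_le.trans hf, by simp⟩

theorem of_pow_mul [IsDomain R] {d : ℕ} (h : BiDegLE ((X - C X) ^ d * a) (M + d) (N + d)) :
    BiDegLE a M N := by
  rw [iff_natDegree] at *
  rcases eq_or_ne a 0 with rfl | ha
  · simp
  have hX : (X - C X : R[X][X]) ≠ 0 := X_sub_C_ne_zero _
  have hs : Bivariate.swap (X - C X : R[X][X]) = -(X - C X) := by
    rw [map_sub, Bivariate.swap_X, Bivariate.swap_Y, neg_sub]
  rw [map_mul, map_pow, hs, natDegree_mul (pow_ne_zero _ hX) ha,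
    natDegree_mul (pow_ne_zero _ (neg_ne_zero.2 hX)) (by simpa using ha), natDegree_pow,
    natDegree_pow, natDegree_neg, natDegree_X_sub_C] at h
  omega

end

end BiDegLE

theorem divX_iterate_X_pow_mul {R : Type*} [CommRing R] (d : ℕ) (p : R[X]) :
    divX^[d] (X ^ d * p) = p := by
  induction d with
  | zero => simp
  | succ d ih =>
    have : divX (X * (X ^ d * p)) = X ^ d * p := by ext i; rw [coeff_divX, coeff_X_mul]
    rw [Function.iterate_succ_apply, pow_succ', mul_assoc, this, ih]

/-- The quotient by a power of `X - r` has controlled size. -/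
theorem RingSize.poly_le_of_pow_mul {R : Type*} [CommRing R] (ν : RingSize R) {r : R}
    (hr : ν r ≤ 1) {a b : R[X]} {d n : ℕ} (h : (X - C r) ^ d * b = a) (ha : a.natDegree ≤ n) :
    ν.poly b ≤ 4 ^ n * ν.poly a := by
  have h1 : taylor r a = X ^ d * taylor r b := by rw [← h, taylor_mul, taylor_pow]; simp
  have h2 : b = taylor (-r) (divX^[d] (taylor r a)) := by
    rw [h1, divX_iterate_X_pow_mul, taylor_taylor]; simp
  have h4 : (divX^[d] (taylor r a)).natDegree ≤ n := by
    have : ∀ (k : ℕ) (p : R[X]), p.natDegree ≤ n → (divX^[k] p).natDegree ≤ n := by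
      intro k
      induction k with
      | zero => simp
      | succ k ih =>
        intro p hp
        rw [Function.iterate_succ_apply]
        exact ih _ (by rw [natDegree_divX_eq_natDegree_tsub_one]; omega)
    exact this _ _ (by rwa [natDegree_taylor])
  calc ν.poly b ≤ 2 ^ n * ν.poly (divX^[d] (taylor r a)) := by
        conv_lhs => rw [h2]
        exact ν.taylor_le h4 _ (by rw [RingSize.neg]; omega)
    _ ≤ 2 ^ n * (2 ^ n * ν.poly a) := by
        gcongr
        exact (ν.divX_pow_le _ _).trans (ν.taylor_le ha _ (by omega))
    _ = _ := by rw [← mul_assoc, ← mul_pow]; norm_num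

section norm

variable {f : ℤ[X]} {q : PowerSeries ℤ[X]}

/-- Divisibility by a power of the diagonal can be read off from the expansion. -/
theorem diag_pow_dvd_of_X_pow_dvd (hf0 : f ≠ 0) {a : ℤ[X][X]} {d : ℕ}
    (h : PowerSeries.X ^ d ∣ shiftHom X (4 * f) a) : (X - C X) ^ d ∣ a := by
  rw [X_sub_C_pow_dvd_iff, ← taylor_apply, X_pow_dvd_iff]
  rw [PowerSeries.X_pow_dvd_iff] at h
  intro k hk
  have := h k hk
  rw [coeff_shiftHom] at this
  exact (mul_eq_zero.1 this).resolve_left (pow_ne_zero _ (mul_ne_zero (by norm_num) hf0))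

theorem shiftHom_norm (hq : IsSqrtSeries f q) (A B : ℤ[X][X]) :
    shiftHom X (4 * f) (A ^ 2 - B ^ 2 * (C f * f.map C)) =
      diagExpansion f q A B * diagExpansion f q A (-B) := by
  simp only [diagExpansion, map_sub, map_mul, map_pow, shiftHom_C, ← hq.eq, map_neg]
  ring

/-- The norm of a section vanishing along the diagonal. -/
theorem exists_norm_quotient (hq : IsSqrtSeries f q) (hf0 : f ≠ 0) (hf : f.natDegree ≤ 6)
    (hns : ∀ a b : ℤ[X], ∀ c : ℤ, c ≠ 0 → a ^ 2 = b ^ 2 * (f * C c) → b = 0) {A B : ℤ[X][X]}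
    {m n d D₁ D₂ K : ℕ} (hm : 2 * m + 6 = D₁ + d) (hn : 2 * n + 6 = D₂ + d) (hAB : A ≠ 0 ∨ B ≠ 0)
    (hA : BiDegLE A (m + 3) (n + 3)) (hB : BiDegLE B m n)
    (hd : PowerSeries.X ^ d ∣ diagExpansion f q A B)
    (hA' : RingSize.int.poly.poly A ≤ K) (hB' : RingSize.int.poly.poly B ≤ K) :
    ∃ R : ℤ[X][X], R ≠ 0 ∧ (X - C X) ^ d * R = A ^ 2 - B ^ 2 * (C f * f.map C) ∧
      BiDegLE R D₁ D₂ ∧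
      RingSize.int.poly.poly R ≤ 4 ^ (D₂ + d) * (K ^ 2 * (1 + RingSize.int.poly f ^ 2)) := by
  have hdvd : (X - C X) ^ d ∣ A ^ 2 - B ^ 2 * (C f * f.map C) :=
    diag_pow_dvd_of_X_pow_dvd hf0 (by rw [shiftHom_norm hq]; exact hd.mul_right _)
  obtain ⟨R, hR⟩ := hdvd
  have hdeg : BiDegLE (A ^ 2 - B ^ 2 * (C f * f.map C)) (D₁ + d) (D₂ + d) := by
    refine ((hA.pow 2).mono (by omega) (by omega)).sub ?_
    exact ((hB.pow 2).mul ((BiDegLE.C_of_natDegree hf).mul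
      (BiDegLE.map_C_of_natDegree hf))).mono (by omega) (by omega)
  have hL : RingSize.int.poly.poly (f.map C) = RingSize.int.poly f := by
    rw [RingSize.poly_eq_of_natDegree_lt _ (Nat.lt_succ_of_le natDegree_map_le),
      RingSize.poly_eq_sum]
    exact Finset.sum_congr rfl fun i _ => by rw [coeff_map, RingSize.poly_C]
  refine ⟨R, ?_, hR.symm, BiDegLE.of_pow_mul (hR ▸ hdeg), ?_⟩
  · rintro rfl
    rw [mul_zero, sub_eq_zero] at hR
    have hlc := congrArg leadingCoeff hR
    simp only [leadingCoeff_mul, leadingCoeff_pow, leadingCoeff_C,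
      leadingCoeff_map_of_injective (C_injective)] at hlc
    have hB0 : B = 0 := leadingCoeff_eq_zero.1
      (hns _ _ _ (leadingCoeff_ne_zero.2 hf0) hlc)
    simp [hB0] at hR hAB
    exact hAB hR
  · refine (RingSize.poly_le_of_pow_mul _ (RingSize.int.poly_X) hR.symm
      (BiDegLE.iff_natDegree.1 hdeg).1).trans ?_
    gcongr
    refine (RingSize.sub _ _ _).trans ?_
    rw [mul_add, mul_one]
    refine add_le_add ((RingSize.pow _ _ _).trans (Nat.pow_le_pow_left hA' 2)) ?_
    refine (RingSize.mul _ _ _).trans (Nat.mul_le_mul ((RingSize.pow _ _ _).trans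
      (Nat.pow_le_pow_left hB' 2)) ((RingSize.mul _ _ _).trans ?_))
    rw [hL, RingSize.poly_C, sq]

end norm

section wronskian

variable {K : Type*} [Field K] [CharZero K]

theorem exists_eq_smul_of_mul_derivative_eq {p q : K[X]} (hq : q ≠ 0)
    (h : q * derivative p = derivative q * p) : ∃ c : K, p = C c * q := by
  have key : ∀ r : K[X], r ≠ 0 → q * derivative r = derivative q * r →
      r.natDegree = q.natDegree := by
    intro r hr hqr
    by_cases h0 : q.natDegree = 0
    · rw [natDegree_eq_zero_iff_degree_le_zero] at h0
      rw [eq_C_of_degree_le_zero h0] at hqr hq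
      simp only [derivative_C, zero_mul, mul_eq_zero, hq, false_or] at hqr
      have := derivative_eq_zero.1 hqr
      rw [this, eq_comm, natDegree_eq_zero_iff_degree_le_zero]; exact h0
    by_cases h1 : r.natDegree = 0
    · rw [natDegree_eq_zero_iff_degree_le_zero] at h1
      rw [eq_C_of_degree_le_zero h1] at hqr hr
      simp only [derivative_C, mul_zero, eq_comm (a := (0 : K[X])), mul_eq_zero, hr,
        or_false] at hqr
      exact absurd (derivative_eq_zero.1 hqr) h0
    have hlead : ∀ s : K[X], s.natDegree ≠ 0 → (derivative s).leadingCoeff =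
        s.leadingCoeff * s.natDegree := by
      intro s hs
      rw [leadingCoeff, natDegree_derivative, coeff_derivative,
        ← Nat.cast_succ, Nat.succ_eq_add_one, Nat.sub_add_cancel (by omega), leadingCoeff]
    have := congrArg leadingCoeff hqr
    rw [leadingCoeff_mul, leadingCoeff_mul, hlead _ h0, hlead _ h1] at this
    have hne := mul_ne_zero (leadingCoeff_ne_zero.2 hq) (leadingCoeff_ne_zero.2 hr)
    have h2 : (r.natDegree : K) = q.natDegree := mul_left_cancel₀ hne (by linear_combination this)
    exact_mod_cast h2
  refine ⟨p.leadingCoeff / q.leadingCoeff, ?_⟩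
  by_contra hne
  have hp0 : p ≠ 0 := by rintro rfl; simp at hne
  have hd := key _ (sub_ne_zero.2 hne) (by
    simp only [derivative_sub, derivative_C_mul]; linear_combination h)
  have hlt : (p - C (p.leadingCoeff / q.leadingCoeff) * q).degree < p.degree := by
    have hl : q.leadingCoeff ≠ 0 := leadingCoeff_ne_zero.2 hq
    have hc : p.leadingCoeff / q.leadingCoeff ≠ 0 :=
      div_ne_zero (leadingCoeff_ne_zero.2 hp0) hl
    refine degree_sub_lt_left ?_ hp0 ?_
    · rw [degree_C_mul hc, degree_eq_natDegree hp0, degree_eq_natDegree hq, key p hp0 h]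
    · rw [leadingCoeff_mul, leadingCoeff_C, div_mul_cancel₀ _ hl]
  have := natDegree_lt_natDegree (sub_ne_zero.2 hne) hlt
  rw [hd, key p hp0 h] at this
  exact lt_irrefl _ this

theorem eq_zero_of_sum_mul_iterate_derivative_eq_zero {n : ℕ} {φ : Fin n → K[X]}
    (hφ : LinearIndependent K φ) {q : Fin n → K[X]}
    (h : ∀ a < n, ∑ j, q j * derivative^[a] (φ j) = 0) : q = 0 := by
  induction n with
  | zero => exact Subsingleton.elim _ _
  | succ n ih =>
    have hφ' : LinearIndependent K fun j : Fin n => φ j.succ :=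
      hφ.comp _ (Fin.succ_injective n)
    have tail : ∀ r : Fin (n + 1) → K[X], r 0 = 0 →
        (∀ a < n, ∑ j, r j * derivative^[a] (φ j) = 0) → ∀ j, r j = 0 := by
      intro r hr0 hr j
      have := ih hφ' (q := fun j => r j.succ) fun a ha => by
        have := hr a ha
        rwa [Fin.sum_univ_succ, hr0, zero_mul, zero_add] at this
      refine Fin.cases hr0 (fun j => congrFun this j) j
    by_contra hq
    have hq0 : q 0 ≠ 0 := fun h0 => hq (funext (tail q h0 fun a ha => h a (by omega)))
    have hq' : ∀ a < n, ∑ j, derivative (q j) * derivative^[a] (φ j) = 0 := by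
      intro a ha
      have h1 := congrArg derivative (h a (by omega))
      rw [derivative_sum, derivative_zero] at h1
      simp only [derivative_mul, Finset.sum_add_distrib, ← Function.iterate_succ_apply'] at h1
      rwa [h (a + 1) (by omega), add_zero] at h1
    have hprop := tail (fun j => q 0 * derivative (q j) - derivative (q 0) * q j) (by ring)
      fun a ha => by
        simp only [sub_mul, Finset.sum_sub_distrib, mul_assoc, ← Finset.mul_sum]
        rw [hq' a ha, h a (by omega)]; simp
    choose c hc using fun j =>
      exists_eq_smul_of_mul_derivative_eq hq0 (sub_eq_zero.1 (hprop j))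
    have hrel : ∑ j, c j • φ j = 0 := by
      have h0 := h 0 (by omega)
      have : q 0 * ∑ j, c j • φ j = 0 := by
        rw [← h0, Finset.mul_sum]
        refine Finset.sum_congr rfl fun j _ => ?_
        conv_rhs => rw [hc j]
        rw [smul_eq_C_mul, Function.iterate_zero_apply]; ring
      exact (mul_eq_zero.1 this).resolve_left hq0
    have hc0 := Fintype.linearIndependent_iff.1 hφ c hrel 0
    exact hq0 (by have := hc 0; rwa [hc0, C_0, zero_mul] at this)

/-- The Wronskian of linearly independent polynomials does not vanish. -/
theorem det_hasseDeriv_ne_zero {n : ℕ} {φ : Fin n → K[X]} (hφ : LinearIndependent K φ) :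
    (Matrix.of fun a j : Fin n => hasseDeriv a (φ j)).det ≠ 0 := by
  intro hdet
  obtain ⟨q, hq, hMq⟩ := Matrix.exists_mulVec_eq_zero_iff.2 hdet
  refine hq (eq_zero_of_sum_mul_iterate_derivative_eq_zero hφ fun a ha => ?_)
  have h1 := congrFun hMq ⟨a, ha⟩
  simp only [Matrix.mulVec, dotProduct, Matrix.of_apply, Pi.zero_apply] at h1
  have h2 : ∀ j, derivative^[a] (φ j) = (a.factorial : K[X]) * hasseDeriv a (φ j) := fun j => by
    rw [← factorial_smul_hasseDeriv]; simp
  rw [← mul_zero (a.factorial : K[X]), ← h1, Finset.mul_sum]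
  refine Finset.sum_congr rfl fun j _ => ?_
  rw [h2]; ring

end wronskian

/-- The multiplicative height of a rational number. -/
def ratHeight (z : ℚ) : ℕ := max z.num.natAbs z.den

theorem ratHeight_pow_le {w : ℤ[X]} (hw : w ≠ 0) {z : ℚ} {o S : ℕ}
    (h : (X - C z) ^ o ∣ w.map (Int.castRingHom ℚ)) (hS : ∀ i, (w.coeff i).natAbs ≤ S) :
    ratHeight z ^ o ≤ S := by
  set l : ℤ[X] := C (z.den : ℤ) * X + C (-z.num) with hl
  have hden : (z.den : ℤ) ≠ 0 := by exact_mod_cast z.den_nz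
  have hprim : l.IsPrimitive := by
    intro r hr
    rw [C_dvd_iff_dvd_coeff] at hr
    have h0 := hr 0
    have h1 := hr 1
    simp only [hl, coeff_add, coeff_C_mul, coeff_X_zero, coeff_C_zero, coeff_X_one, mul_zero,
      mul_one, zero_add, coeff_C_succ, add_zero, dvd_neg] at h0 h1
    have hc : IsCoprime z.num (z.den : ℤ) := by
      rw [Int.isCoprime_iff_gcd_eq_one]; exact z.reduced
    exact hc.isUnit_of_dvd' h0 h1
  have hprim' : (l ^ o).IsPrimitive := by
    induction o with
    | zero => simp
    | succ o ih =>
      rw [pow_succ]; exact (ih ((pow_dvd_pow _ (Nat.le_succ o)).trans h)).mul hprim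
  have hmap : l.map (Int.castRingHom ℚ) = C (z.den : ℚ) * (X - C z) := by
    have : (z.den : ℚ) * z = z.num := by rw [mul_comm]; exact Rat.mul_den_eq_num z
    simp only [hl, Polynomial.map_add, Polynomial.map_mul, Polynomial.map_X, Polynomial.map_C,
      mul_sub, ← C_mul, this]
    simp [sub_eq_add_neg]
  have hdvd : l ^ o ∣ w := by
    rw [IsPrimitive.Int.dvd_iff_map_cast_dvd_map_cast _ _ hprim', Polynomial.map_pow, hmap, mul_pow, ← C_pow]
    exact (IsUnit.mul_left_dvd (isUnit_C.2 (by simp))).2 h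
  obtain ⟨v, rfl⟩ := hdvd
  have hv : v ≠ 0 := right_ne_zero_of_mul hw
  have hl0 : l.leadingCoeff = z.den := leadingCoeff_linear hden
  have hlt : z.num ≠ 0 → l.trailingCoeff = -z.num := fun hz => by
    have : l.natTrailingDegree = 0 := by
      rw [natTrailingDegree_eq_zero]; right; simpa [hl] using hz
    rw [trailingCoeff, this]; simp [hl]
  have hone : ∀ a : ℤ, a ≠ 0 → 1 ≤ a.natAbs := fun a ha => Int.natAbs_pos.2 ha
  rw [ratHeight]
  rcases max_choice z.num.natAbs z.den with hm | hm <;> rw [hm]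
  · by_cases hz : z.num = 0
    · simp [hz] at hm
    have h1 := hS (l ^ o * v).natTrailingDegree
    rw [← trailingCoeff, trailingCoeff_mul] at h1
    have h2 : (l ^ o).trailingCoeff = (-z.num) ^ o := by
      rw [← hlt hz]
      clear * -
      induction o with
      | zero => simp [trailingCoeff]
      | succ o ih => rw [pow_succ, trailingCoeff_mul, ih, pow_succ]
    rw [h2, Int.natAbs_mul, Int.natAbs_pow, Int.natAbs_neg] at h1
    exact (Nat.le_mul_of_pos_right _ (hone _ (by simpa using hv))).trans h1
  · have h1 := hS (l ^ o * v).natDegree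
    rw [← leadingCoeff, leadingCoeff_mul, leadingCoeff_pow, hl0, Int.natAbs_mul,
      Int.natAbs_pow, Int.natAbs_natCast] at h1
    exact (Nat.le_mul_of_pos_right _ (hone _ (by simpa using hv))).trans h1

theorem hasseDeriv_taylor {K : Type*} [CommRing K] (x : K) (a : ℕ) (p : K[X]) :
    hasseDeriv a (taylor x p) = taylor x (hasseDeriv a p) := by
  ext k
  have h := LinearMap.congr_fun (hasseDeriv_comp (R := K) k a) p
  rw [hasseDeriv_coeff, taylor_coeff, taylor_coeff, ← LinearMap.comp_apply, h, LinearMap.smul_apply,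
    nsmul_eq_mul, eval_natCast_mul]
  congr 2
  rw [Nat.choose_symm_add]

namespace RingSize

variable {R : Type*} [CommRing R] (ν : RingSize R)

theorem poly_hasseDeriv_le {p : R[X]} {n : ℕ} (hp : p.natDegree ≤ n) (k : ℕ) :
    ν.poly (hasseDeriv k p) ≤ 2 ^ n * ν.poly p := by
  rw [hasseDeriv_apply, sum_over_range' _ (by simp) _ (Nat.lt_succ_of_le hp),
    ν.poly_eq_of_natDegree_lt (Nat.lt_succ_of_le hp), Finset.mul_sum]
  refine (RingSize.sum _ _ _).trans (Finset.sum_le_sum fun i hi => ?_)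
  rw [poly_monomial]
  refine (ν.mul _ _).trans (Nat.mul_le_mul_right _ ((ν.natCast _).trans ?_))
  exact (Nat.choose_le_two_pow _ _).trans
    (Nat.pow_le_pow_right two_pos (Nat.le_of_lt_succ (Finset.mem_range.1 hi)))

theorem prod_le {ι : Type*} (s : Finset ι) (f : ι → R) : ν (∏ i ∈ s, f i) ≤ ∏ i ∈ s, ν (f i) := by
  classical
  induction s using Finset.induction_on with
  | empty => simpa using ν.one
  | insert a s ha ih =>
    rw [Finset.prod_insert ha, Finset.prod_insert ha]
    exact (ν.mul _ _).trans (Nat.mul_le_mul_left _ ih)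

theorem det_le {n B : ℕ} {M : Matrix (Fin n) (Fin n) R} (h : ∀ i j, ν (M i j) ≤ B) :
    ν M.det ≤ (n * B) ^ n := by
  rw [Matrix.det_apply']
  refine (ν.sum _ _).trans ?_
  calc _ ≤ ∑ _σ : Equiv.Perm (Fin n), B ^ n := by
        refine Finset.sum_le_sum fun σ _ => (ν.mul _ _).trans ?_
        have h1 : ν ((Equiv.Perm.sign σ : ℤ) : R) ≤ 1 := by
          rcases Int.units_eq_one_or (Equiv.Perm.sign σ) with h | h <;> rw [h] <;>
            simpa using ν.one
        refine (Nat.mul_le_mul h1 ((ν.prod_le _ _).trans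
          (Finset.prod_le_prod' fun i _ => h _ _))).trans ?_
        simp
    _ = n.factorial * B ^ n := by simp [Fintype.card_perm]
    _ ≤ _ := by rw [mul_pow]; gcongr; exact Nat.factorial_le_pow n

end RingSize

/-- All monomials `xⁱ yʲ` (`x` inner) of `P` have weight `i w₁ + j w₂` at least `κ`. -/
def WeightGE {R : Type*} [CommRing R] (w₁ w₂ : ℕ) (P : R[X][X]) (κ : ℕ) : Prop :=
  ∀ i j : ℕ, (P.coeff j).coeff i ≠ 0 → κ ≤ i * w₁ + j * w₂

namespace WeightGE

variable {R : Type*} [CommRing R] {w₁ w₂ : ℕ} {P Q : R[X][X]} {κ μ : ℕ}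

theorem mul (hP : WeightGE w₁ w₂ P κ) (hQ : WeightGE w₁ w₂ Q μ) :
    WeightGE w₁ w₂ (P * Q) (κ + μ) := fun i j hij => by
  by_contra hlt
  refine hij ?_
  rw [coeff_mul, finsetSum_coeff]
  refine Finset.sum_eq_zero fun p hp => ?_
  rw [coeff_mul]
  refine Finset.sum_eq_zero fun r hr => ?_
  rw [Finset.HasAntidiagonal.mem_antidiagonal] at hp hr
  by_contra hne
  have h1 := hP _ _ (left_ne_zero_of_mul hne)
  have h2 := hQ _ _ (right_ne_zero_of_mul hne)
  rw [← hp, ← hr] at hlt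
  nlinarith

theorem prod {ι : Type*} (s : Finset ι) {P : ι → R[X][X]} {κ : ι → ℕ}
    (h : ∀ i ∈ s, WeightGE w₁ w₂ (P i) (κ i)) :
    WeightGE w₁ w₂ (∏ i ∈ s, P i) (∑ i ∈ s, κ i) := by
  classical
  induction s using Finset.induction_on with
  | empty => intro i j _; simp
  | insert a s ha ih =>
    rw [Finset.prod_insert ha, Finset.sum_insert ha]
    exact (h a (by simp)).mul (ih fun i hi => h i (by simp [hi]))

theorem det {n : ℕ} {M : Matrix (Fin n) (Fin n) R[X][X]} {κ : Fin n → ℕ}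
    (h : ∀ a b, WeightGE w₁ w₂ (M a b) (κ b)) : WeightGE w₁ w₂ M.det (∑ b, κ b) := by
  intro i j hij
  by_contra hlt
  refine hij ?_
  rw [Matrix.det_apply', finsetSum_coeff, finsetSum_coeff]
  refine Finset.sum_eq_zero fun σ _ => ?_
  rw [show ((Equiv.Perm.sign σ : ℤ) : R[X][X]) = C (C ((Equiv.Perm.sign σ : ℤ) : R)) by simp,
    coeff_C_mul, coeff_C_mul]
  by_contra hne
  exact hlt ((WeightGE.prod Finset.univ (fun b _ => h (σ b) b)) i j (right_ne_zero_of_mul hne))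

end WeightGE

/-- A bivariate polynomial of tensor form. -/
noncomputable def tensorSum {K : Type*} [CommRing K] {r : ℕ} (φ ψ : Fin r → K[X]) : K[X][X] :=
  ∑ l, C (φ l) * (ψ l).map C

theorem coeff_tensorSum {K : Type*} [CommRing K] {r : ℕ} (φ ψ : Fin r → K[X]) (i j : ℕ) :
    ((tensorSum φ ψ).coeff j).coeff i = ∑ l, (φ l).coeff i * (ψ l).coeff j := by
  simp [tensorSum, finsetSum_coeff]

theorem exists_tensor_decomposition {K : Type*} [Field K] {P : K[X][X]} {n : ℕ}
    (hP : P.natDegree ≤ n) (hP0 : P ≠ 0) :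
    ∃ (r : ℕ) (φ ψ : Fin r → K[X]), 1 ≤ r ∧ r ≤ n + 1 ∧ LinearIndependent K φ ∧
      LinearIndependent K ψ ∧ P = tensorSum φ ψ := by
  let V : Submodule K K[X] := Submodule.span K (Set.range fun k : Fin (n + 1) => P.coeff k)
  have hfin : FiniteDimensional K V := FiniteDimensional.span_of_finite K (Set.finite_range _)
  have hmem : ∀ k, P.coeff k ∈ V := fun k => by
    rcases lt_or_ge k (n + 1) with hk | hk
    · exact Submodule.subset_span ⟨⟨k, hk⟩, rfl⟩
    · rw [coeff_eq_zero_of_natDegree_lt (by omega)]; exact V.zero_mem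
  let b := Module.finBasis K V
  let φ : Fin (Module.finrank K V) → K[X] := fun l => b l
  let ψ : Fin (Module.finrank K V) → K[X] := fun l =>
    ∑ k ∈ Finset.range (n + 1), monomial k (b.repr ⟨P.coeff k, hmem k⟩ l)
  have hψ : ∀ l k, (ψ l).coeff k = b.repr ⟨P.coeff k, hmem k⟩ l := by
    intro l k
    simp only [ψ, finsetSum_coeff, coeff_monomial]
    rw [Finset.sum_ite_eq' (Finset.range (n + 1)) k
      fun k => b.repr ⟨P.coeff k, hmem k⟩ l]
    split_ifs with h
    · rfl
    · have : (⟨P.coeff k, hmem k⟩ : V) = 0 := by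
        ext1
        exact coeff_eq_zero_of_natDegree_lt (by rw [Finset.mem_range] at h; omega)
      rw [this]; simp
  have heq : ∀ k, P.coeff k = ∑ l, b.repr ⟨P.coeff k, hmem k⟩ l • φ l := fun k => by
    have := congrArg V.subtype (b.sum_repr ⟨P.coeff k, hmem k⟩)
    rw [map_sum] at this
    exact this.symm
  refine ⟨Module.finrank K V, φ, ψ, ?_, ?_, ?_, ?_, ?_⟩
  · by_contra h
    have h0 : Module.finrank K V = 0 := by omega
    rw [Submodule.finrank_eq_zero] at h0
    refine hP0 (Polynomial.ext fun k => ?_)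
    simpa [h0] using hmem k
  · exact (finrank_range_le_card _).trans (by simp)
  · exact b.linearIndependent.map' V.subtype (by simp)
  · rw [Fintype.linearIndependent_iff]
    intro c hc
    have hz : ∀ v ∈ V, ∀ hv : v ∈ V, ∑ l, c l * b.repr ⟨v, hv⟩ l = 0 := by
      intro v hv
      induction hv using Submodule.span_induction with
      | mem v hv =>
        obtain ⟨k, rfl⟩ := hv
        intro hv
        have := congrArg (fun p => p.coeff (k : ℕ)) hc
        simp only [finsetSum_coeff, coeff_smul, hψ, smul_eq_mul, coeff_zero] at this
        exact this
      | zero => intro hv; rw [show (⟨0, hv⟩ : V) = 0 from rfl]; simp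
      | add u v hu hv ihu ihv =>
        intro huv
        rw [show (⟨u + v, huv⟩ : V) = ⟨u, hu⟩ + ⟨v, hv⟩ from rfl]
        simp only [map_add, Finsupp.add_apply, mul_add, Finset.sum_add_distrib]
        rw [ihu hu, ihv hv, add_zero]
      | smul t v hv ihv =>
        intro htv
        rw [show (⟨t • v, htv⟩ : V) = t • ⟨v, hv⟩ from rfl]
        simp only [map_smul, Finsupp.smul_apply, smul_eq_mul, mul_left_comm _ t, ← Finset.mul_sum]
        rw [ihv hv, mul_zero]
    intro l
    have := hz (b l) (b l).2 (b l).2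
    simpa [Finsupp.single_apply] using this
  · ext k i
    rw [coeff_tensorSum]
    conv_lhs => rw [heq k]
    rw [finsetSum_coeff]
    exact Finset.sum_congr rfl fun l _ => by rw [coeff_smul, smul_eq_mul, hψ, mul_comm]

/-- Translation of a bivariate polynomial by `(x, y)` (`x` for the inner variable). -/
noncomputable def biShift {K : Type*} [CommRing K] (x y : K) : K[X][X] →+* K[X][X] :=
  (taylorAlgHom (C y : K[X])).toRingHom.comp (mapRingHom (taylorAlgHom x).toRingHom)

section

variable {K : Type*} [CommRing K] (x y : K)

theorem biShift_apply (P : K[X][X]) :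
    biShift x y P = taylor (C y) (P.map (taylorAlgHom x).toRingHom) := rfl

theorem biShift_C (p : K[X]) : biShift x y (C p) = C (taylor x p) := by
  rw [biShift_apply, map_C, taylor_C]; rfl

theorem biShift_map_C (p : K[X]) : biShift x y (p.map C) = (taylor y p).map C := by
  rw [biShift_apply, map_map]
  have h : (taylorAlgHom x).toRingHom.comp (C : K →+* K[X]) = C := by
    ext a : 1
    exact taylor_C x a
  rw [h, taylor_apply, taylor_apply, Polynomial.map_comp]
  simp

theorem biShift_tensorSum {r : ℕ} (φ ψ : Fin r → K[X]) :
    biShift x y (tensorSum φ ψ) =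
      tensorSum (fun l => taylor x (φ l)) (fun l => taylor y (ψ l)) := by
  simp only [tensorSum, map_sum, map_mul, biShift_C, biShift_map_C]

/-- The mixed Hasse derivative of order `a` in the inner and `b` in the outer variable. -/
noncomputable def biHasse (a b : ℕ) (P : K[X][X]) : K[X][X] :=
  ∑ j ∈ Finset.range (P.natDegree + 1), monomial j (hasseDeriv a ((hasseDeriv b P).coeff j))

theorem coeff_biHasse (a b : ℕ) (P : K[X][X]) (i j : ℕ) :
    ((biHasse a b P).coeff j).coeff i =
      ((i + a).choose a : K) * (((j + b).choose b : K) * (P.coeff (j + b)).coeff (i + a)) := by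
  have h : (biHasse a b P).coeff j = hasseDeriv a ((hasseDeriv b P).coeff j) := by
    rw [biHasse, finsetSum_coeff]
    simp only [coeff_monomial]
    rw [Finset.sum_ite_eq' (Finset.range (P.natDegree + 1)) j
      fun j => hasseDeriv a ((hasseDeriv b P).coeff j)]
    split_ifs with hj
    · rfl
    · rw [hasseDeriv_coeff, coeff_eq_zero_of_natDegree_lt
        (by rw [Finset.mem_range] at hj; omega), mul_zero, map_zero]
  rw [h, hasseDeriv_coeff, hasseDeriv_coeff]
  congr 1
  rw [← C_eq_natCast, coeff_C_mul]

theorem coeff_biHasse_tensorSum (a b : ℕ) {r : ℕ} (φ ψ : Fin r → K[X]) :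
    biHasse a b (tensorSum φ ψ) =
      tensorSum (fun l => hasseDeriv a (φ l)) (fun l => hasseDeriv b (ψ l)) := by
  ext j i
  rw [coeff_biHasse, coeff_tensorSum, coeff_tensorSum, Finset.mul_sum, Finset.mul_sum]
  refine Finset.sum_congr rfl fun l _ => ?_
  rw [hasseDeriv_coeff, hasseDeriv_coeff]
  ring

theorem WeightGE.biHasse {w₁ w₂ κ : ℕ} {P : K[X][X]} (h : WeightGE w₁ w₂ P κ) (a b : ℕ) :
    WeightGE w₁ w₂ (biHasse a b P) (κ - a * w₁ - b * w₂) := by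
  intro i j hij
  rw [coeff_biHasse] at hij
  have := h _ _ (right_ne_zero_of_mul (right_ne_zero_of_mul hij))
  rw [add_mul, add_mul] at this
  omega

theorem RingSize.biHasse_le (ν : RingSize K) {P : K[X][X]} {M N : ℕ} (hP : BiDegLE P M N)
    (a b : ℕ) : ν.poly.poly (biHasse a b P) ≤ 2 ^ (M + N) * ν.poly.poly P := by
  have hN : P.natDegree ≤ N := by
    refine natDegree_le_iff_coeff_eq_zero.2 fun i hi => ?_
    by_contra hne
    obtain ⟨j, hj⟩ : ∃ j, (P.coeff i).coeff j ≠ 0 := by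
      by_contra hall
      push Not at hall
      exact hne (Polynomial.ext hall)
    have := (hP i j hj).2
    omega
  calc _ ≤ ∑ j ∈ Finset.range (P.natDegree + 1), 2 ^ M * ν.poly ((hasseDeriv b P).coeff j) := by
        refine (RingSize.sum _ _ _).trans (Finset.sum_le_sum fun j _ => ?_)
        rw [RingSize.poly_monomial]
        refine ν.poly_hasseDeriv_le (natDegree_le_iff_coeff_eq_zero.2 fun i hi => ?_) a
        rw [hasseDeriv_coeff, ← C_eq_natCast, coeff_C_mul]
        by_contra hne
        have := (hP _ _ (right_ne_zero_of_mul hne)).1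
        omega
    _ = 2 ^ M * ν.poly.poly (hasseDeriv b P) := by
        rw [← Finset.mul_sum, ν.poly.poly_eq_of_natDegree_lt (n := P.natDegree + 1)]
        exact Nat.lt_succ_of_le ((natDegree_hasseDeriv_le _ _).trans (Nat.sub_le _ _))
    _ ≤ 2 ^ M * (2 ^ N * ν.poly.poly P) := by
        gcongr
        exact ν.poly.poly_hasseDeriv_le hN b
    _ = _ := by rw [pow_add, mul_assoc]

end

theorem det_biHasse_tensorSum {K : Type*} [Field K] {r : ℕ} (φ ψ : Fin r → K[X]) :
    (Matrix.of fun a b : Fin r => biHasse a b (tensorSum φ ψ)).det =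
      C (Matrix.of fun a l : Fin r => hasseDeriv a (φ l)).det *
        (Matrix.of fun b l : Fin r => hasseDeriv b (ψ l)).det.map C := by
  have h : (Matrix.of fun a b : Fin r => biHasse a b (tensorSum φ ψ)) =
      ((C : K[X] →+* K[X][X]).mapMatrix (Matrix.of fun a l : Fin r => hasseDeriv a (φ l))) *
        ((mapRingHom (C : K →+* K[X])).mapMatrix
          (Matrix.of fun b l : Fin r => hasseDeriv b (ψ l))).transpose := by
    ext1 a b
    rw [Matrix.mul_apply, Matrix.of_apply, coeff_biHasse_tensorSum]
    rfl
  rw [h, Matrix.det_mul, Matrix.det_transpose, ← RingHom.map_det, ← RingHom.map_det]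
  rfl

theorem X_sub_C_pow_dvd_of_taylor {K : Type*} [CommRing K] (x : K) (p : K[X]) :
    (X - C x) ^ (taylor x p).natTrailingDegree ∣ p := by
  have h : X ^ (taylor x p).natTrailingDegree ∣ taylor x p := by
    rw [X_pow_dvd_iff]
    exact fun d hd => coeff_eq_zero_of_lt_natTrailingDegree hd
  generalize (taylor x p).natTrailingDegree = o at h ⊢
  obtain ⟨g, hg⟩ := h
  have := congrArg (taylor (-x)) hg
  rw [taylor_taylor, neg_add_cancel, taylor_zero, taylor_mul, taylor_pow, taylor_X, C_neg,
    ← sub_eq_add_neg] at this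
  exact ⟨_, this⟩

theorem ratHeight_pow_order_le {P : ℤ[X][X]} {U V : ℚ[X]} (hU : U ≠ 0) (hV : V ≠ 0)
    (h : P.map (mapRingHom (Int.castRingHom ℚ)) = C U * V.map C) {S : ℕ}
    (hS : ∀ i j, ((P.coeff j).coeff i).natAbs ≤ S) (x : ℚ) :
    ratHeight x ^ (taylor x U).natTrailingDegree ≤ S := by
  obtain ⟨k, hk⟩ : ∃ k, V.coeff k ≠ 0 := by
    by_contra hall
    push Not at hall
    exact hV (Polynomial.ext hall)
  have hw : (P.coeff k).map (Int.castRingHom ℚ) = U * C (V.coeff k) := by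
    have := congrArg (fun p => p.coeff k) h
    simpa [coeff_map, coeff_C_mul] using this
  refine ratHeight_pow_le (w := P.coeff k) (fun h0 => ?_) ?_ fun i => hS i k
  · rw [h0, Polynomial.map_zero] at hw
    exact mul_ne_zero hU (C_ne_zero.2 hk) hw.symm
  · rw [hw]
    exact (X_sub_C_pow_dvd_of_taylor x U).mul_right _

theorem swap_map_rat {P : ℤ[X][X]} {U V : ℚ[X]}
    (h : P.map (mapRingHom (Int.castRingHom ℚ)) = C U * V.map C) :
    (Bivariate.swap P).map (mapRingHom (Int.castRingHom ℚ)) = C V * U.map C := by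
  ext j i
  have := congrArg (fun p => (p.coeff i).coeff j) h
  simp only [coeff_map, coeff_C_mul, coe_mapRingHom, coeff_mul_C, coeff_coeff_swap] at this ⊢
  rw [this, mul_comm]

/-- **Roth's lemma** in two variables: a bivariate integer polynomial of small size vanishing to
high weighted order at a rational point forces the point to have small height. -/
theorem roth_lemma {R : ℤ[X][X]} (hR : R ≠ 0) {D₁ D₂ K κ : ℕ} (hb : BiDegLE R D₁ D₂)
    (hK : RingSize.int.poly.poly R ≤ K) (x y : ℚ)
    (hw : WeightGE D₂ D₁ (biShift x y (R.map (mapRingHom (Int.castRingHom ℚ)))) κ) :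
    ∃ r o₁ o₂, 1 ≤ r ∧ r ≤ D₂ + 1 ∧
      ratHeight x ^ o₁ ≤ ((D₂ + 1) * (2 ^ (D₁ + D₂) * K)) ^ r ∧
      ratHeight y ^ o₂ ≤ ((D₂ + 1) * (2 ^ (D₁ + D₂) * K)) ^ r ∧
      ∑ b ∈ Finset.range r, (κ - r * D₂ - b * D₁) ≤ o₁ * D₂ + o₂ * D₁ := by
  set ι := mapRingHom (Int.castRingHom ℚ)
  have hι : Function.Injective ι := map_injective _ Int.cast_injective
  have hdeg : (R.map ι).natDegree ≤ D₂ :=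
    natDegree_map_le.trans (BiDegLE.iff_natDegree.1 hb).1
  obtain ⟨r, φ, ψ, hr, hrn, hφ, hψ, hP⟩ := exists_tensor_decomposition hdeg
    ((Polynomial.map_ne_zero_iff hι).2 hR)
  set U := (Matrix.of fun a l : Fin r => hasseDeriv a (φ l)).det
  set V := (Matrix.of fun b l : Fin r => hasseDeriv b (ψ l)).det
  have hU : U ≠ 0 := det_hasseDeriv_ne_zero hφ
  have hV : V ≠ 0 := det_hasseDeriv_ne_zero hψ
  set W := (Matrix.of fun a b : Fin r => biHasse a b R).det with hWdef
  have hW : W.map ι = C U * V.map C := by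
    rw [← det_biHasse_tensorSum, ← hP, hWdef, ← coe_mapRingHom, RingHom.map_det]
    congr 1
    ext1 a b
    change (biHasse a b R).map ι = biHasse a b (R.map ι)
    ext j i
    rw [coeff_map, coe_mapRingHom, coeff_map, coeff_biHasse, coeff_biHasse, coeff_map,
      coe_mapRingHom, coeff_map]
    simp
  have hS : ∀ i j, ((W.coeff j).coeff i).natAbs ≤ ((D₂ + 1) * (2 ^ (D₁ + D₂) * K)) ^ r := by
    intro i j
    have h1 : RingSize.int.poly.poly W ≤ (r * (2 ^ (D₁ + D₂) * K)) ^ r :=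
      RingSize.det_le _ fun a b =>
        (RingSize.biHasse_le _ hb a b).trans (Nat.mul_le_mul_left _ hK)
    have h2 := (RingSize.int.coeff_le (W.coeff j) i).trans (RingSize.int.poly.coeff_le W j)
    rw [RingSize.int_toFun] at h2
    exact h2.trans (h1.trans (Nat.pow_le_pow_left (Nat.mul_le_mul_right _ hrn) _))
  refine ⟨r, _, _, hr, hrn, ratHeight_pow_order_le hU hV hW hS x,
    ratHeight_pow_order_le hV hU (swap_map_rat hW) (fun i j => ?_) y, ?_⟩
  · rw [coeff_coeff_swap]; exact hS j i
  · have hdet : biShift x y (C U * V.map C) = (Matrix.of fun a b : Fin r =>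
        biHasse a b (biShift x y (R.map ι))).det := by
      rw [hP, biShift_tensorSum, det_biHasse_tensorSum, map_mul, biShift_C, biShift_map_C]
      have key : ∀ (z : ℚ) (χ : Fin r → ℚ[X]),
          taylor z (Matrix.of fun a l : Fin r => hasseDeriv a (χ l)).det =
            (Matrix.of fun a l : Fin r => hasseDeriv a (taylor z (χ l))).det := by
        intro z χ
        refine ((taylorAlgHom z).map_det _).trans ?_
        congr 1
        ext1 a l
        exact (hasseDeriv_taylor z a (χ l)).symm
      rw [key, key]
    have hge : WeightGE D₂ D₁ (biShift x y (C U * V.map C))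
        (∑ b : Fin r, (κ - r * D₂ - b * D₁)) := by
      rw [hdet]
      refine WeightGE.det fun a b i j hij => ?_
      have h1 := hw.biHasse a b i j hij
      refine le_trans ?_ h1
      have : (a : ℕ) * D₂ ≤ r * D₂ := Nat.mul_le_mul_right _ a.2.le
      omega
    rw [Fin.sum_univ_eq_sum_range (fun b => κ - r * D₂ - b * D₁) r] at hge
    refine hge _ _ ?_
    rw [map_mul, biShift_C, biShift_map_C, coeff_C_mul, coeff_map, coeff_mul_C]
    have tr : ∀ (z : ℚ) (p : ℚ[X]), p ≠ 0 →
        (taylor z p).coeff (taylor z p).natTrailingDegree ≠ 0 := fun z p hp =>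
      trailingCoeff_nonzero_iff_nonzero.2 fun h => hp (taylor_injective z (by simpa using h))
    exact mul_ne_zero (tr x U hU) (tr y V hV)

/-- The size on `R[ω]`, `ω² = a`, induced by a size on `R`. -/
def RingSize.quad {R : Type*} [CommRing R] (ν : RingSize R) (a : R) :
    RingSize (QuadraticAlgebra R a 0) where
  toFun z := ν z.re + (ν a + 1) * ν z.im
  zero' := by simp
  one' := by simpa [QuadraticAlgebra.re_one, QuadraticAlgebra.im_one] using ν.one
  neg' z := by simp
  add' z w := by
    have h1 := ν.add z.re w.re
    have h2 := Nat.mul_le_mul_left (ν a + 1) (ν.add z.im w.im)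
    simp only [QuadraticAlgebra.re_add, QuadraticAlgebra.im_add]
    linarith
  mul' z w := by
    have h1 : ν (z.re * w.re + a * z.im * w.im) ≤
        ν z.re * ν w.re + ν a * ν z.im * ν w.im :=
      (ν.add _ _).trans (add_le_add (ν.mul _ _)
        ((ν.mul _ _).trans (Nat.mul_le_mul_right _ (ν.mul _ _))))
    have h2 : ν (z.re * w.im + z.im * w.re) ≤ ν z.re * ν w.im + ν z.im * ν w.re :=
      (ν.add _ _).trans (add_le_add (ν.mul _ _) (ν.mul _ _))
    have h3 := Nat.mul_le_mul_left (ν a + 1) h2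
    simp only [QuadraticAlgebra.re_mul, QuadraticAlgebra.im_mul, zero_mul, add_zero]
    have h4 : ν a * ν z.im * ν w.im ≤ (ν a + 1) * ν z.im * ((ν a + 1) * ν w.im) := by
      calc ν a * ν z.im * ν w.im = ν a * 1 * (ν z.im * ν w.im) := by ring
        _ ≤ (ν a + 1) * (ν a + 1) * (ν z.im * ν w.im) := by gcongr <;> omega
        _ = _ := by ring
    calc _ ≤ ν z.re * ν w.re + ν a * ν z.im * ν w.im +
          (ν a + 1) * (ν z.re * ν w.im + ν z.im * ν w.re) := add_le_add h1 h3
      _ ≤ ν z.re * ν w.re + (ν a + 1) * ν z.im * ((ν a + 1) * ν w.im) +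
          (ν a + 1) * (ν z.re * ν w.im + ν z.im * ν w.re) := by gcongr
      _ = _ := by ring

/-- The ring `ℤ[u₁, u₂, σ]` with `σ² = f(u₁) f(u₂)`. -/
abbrev SecRing (f : ℤ[X]) := QuadraticAlgebra ℤ[X][X] (C f * f.map C) 0

namespace SecRing

variable {f : ℤ[X]}

/-- The size of an element of `SecRing f`. -/
noncomputable def size (f : ℤ[X]) : RingSize (SecRing f) :=
  RingSize.quad RingSize.int.poly.poly (C f * f.map C)

theorem size_algebraMap_le (a : ℤ[X][X]) :
    size f (algebraMap _ (SecRing f) a) ≤ RingSize.int.poly.poly a := by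
  simp [size, RingSize.quad]

/-- The bidegree of `a + b σ` is at most `(M, N)`, where `σ` has bidegree `(3, 3)`. -/
def DegLE (z : SecRing f) (M N : ℕ) : Prop :=
  BiDegLE z.re M N ∧ BiDegLE ((C X * X) ^ 3 * z.im) M N

theorem coeff_coeff_pow_mul (k : ℕ) (a : ℤ[X][X]) (i j : ℕ) :
    (((C X * X) ^ k * a : ℤ[X][X]).coeff (i + k)).coeff (j + k) = (a.coeff i).coeff j := by
  rw [mul_pow, mul_assoc, ← C_pow, coeff_C_mul, mul_comm (X ^ k) a, coeff_mul_X_pow,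
    mul_comm, coeff_mul_X_pow]

theorem biDegLE_pow_mul_iff (k : ℕ) {a : ℤ[X][X]} {M N : ℕ} :
    BiDegLE ((C X * X) ^ k * a) (M + k) (N + k) ↔ BiDegLE a M N := by
  constructor
  · intro h i j hij
    have := h (i + k) (j + k) (by rwa [coeff_coeff_pow_mul])
    omega
  · intro h
    have hX : BiDegLE (C X * X : ℤ[X][X]) 1 1 := by
      have h2 := BiDegLE.map_C_of_natDegree (f := (X : ℤ[X])) (N := 1) natDegree_X_le
      rw [map_X] at h2
      simpa using (BiDegLE.C_of_natDegree (f := (X : ℤ[X])) natDegree_X_le).mul h2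
    exact ((hX.pow k).mul h).mono (by omega) (by omega)

namespace DegLE

variable {z w : SecRing f} {M N M' N' : ℕ}

theorem mono (h : DegLE z M N) (hM : M ≤ M') (hN : N ≤ N') : DegLE z M' N' :=
  ⟨h.1.mono hM hN, h.2.mono hM hN⟩

theorem algebraMap {a : ℤ[X][X]} (h : BiDegLE a M N) : DegLE (algebraMap _ (SecRing f) a) M N :=
  ⟨h, fun i j hij => by simp at hij⟩

theorem mul (hf : f.natDegree ≤ 6) (hz : DegLE z M N) (hw : DegLE w M' N') :
    DegLE (z * w) (M + M') (N + N') := by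
  constructor
  · rw [QuadraticAlgebra.re_mul]
    refine (hz.1.mul hw.1).add ((biDegLE_pow_mul_iff 6).1 ?_)
    have h := (hz.2.mul hw.2).mul ((BiDegLE.C_of_natDegree hf).mul
      (BiDegLE.map_C_of_natDegree hf))
    have e : (C X * X) ^ 6 * (C f * map C f * z.im * w.im) =
      (C X * X) ^ 3 * z.im * ((C X * X) ^ 3 * w.im) * (C f * map C f) := by ring
    rw [e]
    simpa using h
  · rw [QuadraticAlgebra.im_mul]
    have e : (C X * X : ℤ[X][X]) ^ 3 * (z.re * w.im + z.im * w.re + 0 * z.im * w.im) =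
      z.re * ((C X * X) ^ 3 * w.im) + (C X * X) ^ 3 * z.im * w.re := by ring
    rw [e]
    exact (hz.1.mul hw.2).add (hz.2.mul hw.1)

theorem pow (hf : f.natDegree ≤ 6) (hz : DegLE z M N) (k : ℕ) :
    DegLE (z ^ k) (k * M) (k * N) := by
  induction k with
  | zero =>
    rw [pow_zero, zero_mul, zero_mul]
    have := DegLE.algebraMap (f := f) (a := 1) (M := 0) (N := 0)
      (by simpa using BiDegLE.C_of_natDegree (f := (1 : ℤ[X])) (M := 0) (by simp))
    rwa [map_one] at this
  | succ k ih =>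
    rw [pow_succ, add_mul, add_mul, one_mul, one_mul]
    exact ih.mul hf hz

end DegLE

variable {q : PowerSeries ℤ[X]}

/-- Expansion of `a + b σ` near the diagonal, on the branch where `σ = f` on the diagonal. -/
noncomputable def branch (hq : IsSqrtSeries f q) : SecRing f →+* PowerSeries ℤ[X] where
  toFun z := diagExpansion f q z.re z.im
  map_zero' := by simp [diagExpansion]
  map_one' := by simp [diagExpansion, QuadraticAlgebra.re_one, QuadraticAlgebra.im_one]
  map_add' z w := by simp [diagExpansion]; ring
  map_mul' z w := by
    simp only [diagExpansion, QuadraticAlgebra.re_mul, QuadraticAlgebra.im_mul, map_add, map_mul,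
      shiftHom_C, ← hq.eq, map_zero]
    ring

theorem constantCoeff_branch (hq : IsSqrtSeries f q) (z : SecRing f) :
    PowerSeries.constantCoeff (branch hq z) = z.re.eval X + z.im.eval X * f := by
  simp [branch, diagExpansion, constantCoeff_shiftHom, hq.const]

theorem branch_algebraMap (hq : IsSqrtSeries f q) (a : ℤ[X][X]) :
    branch hq (algebraMap _ _ a) = shiftHom X (4 * f) a := by
  simp [branch, diagExpansion]

theorem X_pow_dvd_of_mul {a b : PowerSeries ℤ[X]} {k : ℕ} (h : PowerSeries.X ^ k ∣ a * b)
    (hb : PowerSeries.constantCoeff b ≠ 0) : PowerSeries.X ^ k ∣ a :=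
  PowerSeries.X_prime.pow_dvd_of_dvd_mul_right k (fun h => hb (PowerSeries.X_dvd_iff.1 h)) h

/-- An element vanishing to order `e` on both branches along the diagonal is divisible by
`(u₂ - u₁) ^ e`. -/
theorem exists_quotient (hq : IsSqrtSeries f q) (hf0 : f ≠ 0) {z : SecRing f} {e M N : ℕ}
    (h₁ : PowerSeries.X ^ e ∣ branch hq z) (h₂ : PowerSeries.X ^ e ∣ branch hq (star z))
    (hz : DegLE z (M + e) (N + e)) :
    ∃ w : SecRing f, algebraMap ℤ[X][X] (SecRing f) ((X - C X) ^ e) * w = z ∧ DegLE w M N ∧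
      size f w ≤ 4 ^ (N + e) * size f z := by
  have e1 : branch hq z = shiftHom X (4 * f) z.re + shiftHom X (4 * f) z.im *
      (PowerSeries.C f * q) := rfl
  have e2 : branch hq (star z) = shiftHom X (4 * f) z.re - shiftHom X (4 * f) z.im *
      (PowerSeries.C f * q) := by
    change shiftHom X (4 * f) (z.re + 0 * z.im) + shiftHom X (4 * f) (-z.im) * _ = _
    rw [map_neg, zero_mul, add_zero]; ring
  have h2 : PowerSeries.constantCoeff (2 : PowerSeries ℤ[X]) ≠ 0 := by
    rw [map_ofNat]; exact two_ne_zero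
  have hfq : PowerSeries.constantCoeff (PowerSeries.C f * q) ≠ 0 := by
    simpa [hq.const] using hf0
  obtain ⟨a, ha⟩ := diag_pow_dvd_of_X_pow_dvd hf0 (a := z.re) (d := e) <| by
    refine X_pow_dvd_of_mul (b := 2) ?_ h2
    have := dvd_add h₁ h₂
    rw [e1, e2] at this
    convert this using 1
    ring
  obtain ⟨b, hb⟩ := diag_pow_dvd_of_X_pow_dvd hf0 (a := z.im) (d := e) <| by
    refine X_pow_dvd_of_mul (X_pow_dvd_of_mul (b := 2) ?_ h2) hfq
    have := dvd_sub h₁ h₂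
    rw [e1, e2] at this
    convert this using 1
    ring
  have hre : z.re.natDegree ≤ N + e := (BiDegLE.iff_natDegree.1 hz.1).1
  have him : z.im.natDegree ≤ N + e :=
    (BiDegLE.iff_natDegree.1 ((biDegLE_pow_mul_iff 3).1
      (hz.2.mono (Nat.le_add_right _ 3) (Nat.le_add_right _ 3)))).1
  refine ⟨⟨a, b⟩, ?_, ⟨BiDegLE.of_pow_mul (d := e) (by rw [← ha]; exact hz.1),
    BiDegLE.of_pow_mul (d := e) ?_⟩, ?_⟩
  · rw [← Algebra.smul_def]
    ext1
    · exact ha.symm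
    · exact hb.symm
  · have : (X - C X) ^ e * ((C X * X) ^ 3 * b) = (C X * X) ^ 3 * z.im := by rw [hb]; ring
    change BiDegLE ((X - C X) ^ e * ((C X * X) ^ 3 * b)) _ _
    rw [this]
    exact hz.2
  · have s1 := RingSize.poly_le_of_pow_mul _ RingSize.int.poly_X ha.symm hre
    have s2 := RingSize.poly_le_of_pow_mul _ RingSize.int.poly_X hb.symm him
    change RingSize.int.poly.poly a + (RingSize.int.poly.poly (C f * f.map C) + 1) *
      RingSize.int.poly.poly b ≤ 4 ^ (N + e) * (RingSize.int.poly.poly z.re +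
        (RingSize.int.poly.poly (C f * f.map C) + 1) * RingSize.int.poly.poly z.im)
    have s3 := Nat.mul_le_mul_left (RingSize.int.poly.poly (C f * f.map C) + 1) s2
    linarith

end SecRing

/-- The sextic `c₃ u⁶ + c₂ u⁴ + c₁ u² + c₀`. -/
noncomputable def evenSextic (c₀ c₁ c₂ c₃ : ℤ) : ℤ[X] :=
  (c₃ : ℤ[X]) * X ^ 6 + (c₂ : ℤ[X]) * X ^ 4 + (c₁ : ℤ[X]) * X ^ 2 + (c₀ : ℤ[X])

namespace SecRing

variable (c₀ c₁ c₂ c₃ : ℤ)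

theorem natDegree_evenSextic : (evenSextic c₀ c₁ c₂ c₃).natDegree ≤ 6 := by
  unfold evenSextic
  compute_degree

theorem star_mul_eq {f : ℤ[X]} (z w : SecRing f) : star (z * w) = star z * star w := by
  ext1 <;> simp only [QuadraticAlgebra.re_star, QuadraticAlgebra.im_star,
    QuadraticAlgebra.re_mul, QuadraticAlgebra.im_mul] <;> ring

theorem star_pow_eq {f : ℤ[X]} (z : SecRing f) (k : ℕ) : star (z ^ k) = star z ^ k := by
  induction k with
  | zero =>
    rw [pow_zero, pow_zero]
    ext1 <;> simp [QuadraticAlgebra.re_one, QuadraticAlgebra.im_one]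
  | succ k ih => rw [pow_succ, pow_succ, star_mul_eq, ih]

/-- `(u₁² - u₂²)²` times the abscissa of the difference on the first elliptic quotient. -/
noncomputable def thetaOne : SecRing (evenSextic c₀ c₁ c₂ c₃) where
  re := (c₃ : ℤ[X][X]) * ((C X * X) ^ 2 * (C X ^ 2 + X ^ 2)) + 2 * (c₂ : ℤ[X][X]) * (C X * X) ^ 2 +
    (c₁ : ℤ[X][X]) * (C X ^ 2 + X ^ 2) + 2 * (c₀ : ℤ[X][X])
  im := 2

/-- The analogue of `thetaOne` for the second elliptic quotient. -/
noncomputable def thetaTwo : SecRing (evenSextic c₀ c₁ c₂ c₃) where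
  re := (c₀ : ℤ[X][X]) * (C X ^ 2 + X ^ 2) + 2 * (c₁ : ℤ[X][X]) * (C X * X) ^ 2 +
    (c₂ : ℤ[X][X]) * ((C X * X) ^ 2 * (C X ^ 2 + X ^ 2)) + 2 * (c₃ : ℤ[X][X]) * (C X * X) ^ 4
  im := 2 * (C X * X)

/-- The quotient of `thetaOne * thetaTwo` by `(u₁ + u₂)²`. -/
noncomputable def psi : SecRing (evenSextic c₀ c₁ c₂ c₃) where
  re := 4 * (c₃ : ℤ[X][X]) * (c₀ : ℤ[X][X]) * ((C X * X) * (C X ^ 2 + X ^ 2) ^ 2) +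
    ((c₂ : ℤ[X][X]) * (c₃ : ℤ[X][X]) * ((C X * X) ^ 4 * (C X ^ 2 + X ^ 2)) +
      4 * (c₁ : ℤ[X][X]) * (c₃ : ℤ[X][X]) * ((C X * X) ^ 3 * (C X ^ 2 + X ^ 2)) +
      ((c₁ : ℤ[X][X]) * (c₂ : ℤ[X][X]) - 7 * (c₀ : ℤ[X][X]) * (c₃ : ℤ[X][X])) *
        ((C X * X) ^ 2 * (C X ^ 2 + X ^ 2)) +
      4 * (c₀ : ℤ[X][X]) * (c₂ : ℤ[X][X]) * ((C X * X) * (C X ^ 2 + X ^ 2)) +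
      (c₀ : ℤ[X][X]) * (c₁ : ℤ[X][X]) * (C X ^ 2 + X ^ 2)) +
    (2 * (c₃ : ℤ[X][X]) ^ 2 * (C X * X) ^ 6 +
      2 * (c₂ : ℤ[X][X]) * (c₃ : ℤ[X][X]) * (C X * X) ^ 5 +
      (2 * (c₂ : ℤ[X][X]) ^ 2 - 4 * (c₁ : ℤ[X][X]) * (c₃ : ℤ[X][X])) * (C X * X) ^ 4 +
      (2 * (c₁ : ℤ[X][X]) * (c₂ : ℤ[X][X]) + 2 * (c₀ : ℤ[X][X]) * (c₃ : ℤ[X][X])) *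
        (C X * X) ^ 3 +
      (2 * (c₁ : ℤ[X][X]) ^ 2 - 4 * (c₀ : ℤ[X][X]) * (c₂ : ℤ[X][X])) * (C X * X) ^ 2 +
      2 * (c₀ : ℤ[X][X]) * (c₁ : ℤ[X][X]) * (C X * X) + 2 * (c₀ : ℤ[X][X]) ^ 2)
  im := 2 * ((c₀ : ℤ[X][X]) + (c₁ : ℤ[X][X]) * (C X * X) + (c₂ : ℤ[X][X]) * (C X * X) ^ 2 +
    (c₃ : ℤ[X][X]) * (C X * X) ^ 3)

variable {c₀ c₁ c₂ c₃}

theorem C_mul_map_evenSextic : C (evenSextic c₀ c₁ c₂ c₃) * (evenSextic c₀ c₁ c₂ c₃).map C =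
    ((c₃ : ℤ[X][X]) * C X ^ 6 + (c₂ : ℤ[X][X]) * C X ^ 4 + (c₁ : ℤ[X][X]) * C X ^ 2 + (c₀ : ℤ[X][X])) *
      ((c₃ : ℤ[X][X]) * X ^ 6 + (c₂ : ℤ[X][X]) * X ^ 4 + (c₁ : ℤ[X][X]) * X ^ 2 + (c₀ : ℤ[X][X])) := by
  simp [evenSextic]

theorem thetaOne_mul_thetaTwo : thetaOne c₀ c₁ c₂ c₃ * thetaTwo c₀ c₁ c₂ c₃ =
    algebraMap ℤ[X][X] _ ((C X + X) ^ 2) * psi c₀ c₁ c₂ c₃ := by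
  rw [← Algebra.smul_def]
  ext1
  · rw [QuadraticAlgebra.re_mul, QuadraticAlgebra.re_smul]
    simp only [thetaOne, thetaTwo, psi, smul_eq_mul]
    rw [C_mul_map_evenSextic]
    ring
  · rw [QuadraticAlgebra.im_mul, QuadraticAlgebra.im_smul]
    simp only [thetaOne, thetaTwo, psi, smul_eq_mul]
    ring

theorem thetaOne_mul_star : star (thetaOne c₀ c₁ c₂ c₃) * thetaOne c₀ c₁ c₂ c₃ =
    algebraMap ℤ[X][X] _ ((X - C X) ^ 2 * ((C X + X) ^ 2 *
      (((c₃ : ℤ[X][X]) * (C X * X) ^ 2 - (c₁ : ℤ[X][X])) ^ 2 -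
        4 * (c₀ : ℤ[X][X]) * ((c₃ : ℤ[X][X]) * (C X ^ 2 + X ^ 2) + (c₂ : ℤ[X][X]))))) := by
  ext1
  · rw [QuadraticAlgebra.re_mul, QuadraticAlgebra.re_star, QuadraticAlgebra.im_star,
      QuadraticAlgebra.algebraMap_re]
    simp only [thetaOne]
    rw [C_mul_map_evenSextic]
    ring
  · rw [QuadraticAlgebra.im_mul, QuadraticAlgebra.re_star, QuadraticAlgebra.im_star,
      QuadraticAlgebra.algebraMap_im]
    ring

theorem thetaTwo_mul_star : star (thetaTwo c₀ c₁ c₂ c₃) * thetaTwo c₀ c₁ c₂ c₃ =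
    algebraMap ℤ[X][X] _ ((X - C X) ^ 2 * ((C X + X) ^ 2 *
      (((c₀ : ℤ[X][X]) - (c₂ : ℤ[X][X]) * (C X * X) ^ 2) ^ 2 -
        4 * (c₃ : ℤ[X][X]) * (C X * X) ^ 2 *
          ((c₀ : ℤ[X][X]) * (C X ^ 2 + X ^ 2) + (c₁ : ℤ[X][X]) * (C X * X) ^ 2)))) := by
  ext1
  · rw [QuadraticAlgebra.re_mul, QuadraticAlgebra.re_star, QuadraticAlgebra.im_star,
      QuadraticAlgebra.algebraMap_re]
    simp only [thetaTwo]
    rw [C_mul_map_evenSextic]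
    ring
  · rw [QuadraticAlgebra.im_mul, QuadraticAlgebra.re_star, QuadraticAlgebra.im_star,
      QuadraticAlgebra.algebraMap_im]
    ring

section degrees

theorem biDegLE_uv : BiDegLE (C X * X : ℤ[X][X]) 1 1 := by
  have h2 := BiDegLE.map_C_of_natDegree (f := (X : ℤ[X])) (N := 1) natDegree_X_le
  rw [map_X] at h2
  simpa using (BiDegLE.C_of_natDegree (f := (X : ℤ[X])) natDegree_X_le).mul h2

theorem biDegLE_uv_pow (k : ℕ) : BiDegLE ((C X * X : ℤ[X][X]) ^ k) k k := by
  simpa using biDegLE_uv.pow k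

theorem biDegLE_add : BiDegLE (C X + X : ℤ[X][X]) 1 1 := by
  have h2 := BiDegLE.map_C_of_natDegree (f := (X : ℤ[X])) (N := 1) natDegree_X_le
  rw [map_X] at h2
  exact ((BiDegLE.C_of_natDegree (f := (X : ℤ[X])) natDegree_X_le).mono le_rfl (by omega)).add
    (h2.mono (by omega) le_rfl)

theorem biDegLE_sq_add_sq : BiDegLE (C X ^ 2 + X ^ 2 : ℤ[X][X]) 2 2 := by
  have h2 := BiDegLE.map_C_of_natDegree (f := (X : ℤ[X])) (N := 1) natDegree_X_le
  rw [map_X] at h2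
  exact (((BiDegLE.C_of_natDegree (f := (X : ℤ[X])) natDegree_X_le).pow 2).mono
    (by omega) (by omega)).add ((h2.pow 2).mono (by omega) (by omega))

theorem biDegLE_intCast (c : ℤ) : BiDegLE (c : ℤ[X][X]) 0 0 := by
  have := BiDegLE.C_of_natDegree (f := (c : ℤ[X])) (M := 0) (by simp)
  simpa using this

theorem BiDegLE.intCast_mul {a : ℤ[X][X]} {M N : ℕ} (c : ℤ) (h : BiDegLE a M N) :
    BiDegLE ((c : ℤ[X][X]) * a) M N := by simpa using (biDegLE_intCast c).mul h

theorem degLE_thetaOne : DegLE (thetaOne c₀ c₁ c₂ c₃) 4 4 := by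
  constructor
  · have h1 := BiDegLE.intCast_mul c₃ ((biDegLE_uv_pow 2).mul biDegLE_sq_add_sq)
    have h2 := BiDegLE.intCast_mul (2 * c₂) (biDegLE_uv_pow 2)
    have h3 := BiDegLE.intCast_mul c₁ biDegLE_sq_add_sq
    have h4 := biDegLE_intCast (2 * c₀)
    push_cast at h2 h4
    exact ((h1.add (h2.mono (by omega) (by omega))).add (h3.mono (by omega) (by omega))).add
      (h4.mono (by omega) (by omega))
  · have h := BiDegLE.intCast_mul 2 (biDegLE_uv_pow 3)
    rw [mul_comm] at h
    push_cast at h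
    exact h.mono (by omega) (by omega)

theorem degLE_thetaTwo : DegLE (thetaTwo c₀ c₁ c₂ c₃) 4 4 := by
  constructor
  · have h1 := BiDegLE.intCast_mul c₂ ((biDegLE_uv_pow 2).mul biDegLE_sq_add_sq)
    have h2 := BiDegLE.intCast_mul (2 * c₁) (biDegLE_uv_pow 2)
    have h3 := BiDegLE.intCast_mul c₀ biDegLE_sq_add_sq
    have h4 := BiDegLE.intCast_mul (2 * c₃) (biDegLE_uv_pow 4)
    push_cast at h2 h4
    exact (((h3.mono (by omega) (by omega)).add (h2.mono (by omega) (by omega))).add h1).add h4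
  · have h := BiDegLE.intCast_mul 2 (biDegLE_uv_pow 4)
    push_cast at h
    have e : (C X * X : ℤ[X][X]) ^ 3 * (2 * (C X * X)) = 2 * (C X * X) ^ 4 := by ring
    change BiDegLE ((C X * X : ℤ[X][X]) ^ 3 * (2 * (C X * X))) 4 4
    rwa [e]

theorem degLE_psi : DegLE (psi c₀ c₁ c₂ c₃) 6 6 := by
  constructor
  · have m (c : ℤ) (k l : ℕ) (h : k + 2 * l ≤ 6) :
        BiDegLE ((c : ℤ[X][X]) * ((C X * X) ^ k * (C X ^ 2 + X ^ 2) ^ l)) 6 6 :=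
      (BiDegLE.intCast_mul c ((biDegLE_uv_pow k).mul (biDegLE_sq_add_sq.pow l))).mono
        (by omega) (by omega)
    have h := ((m (4 * c₃ * c₀) 1 2 (by omega)).add <| ((((m (c₂ * c₃) 4 1 (by omega)).add
      (m (4 * c₁ * c₃) 3 1 (by omega))).add (m (c₁ * c₂ - 7 * c₀ * c₃) 2 1 (by omega))).add
      (m (4 * c₀ * c₂) 1 1 (by omega))).add (m (c₀ * c₁) 0 1 (by omega))).add
      ((((((m (2 * c₃ ^ 2) 6 0 (by omega)).add (m (2 * c₂ * c₃) 5 0 (by omega))).add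
      (m (2 * c₂ ^ 2 - 4 * c₁ * c₃) 4 0 (by omega))).add
      (m (2 * c₁ * c₂ + 2 * c₀ * c₃) 3 0 (by omega))).add
      (m (2 * c₁ ^ 2 - 4 * c₀ * c₂) 2 0 (by omega))).add (m (2 * c₀ * c₁) 1 0 (by omega)) |>.add
      (m (2 * c₀ ^ 2) 0 0 (by omega)))
    push_cast at h
    simp only [pow_zero, pow_one, one_mul, mul_one] at h
    exact h
  · have m (c : ℤ) (k : ℕ) (h : k ≤ 6) : BiDegLE ((c : ℤ[X][X]) * (C X * X) ^ k) 6 6 :=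
      (BiDegLE.intCast_mul c (biDegLE_uv_pow k)).mono h h
    have h := (((m (2 * c₀) 3 (by omega)).add (m (2 * c₁) 4 (by omega))).add
      (m (2 * c₂) 5 (by omega))).add (m (2 * c₃) 6 le_rfl)
    push_cast at h
    have e : (C X * X : ℤ[X][X]) ^ 3 * (2 * ((c₀ : ℤ[X][X]) + (c₁ : ℤ[X][X]) * (C X * X) +
        (c₂ : ℤ[X][X]) * (C X * X) ^ 2 + (c₃ : ℤ[X][X]) * (C X * X) ^ 3)) =
        2 * (c₀ : ℤ[X][X]) * (C X * X) ^ 3 + 2 * (c₁ : ℤ[X][X]) * (C X * X) ^ 4 +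
        2 * (c₂ : ℤ[X][X]) * (C X * X) ^ 5 + 2 * (c₃ : ℤ[X][X]) * (C X * X) ^ 6 := by ring
    change BiDegLE ((C X * X : ℤ[X][X]) ^ 3 * (2 * ((c₀ : ℤ[X][X]) + (c₁ : ℤ[X][X]) * (C X * X) +
        (c₂ : ℤ[X][X]) * (C X * X) ^ 2 + (c₃ : ℤ[X][X]) * (C X * X) ^ 3))) 6 6
    rwa [e]

end degrees

section vanishing

variable {q : PowerSeries ℤ[X]} (hq : IsSqrtSeries (evenSextic c₀ c₁ c₂ c₃) q)

theorem X_pow_dvd_branch_of_mul {z w : SecRing (evenSextic c₀ c₁ c₂ c₃)} {a : ℤ[X][X]} {k : ℕ}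
    (h : z * w = algebraMap _ _ ((X - C X) ^ k * a))
    (hw : PowerSeries.constantCoeff (branch hq w) ≠ 0) :
    PowerSeries.X ^ k ∣ branch hq z := by
  refine X_pow_dvd_of_mul (b := branch hq w) ?_ hw
  rw [← map_mul, h, branch_algebraMap, map_mul, map_pow, map_sub, shiftHom_C, shiftHom_X]
  refine Dvd.dvd.mul_right (pow_dvd_pow_of_dvd ?_ k) _
  simp

theorem X_sq_dvd_branch_star_thetaOne (hf0 : evenSextic c₀ c₁ c₂ c₃ ≠ 0) :
    PowerSeries.X ^ 2 ∣ branch hq (star (thetaOne c₀ c₁ c₂ c₃)) := by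
  refine X_pow_dvd_branch_of_mul hq thetaOne_mul_star ?_
  rw [constantCoeff_branch]
  have : (thetaOne c₀ c₁ c₂ c₃).re.eval X + (thetaOne c₀ c₁ c₂ c₃).im.eval X *
      evenSextic c₀ c₁ c₂ c₃ = 4 * evenSextic c₀ c₁ c₂ c₃ := by
    simp [thetaOne, evenSextic]; ring
  rw [this]
  exact mul_ne_zero (by norm_num : (4 : ℤ[X]) ≠ 0) hf0

theorem X_sq_dvd_branch_star_thetaTwo (hf0 : evenSextic c₀ c₁ c₂ c₃ ≠ 0) :
    PowerSeries.X ^ 2 ∣ branch hq (star (thetaTwo c₀ c₁ c₂ c₃)) := by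
  refine X_pow_dvd_branch_of_mul hq thetaTwo_mul_star ?_
  rw [constantCoeff_branch]
  have : (thetaTwo c₀ c₁ c₂ c₃).re.eval X + (thetaTwo c₀ c₁ c₂ c₃).im.eval X *
      evenSextic c₀ c₁ c₂ c₃ = 4 * X ^ 2 * evenSextic c₀ c₁ c₂ c₃ := by
    simp [thetaTwo, evenSextic]; ring
  rw [this]
  exact mul_ne_zero (mul_ne_zero (by norm_num : (4 : ℤ[X]) ≠ 0) (pow_ne_zero _ X_ne_zero)) hf0

theorem X_pow_four_dvd_branch_star_psi (hf0 : evenSextic c₀ c₁ c₂ c₃ ≠ 0) :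
    PowerSeries.X ^ 4 ∣ branch hq (star (psi c₀ c₁ c₂ c₃)) := by
  have h1 := congrArg star (thetaOne_mul_thetaTwo (c₀ := c₀) (c₁ := c₁) (c₂ := c₂) (c₃ := c₃))
  have h2 : star (algebraMap ℤ[X][X] (SecRing (evenSextic c₀ c₁ c₂ c₃)) ((C X + X) ^ 2)) =
      algebraMap ℤ[X][X] (SecRing (evenSextic c₀ c₁ c₂ c₃)) ((C X + X) ^ 2) := by
    ext1 <;> simp only [QuadraticAlgebra.re_star, QuadraticAlgebra.im_star,
      QuadraticAlgebra.algebraMap_re, QuadraticAlgebra.algebraMap_im] <;> ring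
  rw [star_mul_eq, star_mul_eq, h2] at h1
  refine X_pow_dvd_of_mul (b := branch hq
    (algebraMap ℤ[X][X] (SecRing (evenSextic c₀ c₁ c₂ c₃)) ((C X + X) ^ 2))) ?_ ?_
  · rw [← map_mul, mul_comm (star _), ← h1, map_mul, show 4 = 2 + 2 from rfl, pow_add]
    exact mul_dvd_mul (X_sq_dvd_branch_star_thetaOne hq hf0)
      (X_sq_dvd_branch_star_thetaTwo hq hf0)
  · rw [branch_algebraMap, constantCoeff_shiftHom]
    simp only [eval_pow, eval_add, eval_C, eval_X]
    rw [← two_mul]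
    exact pow_ne_zero _ (mul_ne_zero two_ne_zero X_ne_zero)

end vanishing

/-- The quotients of `z⁴ θᵈ` by a power of the diagonal. -/
theorem exists_quotient_sections {f : ℤ[X]} {q : PowerSeries ℤ[X]} (hq : IsSqrtSeries f q)
    (hf0 : f ≠ 0) (hf : f.natDegree ≤ 6) {z : SecRing f} {m n d K : ℕ}
    (hz : DegLE z m n) (hd : PowerSeries.X ^ d ∣ branch hq z)
    (hK : size f z ≤ K) {θ : SecRing f} {e : ℕ}
    (he : e ≤ 4) (hθ : DegLE θ (2 + e) (2 + e)) (hv : PowerSeries.X ^ e ∣ branch hq (star θ)) :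
    ∃ w : SecRing f, algebraMap ℤ[X][X] (SecRing f) ((X - C X) ^ (d * e)) * w =
        z ^ 4 * θ ^ d ∧ DegLE w (4 * m + 2 * d) (4 * n + 2 * d) ∧
      size f w ≤ 4 ^ (4 * n + 6 * d) * (K ^ 4 * size f θ ^ d) := by
  have hde : d * e ≤ d * 4 := Nat.mul_le_mul_left d he
  have hK' : size f (z ^ 4 * θ ^ d) ≤ K ^ 4 * size f θ ^ d :=
    ((size f).mul _ _).trans (Nat.mul_le_mul (((size f).pow _ _).trans
      (Nat.pow_le_pow_left hK 4)) ((size f).pow _ _))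
  have hdeg : ∀ m, 4 * m + d * (2 + e) = 4 * m + 2 * d + d * e := fun m => by ring
  have hzθ := (hz.pow hf 4).mul hf (hθ.pow hf d)
  rw [hdeg, hdeg] at hzθ
  obtain ⟨w, h1, h2, h3⟩ := exists_quotient hq hf0 (z := z ^ 4 * θ ^ d) (e := d * e)
    (by
      rw [map_mul, map_pow]
      refine Dvd.dvd.mul_right (dvd_trans ?_ (pow_dvd_pow_of_dvd hd 4)) _
      rw [← pow_mul]
      exact pow_dvd_pow _ hde)
    (by
      have hs : star (z ^ 4 * θ ^ d) = star z ^ 4 * star θ ^ d := by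
        rw [star_mul_eq, star_pow_eq, star_pow_eq]
      rw [hs, map_mul, map_pow, map_pow, mul_comm d, pow_mul]
      exact (pow_dvd_pow_of_dvd hv d).mul_left _)
    hzθ
  exact ⟨w, h1, h2, h3.trans (Nat.mul_le_mul (Nat.pow_le_pow_right (by norm_num) (by omega)) hK')⟩

end SecRing

/-- The rational number `r` is an integer of absolute value at most `K`. -/
def IntLE (r : ℚ) (K : ℕ) : Prop := ∃ n : ℤ, r = n ∧ n.natAbs ≤ K

namespace IntLE

variable {r s : ℚ} {K L : ℕ}

theorem mono (h : IntLE r K) (hK : K ≤ L) : IntLE r L :=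
  let ⟨n, hn, h'⟩ := h; ⟨n, hn, h'.trans hK⟩

theorem add (hr : IntLE r K) (hs : IntLE s L) : IntLE (r + s) (K + L) := by
  obtain ⟨n, rfl, hn⟩ := hr
  obtain ⟨m, rfl, hm⟩ := hs
  exact ⟨n + m, by push_cast; rfl, (Int.natAbs_add_le n m).trans (add_le_add hn hm)⟩

theorem mul (hr : IntLE r K) (hs : IntLE s L) : IntLE (r * s) (K * L) := by
  obtain ⟨n, rfl, hn⟩ := hr
  obtain ⟨m, rfl, hm⟩ := hs
  exact ⟨n * m, by push_cast; rfl, by rw [Int.natAbs_mul]; exact Nat.mul_le_mul hn hm⟩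

theorem pow (hr : IntLE r K) (k : ℕ) : IntLE (r ^ k) (K ^ k) := by
  obtain ⟨n, rfl, hn⟩ := hr
  exact ⟨n ^ k, by push_cast; rfl, by rw [Int.natAbs_pow]; exact Nat.pow_le_pow_left hn k⟩

theorem intCast (n : ℤ) : IntLE n n.natAbs := ⟨n, rfl, le_rfl⟩

theorem natCast (n : ℕ) : IntLE n n := ⟨n, by simp, by simp⟩

theorem zero : IntLE 0 K := ⟨0, by simp, by simp⟩

theorem sum {ι : Type*} (s : Finset ι) {g : ι → ℚ} {B : ι → ℕ} (h : ∀ i ∈ s, IntLE (g i) (B i)) :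
    IntLE (∑ i ∈ s, g i) (∑ i ∈ s, B i) := by
  classical
  induction s using Finset.induction_on with
  | empty => simpa using zero
  | insert a s ha ih =>
    rw [Finset.sum_insert ha, Finset.sum_insert ha]
    exact (h a (by simp)).add (ih fun i hi => h i (by simp [hi]))

theorem den_mul (x : ℚ) : IntLE (x.den * x) (ratHeight x) :=
  ⟨x.num, by rw [mul_comm, Rat.mul_den_eq_num], le_max_left _ _⟩

theorem den (x : ℚ) : IntLE x.den (ratHeight x) := (natCast _).mono (le_max_right _ _)

/-- Values of integer polynomials at rational numbers. -/
theorem aeval (x : ℚ) {p : ℤ[X]} {n : ℕ} (hp : p.natDegree ≤ n) :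
    IntLE (x.den ^ n * aeval x p) (ratHeight x ^ n * RingSize.int.poly p) := by
  rw [aeval_eq_sum_range' (Nat.lt_succ_of_le hp), Finset.mul_sum,
    RingSize.int.poly_eq_of_natDegree_lt (Nat.lt_succ_of_le hp), Finset.mul_sum]
  refine IntLE.sum _ fun i hi => ?_
  obtain ⟨k, rfl⟩ := Nat.exists_eq_add_of_le (Nat.lt_succ_iff.1 (Finset.mem_range.1 hi))
  have h := (((den_mul x).pow i).mul ((den x).pow k)).mul (intCast (p.coeff i))
  convert h using 1
  · rw [zsmul_eq_mul]; ring
  · rw [pow_add, RingSize.int_toFun]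

/-- A rational number with integral square is an integer. -/
theorem of_sq (h : IntLE (r ^ 2) (K ^ 2)) : IntLE r K := by
  obtain ⟨n, hn, hK⟩ := h
  have hInt : IsLocalization.IsInteger ℤ r := by
    refine isInteger_of_is_root_of_monic (p := X ^ 2 - C n) (monic_X_pow_sub_C n two_ne_zero) ?_
    simp [hn]
  obtain ⟨m, hm⟩ := hInt
  refine ⟨m, by simpa using hm.symm, ?_⟩
  have h1 : (m : ℚ) ^ 2 = n := by rw [← hn, ← hm]; simp
  have h2 : m ^ 2 = n := by exact_mod_cast h1
  rw [← h2, Int.natAbs_pow] at hK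
  exact (Nat.pow_le_pow_iff_left two_ne_zero).1 hK

end IntLE

theorem ratHeight_pos (x : ℚ) : 0 < ratHeight x := lt_of_lt_of_le x.pos (le_max_right _ _)

/-- The denominators of the coefficients of `s` at `x` grow in a controlled way. -/
def CoeffLE (x : ℚ) (s : PowerSeries ℚ) (a K c : ℕ) : Prop :=
  ∀ I, IntLE (x.den ^ (a + 5 * I) * PowerSeries.coeff I s)
    (K * c ^ I * ratHeight x ^ (a + 5 * I))

namespace CoeffLE

variable {x : ℚ} {s t : PowerSeries ℚ} {a b K L c c' : ℕ}

theorem mono (h : CoeffLE x s a K c) (hab : a ≤ b) (hK : K ≤ L) (hc : c ≤ c') :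
    CoeffLE x s b L c' := fun I => by
  obtain ⟨k, rfl⟩ := Nat.exists_eq_add_of_le hab
  convert (((IntLE.den x).pow k).mul (h I)).mono (L := L * c' ^ I * ratHeight x ^ (a + k + 5 * I))
    ?_ using 1
  · ring
  · calc _ = K * c ^ I * ratHeight x ^ (a + k + 5 * I) := by ring
      _ ≤ _ := by gcongr

theorem mul (hs : CoeffLE x s a K c) (ht : CoeffLE x t b L c) :
    CoeffLE x (s * t) (a + b) (K * L) (2 * c) := fun I => by
  rw [PowerSeries.coeff_mul, Finset.mul_sum]
  refine (IntLE.sum _ (B := fun _ => K * L * c ^ I * ratHeight x ^ (a + b + 5 * I))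
    fun p hp => ?_).mono ?_
  · have hp' := Finset.HasAntidiagonal.mem_antidiagonal.1 hp
    convert (hs p.1).mul (ht p.2) using 1
    · rw [← hp']; ring
    · rw [← hp']; ring
  · rw [Finset.sum_const, Finset.Nat.card_antidiagonal, smul_eq_mul]
    have h2 : I + 1 ≤ 2 ^ I := Nat.lt_two_pow_self
    calc (I + 1) * (K * L * c ^ I * ratHeight x ^ (a + b + 5 * I)) ≤
        2 ^ I * (K * L * c ^ I * ratHeight x ^ (a + b + 5 * I)) := by gcongr
      _ = _ := by ring

end CoeffLE

section local_expansion

variable {f : ℤ[X]} {q : PowerSeries ℤ[X]}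

/-- Expansion of a polynomial near `x`, with local parameter `(u - x) / (4 f(x))`. -/
noncomputable def localHom (f : ℤ[X]) (x : ℚ) : ℤ[X] →+* PowerSeries ℚ :=
  (shiftHom x (4 * aeval x f)).comp (mapRingHom (Int.castRingHom ℚ))

/-- Expansion near `x` of the square root of `f` with value `Y` at `x`. -/
noncomputable def localSqrt (q : PowerSeries ℤ[X]) (x Y : ℚ) : PowerSeries ℚ :=
  PowerSeries.C Y * PowerSeries.map (aeval x).toRingHom q

theorem coeff_localHom (x : ℚ) (p : ℤ[X]) (n : ℕ) : PowerSeries.coeff n (localHom f x p) =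
    (4 * aeval x f) ^ n * (taylor x (p.map (Int.castRingHom ℚ))).coeff n :=
  coeff_shiftHom _ _ (p.map (Int.castRingHom ℚ)) n

theorem localHom_eq_map (x : ℚ) (p : ℤ[X]) : localHom f x p =
    PowerSeries.map (aeval x).toRingHom (shiftHom X (4 * f) (p.map C)) := by
  have : localHom f x = ((PowerSeries.map (aeval x).toRingHom).comp (shiftHom X (4 * f))).comp
      (mapRingHom C) := by
    refine Polynomial.ringHom_ext' (RingHom.ext_int _ _) ?_
    simp [localHom, map_ofNat (aeval x : ℤ[X] →ₐ[ℤ] ℚ)]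
  rw [this]; rfl

theorem localSqrt_sq (hq : IsSqrtSeries f q) {x Y : ℚ} (hY : Y ^ 2 = aeval x f) :
    localSqrt q x Y ^ 2 = localHom f x f := by
  rw [localHom_eq_map, ← hq.eq, localSqrt, mul_pow, ← map_pow, hY, map_mul, map_pow]
  simp

theorem coeff_zero_localSqrt (hq : IsSqrtSeries f q) (x Y : ℚ) :
    PowerSeries.constantCoeff (localSqrt q x Y) = Y := by
  have h : PowerSeries.constantCoeff (PowerSeries.map (aeval x).toRingHom q) = 1 := by
    rw [← PowerSeries.coeff_zero_eq_constantCoeff_apply, PowerSeries.coeff_map,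
      PowerSeries.coeff_zero_eq_constantCoeff_apply, hq.const, map_one]
  rw [localSqrt, map_mul, h]; simp

theorem coeffLE_localHom_X_pow (hf : f.natDegree ≤ 6) (x : ℚ) (i : ℕ) :
    CoeffLE x (localHom f x (X ^ i)) i (2 ^ i) (4 * RingSize.int.poly f) := fun I => by
  have hcoef : PowerSeries.coeff I (localHom f x (X ^ i)) =
      (4 * aeval x f) ^ I * (x ^ (i - I) * (i.choose I : ℚ)) := by
    rw [coeff_localHom]
    simp [taylor_apply, coeff_X_add_C_pow]
  rcases le_or_gt I i with h | h
  · obtain ⟨k, rfl⟩ := Nat.exists_eq_add_of_le h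
    have h1 := ((((IntLE.natCast 4).mul (IntLE.aeval x hf)).pow I).mul
      ((IntLE.den_mul x).pow k)).mul (IntLE.natCast ((I + k).choose I))
    rw [hcoef, Nat.add_sub_cancel_left]
    convert h1.mono (L := 2 ^ (I + k) * (4 * RingSize.int.poly f) ^ I *
      ratHeight x ^ (I + k + 5 * I)) ?_ using 1
    · push_cast; ring
    · calc _ = (I + k).choose I * (4 * RingSize.int.poly f) ^ I *
          ratHeight x ^ (I + k + 5 * I) := by ring
        _ ≤ _ := by gcongr; exact Nat.choose_le_two_pow _ _
  · rw [hcoef, Nat.choose_eq_zero_of_lt h]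
    simpa using IntLE.zero

theorem coeffLE_localSqrt (hq : IsSqrtSeries f q) (hf : f.natDegree ≤ 6) {x Y : ℚ}
    (hY : Y ^ 2 = aeval x f) :
    CoeffLE x (localSqrt q x Y) 3 (RingSize.int.poly f) (1024 * RingSize.int.poly f) := fun I => by
  have h1 : IntLE ((x.den : ℚ) ^ 3 * Y) (RingSize.int.poly f * ratHeight x ^ 3) := by
    refine IntLE.of_sq ((IntLE.aeval x hf).mono ?_ |> fun h => by
      convert h using 1; rw [← hY]; ring)
    rw [mul_pow, ← pow_mul, mul_comm]
    gcongr
    exact Nat.le_self_pow two_ne_zero _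
  have h2 := (IntLE.aeval x (hq.deg I)).mono (Nat.mul_le_mul_left _ (hq.size I))
  convert h1.mul h2 using 1
  · rw [localSqrt, PowerSeries.coeff_C_mul, PowerSeries.coeff_map]
    simp only [AlgHom.toRingHom_eq_coe, RingHom.coe_coe]
    ring
  · ring

end local_expansion

/-- The coefficient of `aⁱ bʲ` in a nested power series (inner variable `a`, outer `b`). -/
noncomputable def bicoeff (p : ℕ × ℕ) : PowerSeries (PowerSeries ℚ) →+ ℚ :=
  ((PowerSeries.coeff p.1 : PowerSeries ℚ →ₗ[ℚ] ℚ).toAddMonoidHom).comp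
    (PowerSeries.coeff p.2 : PowerSeries (PowerSeries ℚ) →ₗ[PowerSeries ℚ] _).toAddMonoidHom

theorem bicoeff_apply (p : ℕ × ℕ) (F : PowerSeries (PowerSeries ℚ)) :
    bicoeff p F = PowerSeries.coeff p.1 (PowerSeries.coeff p.2 F) := rfl

theorem bicoeff_C_mul_map (p : ℕ × ℕ) (s t : PowerSeries ℚ) :
    bicoeff p (PowerSeries.C s * PowerSeries.map PowerSeries.C t) =
      PowerSeries.coeff p.1 s * PowerSeries.coeff p.2 t := by
  rw [bicoeff_apply, PowerSeries.coeff_C_mul, PowerSeries.coeff_map, mul_comm,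
    PowerSeries.coeff_C_mul, mul_comm]

theorem bicoeff_mul (p : ℕ × ℕ) (F G : PowerSeries (PowerSeries ℚ)) :
    bicoeff p (F * G) = ∑ s ∈ Finset.HasAntidiagonal.antidiagonal p.1,
      ∑ t ∈ Finset.HasAntidiagonal.antidiagonal p.2,
        bicoeff (s.1, t.1) F * bicoeff (s.2, t.2) G := by
  simp only [bicoeff_apply, PowerSeries.coeff_mul, map_sum]
  rw [Finset.sum_comm]

/-- The constant coefficient of a nested power series. -/
noncomputable def bicoeffZero : PowerSeries (PowerSeries ℚ) →+* ℚ :=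
  PowerSeries.constantCoeff.comp PowerSeries.constantCoeff

theorem bicoeff_zero (F : PowerSeries (PowerSeries ℚ)) : bicoeff (0, 0) F = bicoeffZero F := by
  simp [bicoeff_apply, bicoeffZero]

theorem isUnit_of_bicoeffZero_ne_zero {F : PowerSeries (PowerSeries ℚ)} (h : bicoeffZero F ≠ 0) :
    IsUnit F := by
  rw [PowerSeries.isUnit_iff_constantCoeff, PowerSeries.isUnit_iff_constantCoeff]
  exact isUnit_iff_ne_zero.2 h

/-- The coefficient of `F` at `p` is `γ` and all coefficients before `p` vanish, with respect
to the order by weight `w₁ i + w₂ j` and then by `i`. -/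
def IsLead (w₁ w₂ : ℕ) (F : PowerSeries (PowerSeries ℚ)) (p : ℕ × ℕ) (γ : ℚ) : Prop :=
  bicoeff p F = γ ∧ ∀ p' : ℕ × ℕ, (p'.1 * w₁ + p'.2 * w₂ < p.1 * w₁ + p.2 * w₂ ∨
    p'.1 * w₁ + p'.2 * w₂ = p.1 * w₁ + p.2 * w₂ ∧ p'.1 < p.1) → bicoeff p' F = 0

namespace IsLead

variable {w₁ w₂ : ℕ} {F G : PowerSeries (PowerSeries ℚ)} {p p' : ℕ × ℕ} {γ γ' : ℚ}

theorem zero (F : PowerSeries (PowerSeries ℚ)) : IsLead w₁ w₂ F (0, 0) (bicoeffZero F) :=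
  ⟨bicoeff_zero F, fun p' h => by simp at h⟩

theorem mul (hw : 0 < w₂) (hF : IsLead w₁ w₂ F p γ) (hG : IsLead w₁ w₂ G p' γ') :
    IsLead w₁ w₂ (F * G) (p + p') (γ * γ') := by
  have key : ∀ s t : ℕ × ℕ, bicoeff s F * bicoeff t G ≠ 0 →
      (p.1 * w₁ + p.2 * w₂ < s.1 * w₁ + s.2 * w₂ ∨
        s.1 * w₁ + s.2 * w₂ = p.1 * w₁ + p.2 * w₂ ∧ p.1 ≤ s.1) ∧
      (p'.1 * w₁ + p'.2 * w₂ < t.1 * w₁ + t.2 * w₂ ∨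
        t.1 * w₁ + t.2 * w₂ = p'.1 * w₁ + p'.2 * w₂ ∧ p'.1 ≤ t.1) := by
    intro s t h
    have h1 := mt (hF.2 s) (left_ne_zero_of_mul h)
    have h2 := mt (hG.2 t) (right_ne_zero_of_mul h)
    omega
  constructor
  · rw [bicoeff_mul, Finset.sum_eq_single (p.1, p'.1), Finset.sum_eq_single (p.2, p'.2)]
    · rw [← hF.1, ← hG.1]
    · rintro ⟨j, j'⟩ hj hne
      by_contra h
      have := key _ _ h
      have hj := Finset.HasAntidiagonal.mem_antidiagonal.1 hj
      simp only [Prod.snd_add] at hj this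
      have h3 : p.2 * w₂ ≤ j * w₂ ∧ p'.2 * w₂ ≤ j' * w₂ := by omega
      have h4 := Nat.le_of_mul_le_mul_right h3.1 hw
      have h5 := Nat.le_of_mul_le_mul_right h3.2 hw
      exact hne (by ext <;> simp <;> omega)
    · simp [Finset.HasAntidiagonal.mem_antidiagonal]
    · rintro ⟨i, i'⟩ hi hne
      refine Finset.sum_eq_zero ?_
      rintro ⟨j, j'⟩ hj
      by_contra h
      have := key _ _ h
      have hi := Finset.HasAntidiagonal.mem_antidiagonal.1 hi
      have hj := Finset.HasAntidiagonal.mem_antidiagonal.1 hj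
      have e1 := congrArg (· * w₁) hi
      have e2 := congrArg (· * w₂) hj
      simp only [Prod.fst_add, Prod.snd_add, add_mul] at hi this e1 e2
      exact hne (by ext <;> simp <;> omega)
    · simp [Finset.HasAntidiagonal.mem_antidiagonal]
  · rintro ⟨a, b⟩ hab
    rw [bicoeff_mul]
    refine Finset.sum_eq_zero ?_
    rintro ⟨i, i'⟩ hi
    refine Finset.sum_eq_zero ?_
    rintro ⟨j, j'⟩ hj
    by_contra h
    have := key _ _ h
    have hi := Finset.HasAntidiagonal.mem_antidiagonal.1 hi
    have hj := Finset.HasAntidiagonal.mem_antidiagonal.1 hj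
    have e1 := congrArg (· * w₁) hi
    have e2 := congrArg (· * w₂) hj
    simp only [Prod.fst_add, Prod.snd_add, add_mul] at hi this e1 e2 hab
    omega

theorem exists_of_ne_zero {κ : ℕ} (h : ∃ p, p.1 * w₁ + p.2 * w₂ < κ ∧ bicoeff p F ≠ 0) :
    ∃ p γ, p.1 * w₁ + p.2 * w₂ < κ ∧ γ ≠ 0 ∧ IsLead w₁ w₂ F p γ := by
  classical
  have hwf := (InvImage.wf (fun p : ℕ × ℕ => toLex (p.1 * w₁ + p.2 * w₂, p.1))
    (wellFounded_lt (α := ℕ ×ₗ ℕ)))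
  obtain ⟨p, hp, hmin⟩ := hwf.has_min {p | bicoeff p F ≠ 0} (h.imp fun _ h => h.2)
  refine ⟨p, _, ?_, hp, rfl, fun p' hp' => ?_⟩
  · obtain ⟨p', h1, h2⟩ := h
    have := hmin p' h2
    simp only [InvImage, Prod.Lex.toLex_lt_toLex] at this
    omega
  · by_contra hne
    refine hmin p' hne ?_
    simpa only [InvImage, Prod.Lex.toLex_lt_toLex] using hp'

end IsLead

namespace SecRing

variable {f : ℤ[X]} {q : PowerSeries ℤ[X]} {x y Y₁ Y₂ : ℚ}

/-- Expansion of a bivariate polynomial near `(x, y)`. -/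
noncomputable def baseHom (f : ℤ[X]) (x y : ℚ) : ℤ[X][X] →+* PowerSeries (PowerSeries ℚ) :=
  eval₂RingHom (PowerSeries.C.comp (localHom f x))
    (PowerSeries.map PowerSeries.C (localHom f y X))

theorem baseHom_C (p : ℤ[X]) : baseHom f x y (C p) = PowerSeries.C (localHom f x p) := by
  simp [baseHom]

theorem baseHom_X : baseHom f x y X = PowerSeries.map PowerSeries.C (localHom f y X) := by
  simp [baseHom]

theorem baseHom_map_C (p : ℤ[X]) :
    baseHom f x y (p.map C) = PowerSeries.map PowerSeries.C (localHom f y p) := by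
  have : (baseHom f x y).comp (mapRingHom C) =
      (PowerSeries.map PowerSeries.C).comp (localHom f y) :=
    Polynomial.ringHom_ext' (RingHom.ext_int _ _) (by simp [baseHom_X])
  exact congrArg (fun φ => φ p) this

theorem bicoeff_baseHom_mul (P : ℤ[X][X]) (s t : PowerSeries ℚ) (p : ℕ × ℕ) :
    bicoeff p (baseHom f x y P * (PowerSeries.C s * PowerSeries.map PowerSeries.C t)) =
      ∑ j ∈ P.support, ∑ i ∈ (P.coeff j).support, ((P.coeff j).coeff i : ℚ) *
        (PowerSeries.coeff p.1 (localHom f x (X ^ i) * s) *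
          PowerSeries.coeff p.2 (localHom f y (X ^ j) * t)) := by
  conv_lhs => rw [P.as_sum_support_C_mul_X_pow]
  simp only [map_sum, Finset.sum_mul]
  refine Finset.sum_congr rfl fun j _ => ?_
  conv_lhs => rw [(P.coeff j).as_sum_support_C_mul_X_pow]
  simp only [map_sum, Finset.sum_mul]
  refine Finset.sum_congr rfl fun i _ => ?_
  have e : baseHom f x y (C (C ((P.coeff j).coeff i) * X ^ i) * X ^ j) *
      (PowerSeries.C s * PowerSeries.map PowerSeries.C t) = (P.coeff j).coeff i •
        (PowerSeries.C (localHom f x (X ^ i) * s) *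
          PowerSeries.map PowerSeries.C (localHom f y (X ^ j) * t)) := by
    rw [map_mul, map_pow, baseHom_X, baseHom_C, map_mul, zsmul_eq_mul, eq_intCast C]
    simp only [map_mul, map_pow, map_intCast]
    ring
  rw [← bicoeff_C_mul_map, e, map_zsmul, zsmul_eq_mul]

theorem bicoeff_baseHom (P : ℤ[X][X]) (p : ℕ × ℕ) : bicoeff p (baseHom f x y P) =
    (4 * aeval x f) ^ p.1 * (4 * aeval y f) ^ p.2 *
      ((biShift x y (P.map (mapRingHom (Int.castRingHom ℚ)))).coeff p.2).coeff p.1 := by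
  induction P using Polynomial.induction_on' with
  | add P Q hP hQ => rw [map_add, map_add, Polynomial.map_add, map_add, hP, hQ, coeff_add,
      coeff_add, mul_add]
  | monomial j P =>
    have e1 : baseHom f x y (monomial j P) = PowerSeries.C (localHom f x P) *
        PowerSeries.map PowerSeries.C (localHom f y (X ^ j)) := by
      rw [← C_mul_X_pow_eq_monomial, map_mul, map_pow, baseHom_C, baseHom_X, map_pow, map_pow]
    have e2 : biShift x y ((monomial j P).map (mapRingHom (Int.castRingHom ℚ))) =
        C (taylor x (P.map (Int.castRingHom ℚ))) *
          (taylor y ((X ^ j : ℤ[X]).map (Int.castRingHom ℚ))).map C := by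
      rw [← biShift_map_C, ← biShift_C, ← map_mul, ← C_mul_X_pow_eq_monomial]
      simp
    rw [e1, e2, bicoeff_C_mul_map, coeff_localHom, coeff_localHom, coeff_C_mul, coeff_map,
      coeff_mul_C]
    ring

/-- Expansion of a section near the point with coordinates `(x, Y₁)` and `(y, Y₂)`. -/
noncomputable def pointHom (hq : IsSqrtSeries f q) (h₁ : Y₁ ^ 2 = aeval x f)
    (h₂ : Y₂ ^ 2 = aeval y f) : SecRing f →+* PowerSeries (PowerSeries ℚ) where
  toFun z := baseHom f x y z.re + baseHom f x y z.im *
    (PowerSeries.C (localSqrt q x Y₁) * PowerSeries.map PowerSeries.C (localSqrt q y Y₂))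
  map_zero' := by simp
  map_one' := by simp [QuadraticAlgebra.re_one, QuadraticAlgebra.im_one]
  map_add' z w := by simp; ring
  map_mul' z w := by
    have e : baseHom f x y (C f * f.map C) = (PowerSeries.C (localSqrt q x Y₁) *
        PowerSeries.map PowerSeries.C (localSqrt q y Y₂)) ^ 2 := by
      rw [map_mul, baseHom_C, baseHom_map_C, ← localSqrt_sq hq h₁, ← localSqrt_sq hq h₂,
        map_pow, map_pow, mul_pow]
    simp only [QuadraticAlgebra.re_mul, QuadraticAlgebra.im_mul, map_add, map_mul, map_zero] at e ⊢
    rw [e]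
    ring

variable (hq : IsSqrtSeries f q) (h₁ : Y₁ ^ 2 = aeval x f) (h₂ : Y₂ ^ 2 = aeval y f)

theorem pointHom_algebraMap (P : ℤ[X][X]) :
    pointHom hq h₁ h₂ (algebraMap ℤ[X][X] (SecRing f) P) = baseHom f x y P := by
  simp [pointHom]

theorem bicoeffZero_pointHom (z : SecRing f) : bicoeffZero (pointHom hq h₁ h₂ z) =
    (z.re.map (aeval x).toRingHom).eval y + (z.im.map (aeval x).toRingHom).eval y * (Y₁ * Y₂) := by
  have e : bicoeffZero.comp (baseHom f x y) =
      (evalRingHom y).comp (mapRingHom (aeval x).toRingHom) := by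
    refine Polynomial.ringHom_ext' (Polynomial.ringHom_ext' (RingHom.ext_int _ _) ?_) ?_
    · simp [bicoeffZero, baseHom, localHom]
    · simp [bicoeffZero, baseHom, localHom]
  have e' (P : ℤ[X][X]) : bicoeffZero (baseHom f x y P) =
    (P.map (aeval x).toRingHom).eval y := congrArg (fun φ => φ P) e
  have e2 : bicoeffZero (PowerSeries.C (localSqrt q x Y₁) *
      PowerSeries.map PowerSeries.C (localSqrt q y Y₂)) = Y₁ * Y₂ := by
    rw [← bicoeff_zero, bicoeff_C_mul_map]
    simp only [PowerSeries.coeff_zero_eq_constantCoeff, coeff_zero_localSqrt hq]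
  rw [← e', ← e', ← e2, ← map_mul, ← map_add]
  rfl

theorem _root_.RingSize.sum_support_poly_poly (P : ℤ[X][X]) :
    ∑ j ∈ P.support, ∑ i ∈ (P.coeff j).support, ((P.coeff j).coeff i).natAbs =
      RingSize.int.poly.poly P := by
  have aux {R : Type} [CommRing R] (ν : RingSize R) (p : R[X]) :
      ∑ i ∈ p.support, ν (p.coeff i) = ν.poly p := by
    rw [ν.poly_eq_sum]
    refine Finset.sum_subset supp_subset_range_natDegree_succ fun i _ hi => ?_
    rw [notMem_support_iff.1 hi, ν.zero]
  rw [← aux]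
  exact Finset.sum_congr rfl fun j _ => aux RingSize.int _

theorem intLE_bicoeff_pointHom (hf : f.natDegree ≤ 6) (hf0 : f ≠ 0) {W : SecRing f} {M N : ℕ}
    (hW : DegLE W M N) (p : ℕ × ℕ) :
    IntLE (x.den ^ (M + 5 * p.1) * y.den ^ (N + 5 * p.2) * bicoeff p (pointHom hq h₁ h₂ W))
      (size f W * (2048 * RingSize.int.poly f) ^ (M + p.1 + (N + p.2) + 2) *
        (ratHeight x ^ (M + 5 * p.1) * ratHeight y ^ (N + 5 * p.2))) := by
  set L := RingSize.int.poly f with hL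
  have hL1 : 1 ≤ L := one_le_poly_size hf0
  have h2 : 2 ≤ 2048 * L := by omega
  have mono {x : ℚ} {s : PowerSeries ℚ} {a i K c M : ℕ} (h : CoeffLE x s a K c) (ha : a ≤ M)
      (hK : K ≤ 2 ^ i * L) (hi : i ≤ M) (hc : c ≤ 2048 * L) :
      CoeffLE x s M ((2048 * L) ^ (M + 1)) (2048 * L) := by
    refine h.mono ha (hK.trans ?_) hc
    rw [pow_succ]
    refine Nat.mul_le_mul ?_ (by omega)
    exact (Nat.pow_le_pow_left h2 i).trans (Nat.pow_le_pow_right (by omega) hi)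
  have c1 {x : ℚ} {i M : ℕ} (hi : i ≤ M) :
      CoeffLE x (localHom f x (X ^ i) * 1) M ((2048 * L) ^ (M + 1)) (2048 * L) := by
    rw [mul_one]
    exact mono (coeffLE_localHom_X_pow hf x i) hi (Nat.le_mul_of_pos_right _ hL1) hi (by omega)
  have c2 {x Y : ℚ} (h : Y ^ 2 = aeval x f) {i M : ℕ} (hi : i + 3 ≤ M) :
      CoeffLE x (localHom f x (X ^ i) * localSqrt q x Y) M ((2048 * L) ^ (M + 1)) (2048 * L) :=
    mono (((coeffLE_localHom_X_pow hf x i).mono le_rfl le_rfl (by omega)).mul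
      (coeffLE_localSqrt hq hf h)) hi le_rfl (by omega) (by omega)
  set B := (2048 * L) ^ (M + p.1 + (N + p.2) + 2) *
        (ratHeight x ^ (M + 5 * p.1) * ratHeight y ^ (N + 5 * p.2)) with hB
  have key (P : ℤ[X][X]) (s t : PowerSeries ℚ) (h : ∀ i j, (P.coeff j).coeff i ≠ 0 →
      CoeffLE x (localHom f x (X ^ i) * s) M ((2048 * L) ^ (M + 1)) (2048 * L) ∧
      CoeffLE y (localHom f y (X ^ j) * t) N ((2048 * L) ^ (N + 1)) (2048 * L)) :
      IntLE (x.den ^ (M + 5 * p.1) * y.den ^ (N + 5 * p.2) * bicoeff p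
        (baseHom f x y P * (PowerSeries.C s * PowerSeries.map PowerSeries.C t)))
        (RingSize.int.poly.poly P * B) := by
    rw [bicoeff_baseHom_mul, ← RingSize.sum_support_poly_poly, Finset.mul_sum, Finset.sum_mul]
    refine IntLE.sum _ fun j _ => ?_
    rw [Finset.mul_sum, Finset.sum_mul]
    refine IntLE.sum _ fun i hi => ?_
    obtain ⟨a1, a2⟩ := h i j (mem_support_iff.1 hi)
    convert (IntLE.intCast ((P.coeff j).coeff i)).mul ((a1 p.1).mul (a2 p.2)) using 1
    · ring
    · rw [hB]; ring
  have k1 := key W.re 1 1 fun i j hij => ⟨c1 (hW.1 j i hij).1, c1 (hW.1 j i hij).2⟩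
  have k2 := key W.im (localSqrt q x Y₁) (localSqrt q y Y₂) fun i j hij => by
    have := hW.2 (j + 3) (i + 3) (by rwa [coeff_coeff_pow_mul])
    exact ⟨c2 h₁ this.1, c2 h₂ this.2⟩
  rw [map_one, map_one, mul_one, mul_one] at k1
  convert (k1.add k2).mono (L := size f W * B) ?_ using 1
  · rw [← mul_add, ← map_add]; rfl
  · rw [hB]; ring
  · rw [← add_mul]
    refine Nat.mul_le_mul_right _ (Nat.add_le_add_left ?_ _)
    exact Nat.le_mul_of_pos_left _ (Nat.succ_pos _)

end SecRing

theorem Rat.den_dvd_of_mul_eq_intCast {z : ℚ} {n m : ℤ} (h : n * z = m) : (z.den : ℤ) ∣ n := by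
  have h1 : n * z.num = m * z.den := by
    have : (n : ℚ) * (z * z.den) = m * z.den := by rw [← mul_assoc, h]
    rw [Rat.mul_den_eq_num] at this
    exact_mod_cast this
  have h2 : IsCoprime (z.den : ℤ) z.num := by
    rw [Int.isCoprime_iff_nat_coprime]; exact z.reduced.symm
  exact h2.dvd_of_dvd_mul_right ⟨m, by rw [h1, mul_comm]⟩

/-- A lower bound for the height of `(1 : α : β : αβ)`. -/
theorem ratHeight_mul_le {g α β : ℚ} {N : ℕ} (hg : g ≠ 0) (h1 : IntLE g N) (h2 : IntLE (g * α) N)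
    (h3 : IntLE (g * β) N) (h4 : IntLE (g * (α * β)) N) : ratHeight α * ratHeight β ≤ N := by
  obtain ⟨n, rfl, hn⟩ := h1
  obtain ⟨a, ha, han⟩ := h2
  obtain ⟨b, hb, hbn⟩ := h3
  obtain ⟨c, hc, hcn⟩ := h4
  obtain ⟨k, rfl⟩ := Rat.den_dvd_of_mul_eq_intCast ha
  have hα := Rat.mul_den_eq_num α
  have hβ := Rat.mul_den_eq_num β
  push_cast at ha hb hc hg
  have e1 : (α.num : ℚ) * k = a := by rw [← ha, ← hα]; ring
  have hk : ∃ l : ℤ, (k : ℚ) * β = l := by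
    have hcop : IsCoprime (α.den : ℤ) α.num := by
      rw [Int.isCoprime_iff_nat_coprime]; exact α.reduced.symm
    obtain ⟨u, v, huv⟩ := hcop
    refine ⟨u * b + v * c, ?_⟩
    have huv' : (u : ℚ) * α.den + v * α.num = 1 := by exact_mod_cast huv
    push_cast
    rw [← hb, ← hc, ← one_mul ((k : ℚ) * β), ← huv', ← hα]
    ring
  obtain ⟨l, hl⟩ := hk
  obtain ⟨k', rfl⟩ := Rat.den_dvd_of_mul_eq_intCast hl
  push_cast at ha hb hc hl hg e1
  have hk' : 1 ≤ k'.natAbs := Nat.one_le_iff_ne_zero.2 fun h => by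
    rw [Int.natAbs_eq_zero] at h
    simp [h] at hg
  have ha' : a = α.num * (β.den * k') := by
    have : (a : ℚ) = α.num * (β.den * k') := by rw [← e1]
    exact_mod_cast this
  have hb' : b = α.den * β.num * k' := by
    have : (b : ℚ) = α.den * β.num * k' := by rw [← hb, ← hβ]; ring
    exact_mod_cast this
  have hc' : c = α.num * β.num * k' := by
    have : (c : ℚ) = α.num * β.num * k' := by rw [← hc, ← hβ, ← hα]; ring
    exact_mod_cast this
  rw [ha', Int.natAbs_mul, Int.natAbs_mul, ← mul_assoc] at han
  rw [hb', Int.natAbs_mul, Int.natAbs_mul] at hbn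
  rw [hc', Int.natAbs_mul, Int.natAbs_mul] at hcn
  rw [Int.natAbs_mul, Int.natAbs_mul, ← mul_assoc] at hn
  have h0 := fun u => Nat.le_mul_of_pos_right u hk'
  rw [ratHeight, ratHeight]
  rcases max_choice α.num.natAbs α.den with h | h <;>
    rcases max_choice β.num.natAbs β.den with h' | h' <;> rw [h, h']
  · exact (h0 _).trans hcn
  · exact (h0 _).trans han
  · exact (h0 _).trans hbn
  · exact (h0 _).trans hn

theorem ratHeight_pow (z : ℚ) (k : ℕ) : ratHeight (z ^ k) = ratHeight z ^ k := by
  rw [ratHeight, ratHeight, Rat.num_pow, Rat.den_pow, Int.natAbs_pow]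
  exact ((show Monotone (fun n : ℕ => n ^ k) from
    fun a b h => Nat.pow_le_pow_left h k).map_max).symm

namespace SecRing

variable {f : ℤ[X]} {q : PowerSeries ℤ[X]} {x y Y₁ Y₂ : ℚ}
  (hq : IsSqrtSeries f q) (h₁ : Y₁ ^ 2 = aeval x f) (h₂ : Y₂ ^ 2 = aeval y f)

theorem bicoeff_mul_eq_zero {w₁ w₂ κ : ℕ} {F : PowerSeries (PowerSeries ℚ)}
    (hF : ∀ p : ℕ × ℕ, p.1 * w₁ + p.2 * w₂ < κ → bicoeff p F = 0)
    (G : PowerSeries (PowerSeries ℚ)) (p : ℕ × ℕ) (hp : p.1 * w₁ + p.2 * w₂ < κ) :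
    bicoeff p (G * F) = 0 := by
  rw [mul_comm, bicoeff_mul]
  refine Finset.sum_eq_zero fun s hs => Finset.sum_eq_zero fun t ht => ?_
  rw [hF (s.1, t.1), zero_mul]
  refine lt_of_le_of_lt ?_ hp
  have hs := Finset.HasAntidiagonal.mem_antidiagonal.1 hs
  have ht := Finset.HasAntidiagonal.mem_antidiagonal.1 ht
  exact add_le_add (Nat.mul_le_mul_right _ (by omega)) (Nat.mul_le_mul_right _ (by omega))

theorem bicoeffZero_diag : bicoeffZero (baseHom f x y (X - C X)) = y - x := by
  simp [bicoeffZero, baseHom, localHom]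

theorem exists_inverse_diag (hxy : x ≠ y) (e : ℕ) : ∃ V : PowerSeries (PowerSeries ℚ),
    V * baseHom f x y ((X - C X) ^ e) = 1 := by
  have hu : IsUnit (baseHom f x y ((X - C X) ^ e)) := by
    rw [map_pow]
    exact (isUnit_of_bicoeffZero_ne_zero (by
      rw [bicoeffZero_diag]; exact sub_ne_zero.2 hxy.symm)).pow e
  exact hu.exists_left_inv

theorem bicoeff_quotient (hxy : x ≠ y) {w₁ w₂ : ℕ} (hw : 0 < w₂) {z θ w : SecRing f} {e k : ℕ}
    (h : algebraMap ℤ[X][X] (SecRing f) ((X - C X) ^ e) * w = z ^ 4 * θ ^ k) {p : ℕ × ℕ} {γ : ℚ}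
    (hp : IsLead w₁ w₂ (pointHom hq h₁ h₂ z) p γ) :
    bicoeff (4 * p.1, 4 * p.2) (pointHom hq h₁ h₂ w) =
      γ ^ 4 * bicoeffZero (pointHom hq h₁ h₂ θ) ^ k / (y - x) ^ e := by
  obtain ⟨V, hV⟩ := exists_inverse_diag (f := f) hxy e
  have h3 : pointHom hq h₁ h₂ w =
      V * (pointHom hq h₁ h₂ θ) ^ k * ((pointHom hq h₁ h₂ z * pointHom hq h₁ h₂ z) *
        (pointHom hq h₁ h₂ z * pointHom hq h₁ h₂ z)) := by
    have h' := congrArg (fun a => V * pointHom hq h₁ h₂ a) h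
    simp only [map_mul, pointHom_algebraMap, ← mul_assoc, hV, one_mul] at h'
    rw [h', map_pow, map_pow]
    ring
  have h4 := (IsLead.zero (w₁ := w₁) (w₂ := w₂) (V * (pointHom hq h₁ h₂ θ) ^ k)).mul hw
    ((hp.mul hw hp).mul hw (hp.mul hw hp))
  have h5 : (4 * p.1, 4 * p.2) = (0, 0) + (p + p + (p + p)) := by
    ext <;> simp <;> ring
  rw [h5, h3, h4.1, map_mul, map_pow]
  have h6 := congrArg bicoeffZero hV
  rw [map_mul, map_one, map_pow, map_pow, bicoeffZero_diag] at h6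
  rw [eq_div_iff (pow_ne_zero _ (sub_ne_zero.2 hxy.symm))]
  calc _ = bicoeffZero V * (y - x) ^ e *
        (γ ^ 4 * bicoeffZero (pointHom hq h₁ h₂ θ) ^ k) := by ring
    _ = _ := by rw [h6, one_mul]

theorem weightGE_of_bicoeff_eq_zero (hY₁ : Y₁ ≠ 0) (hY₂ : Y₂ ≠ 0) (hxy : x ≠ y) {w₁ w₂ κ d : ℕ}
    {z : SecRing f} {R : ℤ[X][X]}
    (hR : algebraMap ℤ[X][X] (SecRing f) ((X - C X) ^ d * R) = star z * z)
    (hz : ∀ p : ℕ × ℕ, p.1 * w₁ + p.2 * w₂ < κ → bicoeff p (pointHom hq h₁ h₂ z) = 0) :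
    WeightGE w₁ w₂ (biShift x y (R.map (mapRingHom (Int.castRingHom ℚ)))) κ := by
  intro i j hij
  by_contra hlt
  obtain ⟨V, hV⟩ := exists_inverse_diag (f := f) hxy d
  have h1 : baseHom f x y R = (V * pointHom hq h₁ h₂ (star z)) * pointHom hq h₁ h₂ z := by
    rw [mul_assoc, ← map_mul, ← hR, pointHom_algebraMap, map_mul, ← mul_assoc, hV, one_mul]
  have h2 := bicoeff_mul_eq_zero hz (V * pointHom hq h₁ h₂ (star z)) (i, j) (not_le.1 hlt)
  rw [← h1, bicoeff_baseHom, ← h₁, ← h₂] at h2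
  refine mul_ne_zero ?_ hij h2
  positivity

section dichotomy

variable {c₀ c₁ c₂ c₃ : ℤ}

/-- The abscissa of the difference of two points on the first elliptic quotient. -/
def xiOne (c₀ c₁ c₂ c₃ : ℤ) (x y Y : ℚ) : ℚ :=
  (c₃ * ((x * y) ^ 2 * (x ^ 2 + y ^ 2)) + 2 * c₂ * (x * y) ^ 2 + c₁ * (x ^ 2 + y ^ 2) + 2 * c₀ +
    2 * Y) / ((y - x) ^ 2 * (x + y) ^ 2)

/-- The abscissa of the difference of two points on the second elliptic quotient. -/
def xiTwo (c₀ c₁ c₂ c₃ : ℤ) (x y Y : ℚ) : ℚ :=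
  (c₀ * (x ^ 2 + y ^ 2) + 2 * c₁ * (x * y) ^ 2 + c₂ * ((x * y) ^ 2 * (x ^ 2 + y ^ 2)) +
    2 * c₃ * (x * y) ^ 4 + 2 * (x * y) * Y) / ((y - x) ^ 2 * (x + y) ^ 2)

theorem exists_bound_xi {q : PowerSeries ℤ[X]} (hq : IsSqrtSeries (evenSextic c₀ c₁ c₂ c₃) q)
    (hf0 : evenSextic c₀ c₁ c₂ c₃ ≠ 0) : ∃ T : ℕ, 1 ≤ T ∧ ∀ (x y Y₁ Y₂ : ℚ)
    (h₁ : Y₁ ^ 2 = aeval x (evenSextic c₀ c₁ c₂ c₃))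
    (h₂ : Y₂ ^ 2 = aeval y (evenSextic c₀ c₁ c₂ c₃)), x ≠ y → x + y ≠ 0 →
    ∀ (z : SecRing (evenSextic c₀ c₁ c₂ c₃)) (m n d K w₁ w₂ : ℕ) (p : ℕ × ℕ) (γ : ℚ),
    DegLE z m n → PowerSeries.X ^ d ∣ branch hq z → size _ z ≤ K → 0 < w₂ → γ ≠ 0 →
    IsLead w₁ w₂ (pointHom hq h₁ h₂ z) p γ →
    (ratHeight (xiOne c₀ c₁ c₂ c₃ x y (Y₁ * Y₂)) *
      ratHeight (xiTwo c₀ c₁ c₂ c₃ x y (Y₁ * Y₂))) ^ d ≤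
      4 ^ (4 * n + 6 * d) * (K ^ 4 * T ^ d) *
      T ^ (4 * m + 2 * d + 4 * p.1 + (4 * n + 2 * d + 4 * p.2) + 2) *
        (ratHeight x ^ (4 * m + 2 * d + 20 * p.1) *
          ratHeight y ^ (4 * n + 2 * d + 20 * p.2)) := by
  have hf := natDegree_evenSextic c₀ c₁ c₂ c₃
  have v1 := X_sq_dvd_branch_star_thetaOne hq hf0
  have v2 := X_sq_dvd_branch_star_thetaTwo hq hf0
  have v3 := X_pow_four_dvd_branch_star_psi hq hf0
  have g1 : DegLE (thetaOne c₀ c₁ c₂ c₃) (2 + 2) (2 + 2) := degLE_thetaOne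
  have g2 : DegLE (thetaTwo c₀ c₁ c₂ c₃) (2 + 2) (2 + 2) := degLE_thetaTwo
  have g3 : DegLE (psi c₀ c₁ c₂ c₃) (2 + 4) (2 + 4) := degLE_psi
  have hψ := thetaOne_mul_thetaTwo (c₀ := c₀) (c₁ := c₁) (c₂ := c₂) (c₃ := c₃)
  have ev1 : ∀ (x y Y₁ Y₂ : ℚ) h₁ h₂, bicoeffZero (pointHom (x := x) (y := y) (Y₁ := Y₁)
      (Y₂ := Y₂) hq h₁ h₂ (thetaOne c₀ c₁ c₂ c₃)) =
      c₃ * ((x * y) ^ 2 * (x ^ 2 + y ^ 2)) + 2 * c₂ * (x * y) ^ 2 + c₁ * (x ^ 2 + y ^ 2) + 2 * c₀ +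
        2 * (Y₁ * Y₂) := fun x y Y₁ Y₂ h₁ h₂ => by
    rw [bicoeffZero_pointHom]
    simp [thetaOne]
  have ev2 : ∀ (x y Y₁ Y₂ : ℚ) h₁ h₂, bicoeffZero (pointHom (x := x) (y := y) (Y₁ := Y₁)
      (Y₂ := Y₂) hq h₁ h₂ (thetaTwo c₀ c₁ c₂ c₃)) =
      c₀ * (x ^ 2 + y ^ 2) + 2 * c₁ * (x * y) ^ 2 + c₂ * ((x * y) ^ 2 * (x ^ 2 + y ^ 2)) +
        2 * c₃ * (x * y) ^ 4 + 2 * (x * y) * (Y₁ * Y₂) := fun x y Y₁ Y₂ h₁ h₂ => by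
    rw [bicoeffZero_pointHom]
    simp [thetaTwo]
  generalize thetaOne c₀ c₁ c₂ c₃ = θ₁ at *
  generalize thetaTwo c₀ c₁ c₂ c₃ = θ₂ at *
  generalize psi c₀ c₁ c₂ c₃ = ψ at *
  generalize evenSextic c₀ c₁ c₂ c₃ = f at *
  obtain ⟨T, hT⟩ : ∃ T, T = 2048 * RingSize.int.poly f + 4 + size f θ₁ + size f θ₂ + size f ψ :=
    ⟨_, rfl⟩
  refine ⟨T, by omega, ?_⟩
  intro x y Y₁ Y₂ h₁ h₂ hxy hxy' z m n d K w₁ w₂ p γ hz hd hK hw hγ hp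
  have hv : (y - x) ≠ 0 := sub_ne_zero.2 hxy.symm
  obtain ⟨u1, a1, b1, s1⟩ := exists_quotient_sections hq hf0 hf hz hd hK (by norm_num) g1 v1
  obtain ⟨u2, a2, b2, s2⟩ := exists_quotient_sections hq hf0 hf hz hd hK (by norm_num) g2 v2
  obtain ⟨u3, a3, b3, s3⟩ := exists_quotient_sections hq hf0 hf hz hd hK le_rfl g3 v3
  obtain ⟨u0, hu0⟩ : ∃ u0, u0 = z ^ 4 * algebraMap ℤ[X][X] (SecRing f) ((C X + X) ^ (2 * d)) :=
    ⟨_, rfl⟩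
  have a0 : algebraMap ℤ[X][X] (SecRing f) ((X - C X) ^ 0) * u0 =
      z ^ 4 * algebraMap ℤ[X][X] (SecRing f) ((C X + X) ^ 2) ^ d := by
    rw [pow_zero, map_one, one_mul, hu0, pow_mul, map_pow]
  have b0 : DegLE u0 (4 * m + 2 * d) (4 * n + 2 * d) := by
    rw [hu0]
    refine (hz.pow hf 4).mul hf (DegLE.algebraMap ?_)
    simpa only [mul_one] using biDegLE_add.pow (2 * d)
  have hK4 : size f (z ^ 4) ≤ K ^ 4 := ((size f).pow _ _).trans (Nat.pow_le_pow_left hK 4)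
  have s0 : size f u0 ≤ 4 ^ (4 * n + 6 * d) * (K ^ 4 * T ^ d) := by
    have hX : RingSize.int.poly.poly (C X + X : ℤ[X][X]) ≤ 2 := by
      refine (RingSize.add _ _ _).trans ?_
      rw [RingSize.poly_C]
      exact add_le_add RingSize.int.poly_X (RingSize.poly_X _)
    have h2 : size f (algebraMap ℤ[X][X] (SecRing f) ((C X + X) ^ (2 * d))) ≤ T ^ d := by
      refine (size_algebraMap_le _).trans ((RingSize.pow _ _ _).trans ?_)
      refine (Nat.pow_le_pow_left hX _).trans ?_
      rw [pow_mul]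
      exact Nat.pow_le_pow_left (by omega) d
    rw [hu0]
    refine ((size f).mul _ _).trans ((Nat.mul_le_mul hK4 h2).trans ?_)
    exact Nat.le_mul_of_pos_left _ (by positivity)
  have bound (u : SecRing f) (hb : DegLE u (4 * m + 2 * d) (4 * n + 2 * d)) {S : ℕ} (hS : S ≤ T)
      (hs : size f u ≤ 4 ^ (4 * n + 6 * d) * (K ^ 4 * S ^ d)) :
      IntLE (x.den ^ (4 * m + 2 * d + 5 * (4 * p.1)) * y.den ^ (4 * n + 2 * d + 5 * (4 * p.2)) *
          bicoeff (4 * p.1, 4 * p.2) (pointHom hq h₁ h₂ u))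
        (4 ^ (4 * n + 6 * d) * (K ^ 4 * T ^ d) *
      T ^ (4 * m + 2 * d + 4 * p.1 + (4 * n + 2 * d + 4 * p.2) + 2) *
        (ratHeight x ^ (4 * m + 2 * d + 20 * p.1) *
          ratHeight y ^ (4 * n + 2 * d + 20 * p.2))) := by
    refine (intLE_bicoeff_pointHom hq h₁ h₂ hf hf0 hb (4 * p.1, 4 * p.2)).mono ?_
    have e1 : ∀ a, 5 * (4 * a) = 20 * a := fun a => by ring
    simp only [e1]
    refine Nat.mul_le_mul_right _ (Nat.mul_le_mul (hs.trans ?_)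
      (Nat.pow_le_pow_left (by omega) _))
    gcongr
  have q0 := bicoeff_quotient hq h₁ h₂ hxy hw a0 hp
  have q1 := bicoeff_quotient hq h₁ h₂ hxy hw a1 hp
  have q2 := bicoeff_quotient hq h₁ h₂ hxy hw a2 hp
  have q3 := bicoeff_quotient hq h₁ h₂ hxy hw a3 hp
  have i0 := bound u0 b0 le_rfl s0
  have i1 := bound u1 b1 (by omega) s1
  have i2 := bound u2 b2 (by omega) s2
  have i3 := bound u3 b3 (by omega) s3
  have ev0 : bicoeffZero (pointHom hq h₁ h₂ (algebraMap ℤ[X][X] (SecRing f) ((C X + X) ^ 2))) =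
      (x + y) ^ 2 := by
    have h0 : bicoeffZero (baseHom f x y (C X + X)) = x + y := by
      simp [bicoeffZero, baseHom, localHom]
    rw [pointHom_algebraMap, map_pow, map_pow, h0]
  have ev3 := congrArg (fun a => bicoeffZero (pointHom hq h₁ h₂ a)) hψ
  simp only [map_mul] at ev3
  rw [ev0] at ev3
  have x1 : xiOne c₀ c₁ c₂ c₃ x y (Y₁ * Y₂) = bicoeffZero (pointHom hq h₁ h₂ θ₁) /
    ((y - x) ^ 2 * (x + y) ^ 2) := by rw [ev1]; rfl
  have x2 : xiTwo c₀ c₁ c₂ c₃ x y (Y₁ * Y₂) = bicoeffZero (pointHom hq h₁ h₂ θ₂) /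
    ((y - x) ^ 2 * (x + y) ^ 2) := by rw [ev2]; rfl
  rw [x1, x2, mul_pow, ← ratHeight_pow, ← ratHeight_pow]
  rw [ev0] at q0
  generalize bicoeffZero (pointHom hq h₁ h₂ θ₁) = t₁ at *
  generalize bicoeffZero (pointHom hq h₁ h₂ θ₂) = t₂ at *
  generalize bicoeffZero (pointHom hq h₁ h₂ ψ) = t₃ at *
  have hx := x.den_ne_zero
  have hy := y.den_ne_zero
  generalize y - x = v at hv q0 q1 q2 q3 ⊢
  generalize x + y = s at hxy' q0 ev3 ⊢
  refine ratHeight_mul_le ?_ i0 ?_ ?_ ?_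
  · rw [q0]
    positivity
  · convert i1 using 1
    rw [q0, q1]
    simp only [div_pow, mul_pow, pow_mul, pow_zero]
    field_simp
    ring
  · convert i2 using 1
    rw [q0, q2]
    simp only [div_pow, mul_pow, pow_mul, pow_zero]
    field_simp
    ring
  · convert i3 using 1
    have e3 : t₃ ^ d = t₁ ^ d * t₂ ^ d / (s ^ 2) ^ d := by
      rw [← mul_pow, ev3, mul_pow]
      field_simp
    rw [q0, q3, e3]
    simp only [div_pow, mul_pow, pow_mul, pow_zero]
    field_simp
    ring

end dichotomy

end SecRing

open SecRing in
/-- The main alternative: either two points of large and very different heights are excluded by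
Roth's lemma, or the product of the heights of the two differences is small. -/
theorem exists_dichotomy {c₀ c₁ c₂ c₃ : ℤ} (h0 : c₀ ≠ 0)
    (hns : ∀ a b : ℤ[X], ∀ c : ℤ, c ≠ 0 →
      a ^ 2 = b ^ 2 * (evenSextic c₀ c₁ c₂ c₃ * C c) → b = 0) :
    ∃ C₁ : ℕ, 1 ≤ C₁ ∧ ∀ x y Y₁ Y₂ : ℚ, Y₁ ^ 2 = aeval x (evenSextic c₀ c₁ c₂ c₃) →
      Y₂ ^ 2 = aeval y (evenSextic c₀ c₁ c₂ c₃) → Y₁ ≠ 0 → Y₂ ≠ 0 → x ≠ y → x + y ≠ 0 →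
      ∀ m n d D₁ D₂ κ : ℕ, 2 * m + 6 = D₁ + d → 2 * n + 6 = D₂ + d → 0 < d →
      2 ≤ n → 2 ≤ m → 0 < D₂ → D₂ ≤ D₁ → D₂ ≤ 2 * d → 16 * d ^ 2 ≤ 5 * (D₁ * D₂) →
      100 * (m + n + 6) ≤ d ^ 2 → 2 * ((m + 4) * (n + 4)) ≤ 2 ^ d →
      (∃ r o₁ o₂, 1 ≤ r ∧ r ≤ D₂ + 1 ∧ ratHeight x ^ o₁ ≤ (C₁ ^ D₁) ^ r ∧
        ratHeight y ^ o₂ ≤ (C₁ ^ D₁) ^ r ∧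
        ∑ b ∈ Finset.range r, (κ - r * D₂ - b * D₁) ≤ o₁ * D₂ + o₂ * D₁) ∨
      ∃ i j, i * D₂ + j * D₁ < κ ∧
        (ratHeight (xiOne c₀ c₁ c₂ c₃ x y (Y₁ * Y₂)) *
          ratHeight (xiTwo c₀ c₁ c₂ c₃ x y (Y₁ * Y₂))) ^ d ≤
        C₁ ^ (D₁ + i + j) * (ratHeight x ^ (2 * D₁ + 4 * d + 20 * i) *
          ratHeight y ^ (2 * D₂ + 4 * d + 20 * j)) := by
  have hf := natDegree_evenSextic c₀ c₁ c₂ c₃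
  have hc : (evenSextic c₀ c₁ c₂ c₃).coeff 0 ≠ 0 := by
    simpa [evenSextic, coeff_zero_eq_eval_zero] using h0
  have hf0 : evenSextic c₀ c₁ c₂ c₃ ≠ 0 := fun h => hc (by simp [h])
  obtain ⟨q, hq⟩ := exists_sqrt_series hf hf0
  replace hq : IsSqrtSeries (evenSextic c₀ c₁ c₂ c₃) q := ⟨hq.1, hq.2.1, hq.2.2.1, hq.2.2.2⟩
  obtain ⟨C₀, hC₀, haux⟩ := exists_auxiliary_section hq hc hf
  obtain ⟨T, hT, hbd⟩ := exists_bound_xi hq hf0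
  generalize evenSextic c₀ c₁ c₂ c₃ = f at *
  obtain ⟨S, hS⟩ : ∃ S, S = RingSize.int.poly.poly (C f * f.map C) := ⟨_, rfl⟩
  obtain ⟨L, hL⟩ : ∃ L, L = 1 + RingSize.int.poly f ^ 2 := ⟨_, rfl⟩
  have hL1 : 1 ≤ L := by omega
  obtain ⟨U, hU⟩ : ∃ U, U = 2 * (4 * 16) * C₀ ^ 2 * L := ⟨_, rfl⟩
  obtain ⟨V, hV⟩ : ∃ V, V = 4 ^ 10 * ((S + 2) * C₀) ^ 4 * T ^ 15 := ⟨_, rfl⟩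
  have hU1 : 1 ≤ U := by
    rw [hU]; exact Nat.one_le_iff_ne_zero.2 (by positivity)
  have hV1 : 1 ≤ V := by
    rw [hV]; exact Nat.one_le_iff_ne_zero.2 (by positivity)
  refine ⟨U * V, Nat.one_le_iff_ne_zero.2 (by positivity), ?_⟩
  intro x y Y₁ Y₂ h₁ h₂ hY₁ hY₂ hxy hxy' m n d D₁ D₂ κ hm hn hd hn2 hm2 hD0 hD hDd hDD hdd h2d
  have hdD : d ≤ D₁ := by
    by_contra hlt
    have h1 : D₁ * D₂ ≤ D₁ * D₁ := Nat.mul_le_mul_left _ hD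
    have h2 : D₁ * D₁ ≤ d * d := Nat.mul_le_mul (by omega) (by omega)
    have h3 : 0 < d * d := by positivity
    rw [pow_two] at hDD
    omega
  obtain ⟨A, B, hAB, hA, hB, hdvd, hAs, hBs⟩ := haux m n d D₁ D₂ hm hn hd hn2 hm2 hD hDd hDD hdd h2d
  by_cases hlight : ∃ p : ℕ × ℕ, p.1 * D₂ + p.2 * D₁ < κ ∧
      bicoeff p (pointHom hq h₁ h₂ (⟨A, B⟩ : SecRing f)) ≠ 0
  · right
    obtain ⟨p, γ, hp, hγ, hlead⟩ := IsLead.exists_of_ne_zero hlight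
    refine ⟨p.1, p.2, hp, ?_⟩
    have hz : DegLE (⟨A, B⟩ : SecRing f) (m + 3) (n + 3) :=
      ⟨hA, (biDegLE_pow_mul_iff 3).2 hB⟩
    have hsize : size f (⟨A, B⟩ : SecRing f) ≤ ((S + 2) * C₀) ^ D₁ := by
      have h1 : size f (⟨A, B⟩ : SecRing f) ≤ C₀ ^ D₁ + (S + 1) * C₀ ^ D₁ := by
        rw [hS]
        exact add_le_add hAs (Nat.mul_le_mul_left _ hBs)
      refine h1.trans ?_
      rw [mul_pow]
      have h2 : S + 2 ≤ (S + 2) ^ D₁ := Nat.le_self_pow (by omega) _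
      calc C₀ ^ D₁ + (S + 1) * C₀ ^ D₁ = (S + 2) * C₀ ^ D₁ := by ring
        _ ≤ _ := Nat.mul_le_mul_right _ h2
    have key := hbd x y Y₁ Y₂ h₁ h₂ hxy hxy' _ (m + 3) (n + 3) d _ D₂ D₁ p γ hz hdvd hsize
      (by omega) hγ hlead
    have e1 : 4 * (m + 3) + 2 * d = 2 * D₁ + 4 * d := by omega
    have e2 : 4 * (n + 3) + 2 * d = 2 * D₂ + 4 * d := by omega
    rw [e1, e2] at key
    refine key.trans (Nat.mul_le_mul_right _ ?_)
    obtain ⟨N, hN⟩ : ∃ N, N = D₁ + p.1 + p.2 := ⟨_, rfl⟩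
    rw [← hN]
    calc 4 ^ (4 * (n + 3) + 6 * d) * ((((S + 2) * C₀) ^ D₁) ^ 4 * T ^ d) *
          T ^ (2 * D₁ + 4 * d + 4 * p.1 + (2 * D₂ + 4 * d + 4 * p.2) + 2)
        = 4 ^ (4 * (n + 3) + 6 * d) * ((S + 2) * C₀) ^ (4 * D₁) *
          T ^ (d + (2 * D₁ + 4 * d + 4 * p.1 + (2 * D₂ + 4 * d + 4 * p.2) + 2)) := by
          rw [pow_add T d]; ring
      _ ≤ 4 ^ (10 * N) * ((S + 2) * C₀) ^ (4 * N) * T ^ (15 * N) := by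
          have : 0 < (S + 2) * C₀ := by positivity
          gcongr <;> omega
      _ = V ^ N := by
          rw [hV]
          generalize (S + 2) * C₀ = W
          rw [mul_pow, mul_pow, ← pow_mul, ← pow_mul, ← pow_mul]
      _ ≤ (U * V) ^ N := Nat.pow_le_pow_left (Nat.le_mul_of_pos_left _ (by omega)) _
  · left
    push Not at hlight
    obtain ⟨R, hR0, hR, hRb, hRs⟩ :=
      exists_norm_quotient hq hf0 hf hns hm hn hAB hA hB hdvd hAs hBs
    have hRz : algebraMap ℤ[X][X] (SecRing f) ((X - C X) ^ d * R) =
        star (⟨A, B⟩ : SecRing f) * ⟨A, B⟩ := by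
      rw [hR]
      ext1 <;> simp only [QuadraticAlgebra.re_star, QuadraticAlgebra.im_star,
        QuadraticAlgebra.re_mul, QuadraticAlgebra.im_mul, QuadraticAlgebra.algebraMap_re,
        QuadraticAlgebra.algebraMap_im] <;> ring
    have hw := weightGE_of_bicoeff_eq_zero hq h₁ h₂ hY₁ hY₂ hxy hRz hlight
    obtain ⟨r, o₁, o₂, hr1, hr2, ho₁, ho₂, hsum⟩ := roth_lemma hR0 hRb hRs x y hw
    have hK : (D₂ + 1) * (2 ^ (D₁ + D₂) * (4 ^ (D₂ + d) * ((C₀ ^ D₁) ^ 2 *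
        (1 + RingSize.int.poly f ^ 2)))) ≤ (U * V) ^ D₁ := by
      rw [← hL]
      have h1 : D₂ + 1 ≤ 2 ^ D₁ := Nat.lt_two_pow_self.trans_le (Nat.pow_le_pow_right two_pos hD)
      have h2 : 2 ^ (D₁ + D₂) ≤ 4 ^ D₁ := by
        rw [show 4 = 2 ^ 2 from rfl, ← pow_mul]; exact Nat.pow_le_pow_right two_pos (by omega)
      have h3 : 4 ^ (D₂ + d) ≤ 16 ^ D₁ := by
        rw [show 16 = 4 ^ 2 from rfl, ← pow_mul]
        exact Nat.pow_le_pow_right (by norm_num) (by omega)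
      have h4 : L ≤ L ^ D₁ := Nat.le_self_pow (by omega) _
      calc _ ≤ 2 ^ D₁ * (4 ^ D₁ * (16 ^ D₁ * ((C₀ ^ D₁) ^ 2 * L ^ D₁))) := by gcongr
        _ = U ^ D₁ := by rw [hU, mul_pow, mul_pow, mul_pow, mul_pow]; ring
        _ ≤ _ := Nat.pow_le_pow_left (Nat.le_mul_of_pos_right _ (by omega)) _
    exact ⟨r, o₁, o₂, hr1, hr2, ho₁.trans (Nat.pow_le_pow_left hK r),
      ho₂.trans (Nat.pow_le_pow_left hK r), hsum⟩

theorem two_mul_pow_four_le_two_pow {d : ℕ} (hd : 20 ≤ d) : 2 * d ^ 4 ≤ 2 ^ d := by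
  induction d, hd using Nat.le_induction with
  | base => norm_num
  | succ k hk ih =>
    have h1 : (k + 1) ^ 4 ≤ 2 * k ^ 4 := by
      obtain ⟨j, rfl⟩ := Nat.exists_eq_add_of_le hk
      ring_nf
      nlinarith [Nat.zero_le (j ^ 4), Nat.zero_le (j ^ 3), Nat.zero_le (j ^ 2)]
    rw [pow_succ 2]
    omega

theorem exists_nat_parity (a : ℝ) (ha : 0 ≤ a) (d : ℕ) :
    ∃ D k : ℕ, D + d = 2 * k ∧ a ≤ D ∧ (D : ℝ) ≤ a + 2 := by
  have h1 := Nat.le_ceil a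
  have h2 := Nat.ceil_lt_add_one ha
  obtain ⟨k, hk⟩ | ⟨k, hk⟩ := Nat.even_or_odd (⌈a⌉₊ + d)
  · exact ⟨⌈a⌉₊, k, by omega, h1, by linarith⟩
  · exact ⟨⌈a⌉₊ + 1, k + 1, by omega, by push_cast; linarith, by push_cast; linarith⟩

theorem roth_sum_le {D₁ D₂ e r : ℕ} (he : e ≤ D₂ + 1) (hr : r ≤ D₂ + 1) :
    r * e ^ 2 * D₁ ≤ (D₂ + 1) *
      ∑ b ∈ Finset.range r, (2 * e * D₁ + (D₂ + 1) * D₂ - r * D₂ - b * D₁) := by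
  have h1 : min r e * (e * D₁) ≤
      ∑ b ∈ Finset.range r, (2 * e * D₁ + (D₂ + 1) * D₂ - r * D₂ - b * D₁) := by
    calc min r e * (e * D₁) = ∑ b ∈ Finset.range (min r e), e * D₁ := by simp
      _ ≤ ∑ b ∈ Finset.range (min r e),
          (2 * e * D₁ + (D₂ + 1) * D₂ - r * D₂ - b * D₁) := by
        refine Finset.sum_le_sum fun b hb => ?_
        have hb' : b ≤ e := (Finset.mem_range.1 hb).le.trans (min_le_right _ _)
        have e1 := Nat.mul_le_mul_right D₁ hb'
        have e2 := Nat.mul_le_mul_right D₂ hr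
        rw [mul_assoc]
        omega
      _ ≤ _ := Finset.sum_le_sum_of_subset (Finset.range_subset_range.2 (min_le_left _ _))
  have h2 : r * e ≤ (D₂ + 1) * min r e := by
    rcases le_total r e with h | h
    · rw [min_eq_left h, mul_comm]; exact Nat.mul_le_mul_right _ he
    · rw [min_eq_right h]; exact Nat.mul_le_mul_right _ hr
  calc r * e ^ 2 * D₁ = r * e * (e * D₁) := by ring
    _ ≤ (D₂ + 1) * min r e * (e * D₁) := Nat.mul_le_mul_right _ h2
    _ = (D₂ + 1) * (min r e * (e * D₁)) := by ring
    _ ≤ _ := Nat.mul_le_mul_left _ h1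

theorem roth_sum_contradiction {s h C : ℝ} {D₁ D₂ e r o₁ o₂ : ℕ} (hC : 0 ≤ C)
    (hh0 : 0 < h) (hh : 10 ^ 7 * C < h) (hD₁0 : (0 : ℝ) < D₁) (hD₂1 : (1 : ℝ) ≤ D₂)
    (e1 : (D₁ : ℝ) ≤ s ^ 2 * (2 * D₂)) (he3 : e ≤ D₂ + 1) (he1 : (D₂ : ℝ) ≤ 1000 * e)
    (hr1 : 1 ≤ r) (hr2 : r ≤ D₂ + 1) (ho₁ : o₁ * h ≤ r * (D₁ * C))
    (ho₂ : o₂ * (s ^ 2 * h) ≤ r * (D₁ * C))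
    (hsum : ∑ b ∈ Finset.range r, (2 * e * D₁ + (D₂ + 1) * D₂ - r * D₂ - b * D₁) ≤
      o₁ * D₂ + o₂ * D₁) : False := by
  have hD₂0 : (0 : ℝ) < D₂ := by linarith
  have h1 := (roth_sum_le (D₁ := D₁) he3 hr2).trans (Nat.mul_le_mul_left _ hsum)
  have h1' : (r * e ^ 2 * D₁ : ℝ) ≤ (D₂ + 1) * (o₁ * D₂ + o₂ * D₁) := by exact_mod_cast h1
  have h2 : o₂ * D₁ * h ≤ r * (D₁ * C) * (2 * D₂) := by
    calc o₂ * D₁ * h ≤ o₂ * (s ^ 2 * (2 * D₂)) * h := by gcongr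
      _ = o₂ * (s ^ 2 * h) * (2 * D₂) := by ring
      _ ≤ _ := by gcongr
  have h3 : (o₁ * D₂ + o₂ * D₁) * h ≤ r * (D₁ * C) * (3 * D₂) := by
    have := mul_le_mul_of_nonneg_right ho₁ hD₂0.le
    linarith
  have h4 : (r * e ^ 2 * D₁ : ℝ) * h ≤ (D₂ + 1) * (r * (D₁ * C) * (3 * D₂)) := by
    calc (r * e ^ 2 * D₁ : ℝ) * h ≤ (D₂ + 1) * (o₁ * D₂ + o₂ * D₁) * h := by gcongr
      _ = (D₂ + 1) * ((o₁ * D₂ + o₂ * D₁) * h) := by ring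
      _ ≤ _ := by gcongr
  have hr0 : (0 : ℝ) < r := by exact_mod_cast hr1
  have h5 : (e : ℝ) ^ 2 * h ≤ (D₂ + 1) * (C * (3 * D₂)) := by
    have : (r * D₁ : ℝ) * (e ^ 2 * h) ≤ (r * D₁) * ((D₂ + 1) * (C * (3 * D₂))) := by
      linarith
    exact le_of_mul_le_mul_left this (by positivity)
  have h6 : (D₂ : ℝ) ^ 2 * h ≤ 10 ^ 6 * ((D₂ + 1) * (C * (3 * D₂))) := by
    have : (D₂ : ℝ) ^ 2 ≤ (1000 * e) ^ 2 := by gcongr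
    calc (D₂ : ℝ) ^ 2 * h ≤ (1000 * e) ^ 2 * h := by gcongr
      _ = 10 ^ 6 * (e ^ 2 * h) := by ring
      _ ≤ _ := by gcongr
  have h7 : (D₂ + 1) * (C * (3 * D₂)) ≤ (2 * D₂) * (C * (3 * D₂)) := by
    gcongr; linarith
  have h8 : (D₂ : ℝ) ^ 2 * (6 * 10 ^ 6 * C) < (D₂ : ℝ) ^ 2 * h :=
    mul_lt_mul_of_pos_left (by linarith) (by positivity)
  linarith

set_option maxHeartbeats 1000000 in
theorem exists_vojta_parameters {s h C c : ℝ} (hs : 40 ≤ s) (hC : 0 ≤ C) (hc : 0 ≤ c)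
    (hh : 10 ^ 7 * (C + c + 1) ≤ h) : ∃ m n d D₁ D₂ κ : ℕ, 2 * m + 6 = D₁ + d ∧
      2 * n + 6 = D₂ + d ∧ 0 < d ∧ 2 ≤ n ∧ 2 ≤ m ∧ 0 < D₂ ∧ D₂ ≤ D₁ ∧ D₂ ≤ 2 * d ∧
      16 * d ^ 2 ≤ 5 * (D₁ * D₂) ∧ 100 * (m + n + 6) ≤ d ^ 2 ∧ 2 * ((m + 4) * (n + 4)) ≤ 2 ^ d ∧
      (∀ r o₁ o₂ : ℕ, 1 ≤ r → r ≤ D₂ + 1 → o₁ * h ≤ r * (D₁ * C) → o₂ * (s ^ 2 * h) ≤ r * (D₁ * C) →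
        ∑ b ∈ Finset.range r, (κ - r * D₂ - b * D₁) ≤ o₁ * D₂ + o₂ * D₁ → False) ∧
      ∀ i j : ℕ, i * D₂ + j * D₁ < κ → (D₁ + i + j) * C + ((2 * D₁ + 4 * d + 20 * i) * h +
        (2 * D₂ + 4 * d + 20 * j) * (s ^ 2 * h)) <
        d * (4 * h + 4 * (s ^ 2 * h) + 7.92 * (s * h) - 2 * c) := by
  have hh0 : 0 < h := by linarith
  obtain ⟨d, hd⟩ := exists_nat_ge (2000 * s)
  have hd0 : (0 : ℝ) < d := by linarith
  have hs0 : 0 < s := by linarith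
  obtain ⟨w, hw⟩ : ∃ w : ℝ, w = d / s := ⟨_, rfl⟩
  have hws : w * s = d := by rw [hw]; field_simp
  have hw2 : 2000 ≤ w := by rw [hw, le_div_iff₀ hs0]; exact hd
  have hwd : 40 * w ≤ d := by rw [← hws, mul_comm]; gcongr
  obtain ⟨D₁, k₁, hk₁, hl₁, hu₁⟩ := exists_nat_parity (15 / 8 * (s * d)) (by positivity) d
  obtain ⟨D₂, k₂, hk₂, hl₂, hu₂⟩ := exists_nat_parity (15 / 8 * w) (by linarith) d
  have hsd : 80000 * s ≤ s * d := by rw [mul_comm]; gcongr; linarith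
  have hD₁ : (D₁ : ℝ) ≤ 1.01 * (15 / 8) * (s * d) := by linarith
  have hD₂ : (D₂ : ℝ) ≤ 1.01 * (15 / 8) * w := by linarith
  have hd80 : 80000 ≤ d := by
    have : (80000 : ℝ) ≤ d := by linarith
    exact_mod_cast this
  have hwsd : 1600 * w ≤ s * d := by
    calc 1600 * w = 40 * (40 * w) := by ring
      _ ≤ _ := by gcongr
  have hD : D₂ ≤ D₁ := by
    have : (D₂ : ℝ) ≤ D₁ := by linarith
    exact_mod_cast this
  have hsdd : 2000 * (s * d) ≤ d * d := by rw [← mul_assoc]; gcongr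
  have hdd : 80000 * (d : ℝ) ≤ d * d := by gcongr; linarith
  have hdD : 4 * (50 * (D₁ + D₂ + 2 * d)) ≤ 4 * (d ^ 2) := by
    have : (4 : ℝ) * (50 * (D₁ + D₂ + 2 * d)) ≤ 4 * (d ^ 2) := by linarith
    exact_mod_cast this
  have hmn : 100 * (k₁ - 3 + (k₂ - 3) + 6) ≤ d ^ 2 := by omega
  obtain ⟨e, he1, he2⟩ : ∃ e : ℕ, (D₂ : ℝ) ≤ 1000 * e ∧ (1000 * e : ℝ) ≤ 2 * D₂ := by
    refine ⟨⌈(D₂ : ℝ) / 1000⌉₊, ?_, ?_⟩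
    · have := Nat.le_ceil ((D₂ : ℝ) / 1000); linarith
    · have := Nat.ceil_lt_add_one (a := (D₂ : ℝ) / 1000) (by positivity); linarith
  have he3 : e ≤ D₂ + 1 := by
    have : (e : ℝ) ≤ D₂ + 1 := by linarith
    exact_mod_cast this
  have hD₂0 : (0 : ℝ) < D₂ := by linarith
  have hD₁0 : (0 : ℝ) < D₁ := by linarith
  refine ⟨k₁ - 3, k₂ - 3, d, D₁, D₂, 2 * e * D₁ + (D₂ + 1) * D₂, by omega, by omega, by omega,
    by omega, by omega, by exact_mod_cast hD₂0, hD, ?_, ?_, hmn, ?_, ?_, ?_⟩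
  · have : (D₂ : ℝ) ≤ 2 * d := by linarith
    exact_mod_cast this
  · have h1 : (15 / 8 * (s * d)) * (15 / 8 * w) ≤ D₁ * D₂ := by gcongr
    have h2 : (15 / 8 * (s * d)) * (15 / 8 * w) = (15 / 8) ^ 2 * (d : ℝ) ^ 2 := by
      rw [← hws]; ring
    have : (16 : ℝ) * d ^ 2 ≤ 5 * (D₁ * D₂) := by linarith [sq_nonneg (d : ℝ)]
    exact_mod_cast this
  · refine le_trans ?_ (two_mul_pow_four_le_two_pow (by omega))
    have h1 : k₁ - 3 + 4 ≤ d ^ 2 := by omega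
    have h2 : k₂ - 3 + 4 ≤ d ^ 2 := by omega
    calc _ ≤ 2 * (d ^ 2 * d ^ 2) := Nat.mul_le_mul_left _ (Nat.mul_le_mul h1 h2)
      _ = _ := by ring
  · intro r o₁ o₂ hr1 hr2 ho₁ ho₂ hsum
    refine roth_sum_contradiction hC hh0 (by linarith) hD₁0 (by linarith) ?_ he3 he1 hr1 hr2 ho₁ ho₂
      hsum
    have : s ^ 2 * w = s * d := by rw [← hws]; ring
    have h1 := mul_le_mul_of_nonneg_left hl₂ (sq_nonneg s)
    linarith
  · intro i j hij
    clear hk₁ hk₂ hdD hmn hd80 hD hwd hsdd hdd hw he1 he3 hsd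
    have hij' : (i * D₂ + j * D₁ : ℝ) ≤ 2 * e * D₁ + (D₂ + 1) * D₂ := by exact_mod_cast hij.le
    clear hij
    obtain ⟨I, hI⟩ : ∃ I : ℝ, I = i + j * s ^ 2 := ⟨_, rfl⟩
    have hI0 : 0 ≤ I := by rw [hI]; positivity
    have hsw : s ^ 2 * w = s * d := by rw [← hws]; ring
    have h1 : 15 / 8 * w * I ≤ 2 * e * D₁ + (D₂ + 1) * D₂ := by
      refine le_trans ?_ hij'
      calc 15 / 8 * w * I = i * (15 / 8 * w) + j * (15 / 8 * (s * d)) := by rw [hI, ← hsw]; ring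
        _ ≤ _ := by gcongr
    have h2 : 2 * e * D₁ + (D₂ + 1) * D₂ ≤ 15 / 8 * w * (0.01 * (s * d)) := by
      have a1 : (2 * e * D₁ : ℝ) ≤ (2 * (1.01 * (15 / 8) * w)) / 500 * (1.01 * (15 / 8) * (s * d)) := by
        have : (2 * e : ℝ) ≤ (2 * (1.01 * (15 / 8) * w)) / 500 := by linarith
        gcongr
      have a2 : (D₂ + 1) * D₂ ≤ 1.02 * (15 / 8) * w * (1.01 * (15 / 8) * w) := by
        have : (D₂ + 1 : ℝ) ≤ 1.02 * (15 / 8) * w := by linarith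
        gcongr
      have a4 : w * (1600 * w) ≤ w * (s * d) := by gcongr
      have a5 : 0 ≤ w * (s * d) := by positivity
      linarith
    have h3 : I ≤ 0.01 * (s * d) := by
      have := h1.trans h2
      exact le_of_mul_le_mul_left this (by linarith)
    have h4 : (i + j : ℝ) ≤ I := by
      have : (j : ℝ) ≤ j * s ^ 2 := le_mul_of_one_le_right (by positivity) (one_le_pow₀ (by linarith))
      rw [hI]; linarith
    clear h1 h2 hij' he2 hws hD₂ hw2
    obtain ⟨g, hg⟩ : ∃ g, g = s * d * h := ⟨_, rfl⟩
    have b1 : (D₁ + i + j) * C ≤ 3 * (s * d) * C := by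
      gcongr; linarith
    have b2 : 3 * (s * d) * C ≤ 0.01 * g := by
      have : (s * d) * (300 * C) ≤ (s * d) * h := by gcongr; linarith
      rw [hg]; linarith
    have b3 : 20 * (i * h + j * (s ^ 2 * h)) ≤ 0.2 * g := by
      calc 20 * (i * h + j * (s ^ 2 * h)) = 20 * I * h := by rw [hI]; ring
        _ ≤ 20 * (0.01 * (s * d)) * h := by gcongr
        _ = _ := by rw [hg]; ring
    have b4 : 2 * D₁ * h ≤ 15 / 4 * g + 4 * h := by
      have := mul_le_mul_of_nonneg_right hu₁ hh0.le
      rw [hg]; linarith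
    have b5 : 2 * D₂ * (s ^ 2 * h) ≤ 15 / 4 * g + 4 * (s ^ 2 * h) := by
      have := mul_le_mul_of_nonneg_right hu₂ (by positivity : 0 ≤ s ^ 2 * h)
      have e : w * (s ^ 2 * h) = g := by rw [hg, ← hsw]; ring
      linarith
    have b6 : s ^ 2 * h ≤ g / 2000 := by
      have : s * h * (2000 * s) ≤ s * h * d := by gcongr
      rw [hg]; linarith
    have b7 : h ≤ s ^ 2 * h := le_mul_of_one_le_left hh0.le (one_le_pow₀ (by linarith))
    have b8 : d * (2 * c) ≤ 0.01 * g := by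
      have e1 : d * (200 * c) ≤ d * h := by gcongr; linarith
      have e2 : d * h ≤ s * (d * h) := le_mul_of_one_le_left (by positivity) (by linarith)
      rw [hg]; linarith
    have hg0 : 0 < g := by rw [hg]; positivity
    clear hI h3 h4 hu₁ hu₂ hl₁ hl₂ hD₁ hwsd
    have b9 : d * (7.92 * (s * h)) = 7.92 * g := by rw [hg]; ring
    linarith

theorem mul_log_le_of_pow_le {a b o r D : ℕ} (ha : 0 < a) (h : a ^ o ≤ (b ^ D) ^ r) :
    o * Real.log a ≤ r * (D * Real.log b) := by
  have h1 : ((a ^ o : ℕ) : ℝ) ≤ (((b ^ D) ^ r : ℕ) : ℝ) := by exact_mod_cast h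
  have h2 := Real.log_le_log (by positivity) h1
  push_cast at h2
  rwa [Real.log_pow, Real.log_pow, Real.log_pow] at h2

theorem ratHeight_neg (x : ℚ) : ratHeight (-x) = ratHeight x := by
  simp [ratHeight]

open SecRing in
/-- The gap principle: the points attached to two rational points of large and very different
heights cannot both have heights as large as forced by a small angle. -/
theorem exists_gap_contradiction {c₀ c₁ c₂ c₃ : ℤ} (h0 : c₀ ≠ 0)
    (hns : ∀ a b : ℤ[X], ∀ c : ℤ, c ≠ 0 →
      a ^ 2 = b ^ 2 * (evenSextic c₀ c₁ c₂ c₃ * C c) → b = 0) {c : ℝ} (hc : 0 ≤ c) :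
    ∃ H₀ : ℝ, 0 < H₀ ∧ ∀ x y Y₁ Y₂ : ℚ, Y₁ ^ 2 = aeval x (evenSextic c₀ c₁ c₂ c₃) →
      Y₂ ^ 2 = aeval y (evenSextic c₀ c₁ c₂ c₃) → Y₁ ≠ 0 → Y₂ ≠ 0 →
      H₀ ≤ Real.log (ratHeight x) → 1600 * Real.log (ratHeight x) ≤ Real.log (ratHeight y) →
      (∀ ξ, ξ = xiOne c₀ c₁ c₂ c₃ x y (Y₁ * Y₂) ∨ ξ = xiTwo c₀ c₁ c₂ c₃ x y (Y₁ * Y₂) →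
        2 * Real.log (ratHeight x) + 2 * Real.log (ratHeight y) +
        3.96 * √(Real.log (ratHeight x) * Real.log (ratHeight y)) - c ≤
        Real.log (ratHeight ξ)) → False := by
  obtain ⟨C₁, hC₁, key⟩ := exists_dichotomy h0 hns
  have hC0 : 0 ≤ Real.log C₁ := Real.log_nonneg (by exact_mod_cast hC₁)
  refine ⟨10 ^ 7 * (Real.log C₁ + c + 1), by positivity, ?_⟩
  intro x y Y₁ Y₂ h₁ h₂ hY₁ hY₂ hx hxy hξ
  have hx0 : 0 < Real.log (ratHeight x) := lt_of_lt_of_le (by positivity) hx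
  have hne : ratHeight x ≠ ratHeight y := fun h => by rw [h] at hx0 hxy; linarith
  have hne1 : x ≠ y := fun h => hne (by rw [h])
  have hne2 : x + y ≠ 0 := fun h => hne (by rw [eq_neg_of_add_eq_zero_left h, ratHeight_neg])
  have key := key x y Y₁ Y₂ h₁ h₂ hY₁ hY₂ hne1 hne2
  have e1 := hξ _ (Or.inl rfl)
  have e2 := hξ _ (Or.inr rfl)
  have p1 := ratHeight_pos (xiOne c₀ c₁ c₂ c₃ x y (Y₁ * Y₂))
  have p2 := ratHeight_pos (xiTwo c₀ c₁ c₂ c₃ x y (Y₁ * Y₂))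
  have p3 := ratHeight_pos x
  have p4 := ratHeight_pos y
  generalize ratHeight (xiOne c₀ c₁ c₂ c₃ x y (Y₁ * Y₂)) = u₁ at *
  generalize ratHeight (xiTwo c₀ c₁ c₂ c₃ x y (Y₁ * Y₂)) = u₂ at *
  generalize ratHeight x = a at *
  generalize ratHeight y = b at *
  clear hξ hne h₁ h₂ hns
  obtain ⟨s, hs⟩ : ∃ s, s = √(Real.log b / Real.log a) := ⟨_, rfl⟩
  have hs2 : s ^ 2 * Real.log a = Real.log b := by
    rw [hs, Real.sq_sqrt (div_nonneg (by linarith) hx0.le)]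
    field_simp
  have hs40 : 40 ≤ s := by
    rw [hs]
    refine Real.le_sqrt_of_sq_le ?_
    rw [le_div_iff₀ hx0]
    linarith
  have hg : √(Real.log a * Real.log b) = s * Real.log a := by
    rw [← hs2, show Real.log a * (s ^ 2 * Real.log a) = (s * Real.log a) ^ 2 by ring,
      Real.sqrt_sq (by positivity)]
  obtain ⟨m, n, d, D₁, D₂, κ, q1, q2, q3, q4, q5, q6, q7, q8, q9, q10, q11, hroth, hlow⟩ :=
    exists_vojta_parameters hs40 hC0 hc hx
  rw [hs2] at hroth hlow
  rw [hg] at e1 e2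
  obtain ⟨r, o₁, o₂, hr1, hr2, ho₁, ho₂, hsum⟩ | ⟨i, j, hij, hle⟩ :=
    key m n d D₁ D₂ κ q1 q2 q3 q4 q5 q6 q7 q8 q9 q10 q11
  · exact hroth r o₁ o₂ hr1 hr2 (mul_log_le_of_pow_le p3 ho₁) (mul_log_le_of_pow_le p4 ho₂) hsum
  · refine (hlow i j hij).not_ge ?_
    have h1 : (((u₁ * u₂) ^ d : ℕ) : ℝ) ≤ ((C₁ ^ (D₁ + i + j) *
      (a ^ (2 * D₁ + 4 * d + 20 * i) * b ^ (2 * D₂ + 4 * d + 20 * j)) : ℕ) : ℝ) := by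
      exact_mod_cast hle
    have h2 := Real.log_le_log (by positivity) h1
    push_cast at h2
    rw [Real.log_pow, Real.log_mul (by positivity) (by positivity),
      Real.log_mul (by positivity) (by positivity), Real.log_mul (by positivity) (by positivity),
      Real.log_pow, Real.log_pow, Real.log_pow] at h2
    push_cast at h2
    refine le_trans (mul_le_mul_of_nonneg_left ?_ (Nat.cast_nonneg d)) h2
    linarith

namespace ShortCurve

open WeierstrassCurve WeierstrassCurve.Affine Height

section Formulas

variable {F : Type*} [Field F] {W : WeierstrassCurve.Affine F}

private lemma eval_addSubMap (W : WeierstrassCurve.Affine F) (s t u : F) :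
    (fun i ↦ (addSubMap W i).eval ![s, t, u]) =
      ![s ^ 2 - W.b₄ * s * u - W.b₆ * t * u - W.b₈ * u ^ 2,
        2 * t * s + W.b₂ * s * u + W.b₄ * t * u + W.b₆ * u ^ 2, t ^ 2 - 4 * s * u] := by
  ext i
  fin_cases i <;> simp [addSubMap]

lemma equation_short (h1 : W.a₁ = 0) (h3 : W.a₃ = 0) {x y : F} (h : W.Nonsingular x y) :
    y ^ 2 = x ^ 3 + W.a₂ * x ^ 2 + W.a₄ * x + W.a₆ := by
  have := (W.equation_iff x y).mp h.1
  simpa [h1, h3] using this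

variable [DecidableEq F]

lemma exists_smul_sym2x_of_X_ne (h1 : W.a₁ = 0) (h3 : W.a₃ = 0) {x₁ y₁ x₂ y₂ : F}
    (p : W.Nonsingular x₁ y₁) (q : W.Nonsingular x₂ y₂) (hx : x₁ ≠ x₂) :
    ∃ t : F, t ≠ 0 ∧
      (fun i ↦ (addSubMap W i).eval (Point.sym2x (.some x₁ y₁ p) (.some x₂ y₂ q))) =
        t • Point.sym2x (Point.some x₁ y₁ p + .some x₂ y₂ q)
          (Point.some x₁ y₁ p - .some x₂ y₂ q) := by
  have hd : x₁ - x₂ ≠ 0 := sub_ne_zero.mpr hx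
  have e1 := equation_short h1 h3 p
  have e2 := equation_short h1 h3 q
  refine ⟨(x₁ - x₂) ^ 2, pow_ne_zero 2 hd, ?_⟩
  rw [sub_eq_add_neg (Point.some x₁ y₁ p), Point.neg_some, Point.add_of_X_ne hx,
    Point.add_of_X_ne hx,
    Point.sym2x_some_some, Point.sym2x_some_some, eval_addSubMap]
  simp only [slope_of_X_ne hx, addX, negY, h1, h3, b₂, b₄, b₆, b₈]
  ext i
  fin_cases i
  · simp
    field_simp
    linear_combination
      (-(y₁ ^ 2 - y₂ ^ 2 + (x₁ ^ 3 + W.a₂ * x₁ ^ 2 + W.a₄ * x₁ + W.a₆)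
        - (x₂ ^ 3 + W.a₂ * x₂ ^ 2 + W.a₄ * x₂ + W.a₆))
        + 2 * (W.a₂ + x₁ + x₂) * (x₁ - x₂) ^ 2) * e1 +
      ((y₁ ^ 2 - y₂ ^ 2 + (x₁ ^ 3 + W.a₂ * x₁ ^ 2 + W.a₄ * x₁ + W.a₆)
        - (x₂ ^ 3 + W.a₂ * x₂ ^ 2 + W.a₄ * x₂ + W.a₆))
        + 2 * (W.a₂ + x₁ + x₂) * (x₁ - x₂) ^ 2) * e2
  · simp
    field_simp
    linear_combination (-2 : F) * e1 - 2 * e2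
  · simp
    ring

variable [CharZero F]

lemma exists_smul_sym2x_self (h1 : W.a₁ = 0) (h3 : W.a₃ = 0)
    [W.IsElliptic] (P : W.Point) :
    ∃ t : F, t ≠ 0 ∧
      (fun i ↦ (addSubMap W i).eval (Point.sym2x P P)) = t • Point.sym2x (P + P) 0 := by
  rcases P with _ | ⟨x, y, p⟩
  · refine ⟨1, one_ne_zero, ?_⟩
    rw [← Point.zero_def, add_zero, Point.sym2x_zero_zero, eval_addSubMap]
    ext i
    fin_cases i <;> simp
  have e1 := equation_short h1 h3 p
  by_cases hy : y = 0
  · have h0 := addSubMap_ne_zero W (Point.sym2x_ne_zero (.some x y p) (.some x y p))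
    rw [Point.add_self_of_Y_eq (by simp [negY, h1, h3, hy]), Point.sym2x_zero_zero]
    rw [Point.sym2x_some_some, eval_addSubMap] at h0 ⊢
    subst hy
    have z1 : 2 * (x + x) * (x * x) + W.b₂ * (x * x) * 1 + W.b₄ * (x + x) * 1 + W.b₆ * 1 ^ 2 = 0 := by
      simp only [b₂, b₄, b₆, h1, h3]
      linear_combination (-4 : F) * e1
    have z2 : (x + x) ^ 2 - 4 * (x * x) * 1 = 0 := by ring
    rw [z1, z2] at h0 ⊢
    refine ⟨_, fun h ↦ h0 (congrArg (fun z ↦ ![z, 0, 0]) h |>.trans ?_), ?_⟩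
    · ext i
      fin_cases i <;> simp
    · ext i
      fin_cases i <;> simp
  · have hne : y ≠ W.negY x y := by
      simp only [negY, h1, h3]
      intro h
      exact hy (by
        have : 2 * y = 0 := by linear_combination h
        simpa using this)
    refine ⟨4 * y ^ 2, mul_ne_zero (by norm_num) (pow_ne_zero 2 hy), ?_⟩
    rw [Point.add_self_of_Y_ne hne, Point.sym2x_some_some, Point.sym2x_some_zero, eval_addSubMap]
    have h4 : y + y ≠ 0 := by
      rw [← two_mul]; exact mul_ne_zero two_ne_zero hy
    simp only [slope_of_Y_ne rfl hne, addX, negY, h1, h3, b₂, b₄, b₆, b₈]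
    ext i
    fin_cases i
    · simp
      field_simp
      linear_combination (32 * x + 16 * W.a₂) * e1
    · simp
      linear_combination (-4 : F) * e1
    · simp
      ring

lemma exists_smul_sym2x (h1 : W.a₁ = 0) (h3 : W.a₃ = 0)
    [W.IsElliptic] (P Q : W.Point) :
    ∃ t : F, t ≠ 0 ∧
      (fun i ↦ (addSubMap W i).eval (Point.sym2x P Q)) = t • Point.sym2x (P + Q) (P - Q) := by
  by_cases h : P.xRep = Q.xRep
  · rcases Point.eq_or_eq_neg_of_xRep_eq_xRep h with rfl | rfl
    · simpa using exists_smul_sym2x_self h1 h3 P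
    · have := exists_smul_sym2x_self h1 h3 Q
      rw [Point.sym2x_neg_left, neg_add_cancel, Point.sym2x_comm,
        show -Q - Q = -(Q + Q) by abel, Point.sym2x_comm 0, Point.sym2x_neg_left]
      exact this
  rcases P with _ | ⟨x₁, y₁, p⟩ <;> rcases Q with _ | ⟨x₂, y₂, q⟩
  · exact absurd rfl h
  · refine ⟨1, one_ne_zero, ?_⟩
    rw [← Point.zero_def, zero_add, zero_sub, Point.sym2x_neg_right, Point.sym2x_zero_some,
      Point.sym2x_some_some, eval_addSubMap]
    ext i
    fin_cases i <;> simp <;> ring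
  · refine ⟨1, one_ne_zero, ?_⟩
    rw [← Point.zero_def, add_zero, sub_zero, Point.sym2x_some_zero,
      Point.sym2x_some_some, eval_addSubMap]
    ext i
    fin_cases i <;> simp <;> ring
  · exact exists_smul_sym2x_of_X_ne h1 h3 p q fun hx ↦ h (by simp [hx])

end Formulas

section Height

variable {W : WeierstrassCurve.Affine ℚ}

/-- The naive logarithmic height of a point, that is the height of its `x`-coordinate. -/
noncomputable def naiveHeight (P : W.Point) : ℝ := logHeight P.xRep

lemma naiveHeight_nonneg (P : W.Point) : 0 ≤ naiveHeight P := logHeight_nonneg _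

lemma naiveHeight_some {x y : ℚ} (h : W.Nonsingular x y) :
    naiveHeight (.some x y h) = Real.log (ratHeight x) := by
  rw [naiveHeight, Point.xRep_some, ← logHeight₁_eq_logHeight, Rat.logHeight₁_eq_log_max]
  rfl

theorem exists_parallelogram (h1 : W.a₁ = 0) (h3 : W.a₃ = 0) [W.IsElliptic] :
    ∃ C, ∀ P Q : W.Point, |naiveHeight (P + Q) + naiveHeight (P - Q)
      - 2 * (naiveHeight P + naiveHeight Q)| ≤ C := by
  obtain ⟨C₁, hC₁⟩ := abs_logHeight_addSubMap_sub_two_mul_logHeight_le W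
  obtain ⟨C₂, hC₂⟩ := abs_logHeight_sym2_sub_le ℚ
  have key (P Q : W.Point) :
      |logHeight (Point.sym2x P Q) - (naiveHeight P + naiveHeight Q)| ≤ C₂ := by
    have hP := Point.xRep_ne_zero P
    have hQ := Point.xRep_ne_zero Q
    have e (R : W.Point) : R.xRep = ![R.xRep 0, R.xRep 1] := by
      ext i; fin_cases i <;> rfl
    have := hC₂ (e P ▸ hP) (e Q ▸ hQ)
    rw [← e P, ← e Q] at this
    exact this
  refine ⟨C₁ + 3 * C₂, fun P Q ↦ ?_⟩
  obtain ⟨t, ht, h⟩ := exists_smul_sym2x h1 h3 P Q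
  have i1 := hC₁ (Point.sym2x P Q)
  rw [h, logHeight_smul_eq_logHeight _ ht] at i1
  have i2 := key P Q
  have i3 := key (P + Q) (P - Q)
  rw [abs_le] at *
  constructor <;> linarith [i1.1, i1.2, i2.1, i2.2, i3.1, i3.2]

instance northcott_naiveHeight : Northcott (naiveHeight (W := W)) where
  finite_le B := by
    have hf := NumberField.finite_setOfPred_logHeight₁_le (K := ℚ) B
    have hfin : ((fun x : ℚ ↦ ![x, 1]) '' {x : ℚ | logHeight₁ x ≤ B} ∪ {![1, 0]}).Finite :=
      (hf.image _).union (Set.finite_singleton _)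
    refine (hfin.preimage' (f := Point.xRep (W' := W)) fun v _ ↦ ?_).subset ?_
    · by_cases hv : ∃ P : W.Point, P.xRep = v
      · obtain ⟨P, rfl⟩ := hv
        refine (Set.toFinite {P, -P}).subset fun Q hQ ↦ ?_
        exact Point.eq_or_eq_neg_of_xRep_eq_xRep hQ
      · refine Set.finite_empty.subset fun P hP ↦ hv ⟨P, hP⟩
    · rintro (_ | ⟨x, y, p⟩) hP
      · right; rfl
      · left
        refine ⟨x, ?_, rfl⟩
        simpa [naiveHeight, logHeight₁_eq_logHeight] using hP

end Height

end ShortCurve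

namespace SplitCurve

open WeierstrassCurve WeierstrassCurve.Affine

/-- The cubic `y² = (x - e₁)(x - e₂)(x - e₃)`. -/
@[simps] def curve (e₁ e₂ e₃ : ℚ) : WeierstrassCurve.Affine ℚ where
  a₁ := 0
  a₂ := -(e₁ + e₂ + e₃)
  a₃ := 0
  a₄ := e₁ * e₂ + e₁ * e₃ + e₂ * e₃
  a₆ := -(e₁ * e₂ * e₃)

lemma isElliptic {e₁ e₂ e₃ : ℚ} (h12 : e₁ ≠ e₂) (h13 : e₁ ≠ e₃) (h23 : e₂ ≠ e₃) :
    WeierstrassCurve.IsElliptic (curve e₁ e₂ e₃) := by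
  refine ⟨isUnit_iff_ne_zero.mpr ?_⟩
  have : WeierstrassCurve.Δ (curve e₁ e₂ e₃)
      = 16 * ((e₁ - e₂) * (e₁ - e₃) * (e₂ - e₃)) ^ 2 := by
    simp only [WeierstrassCurve.Δ, b₂, b₄, b₆, b₈, curve_a₁, curve_a₂, curve_a₃, curve_a₄,
      curve_a₆]
    ring
  rw [this]
  have h1 := sub_ne_zero.mpr h12
  have h2 := sub_ne_zero.mpr h13
  have h3 := sub_ne_zero.mpr h23
  positivity

lemma equation_iff_prod {e₁ e₂ e₃ x y : ℚ} :
    (curve e₁ e₂ e₃).Equation x y ↔ y ^ 2 = (x - e₁) * (x - e₂) * (x - e₃) := by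
  rw [WeierstrassCurve.Affine.equation_iff]
  simp only [curve_a₁, curve_a₂, curve_a₃, curve_a₄, curve_a₆]
  constructor <;> intro h <;> linear_combination h

variable {e₁ e₂ e₃ : ℚ}

/-- A point whose `x - eᵢ` are all squares is divisible by two. -/
lemma exists_add_self_of_squares (h12 : e₁ ≠ e₂) (h13 : e₁ ≠ e₃) (h23 : e₂ ≠ e₃)
    {x y t₁ t₂ t₃ : ℚ} (h : (curve e₁ e₂ e₃).Nonsingular x y) (h1 : x - e₁ = t₁ ^ 2)
    (h2 : x - e₂ = t₂ ^ 2) (h3 : x - e₃ = t₃ ^ 2) (hy : y = t₁ * t₂ * t₃) :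
    ∃ T : (curve e₁ e₂ e₃).Point, T + T = .some x y h := by
  have := isElliptic h12 h13 h23
  obtain rfl : e₁ = x - t₁ ^ 2 := by linarith
  obtain rfl : e₂ = x - t₂ ^ 2 := by linarith
  obtain rfl : e₃ = x - t₃ ^ 2 := by linarith
  have n12 : t₁ + t₂ ≠ 0 := fun h ↦ h12 (by linear_combination (t₂ - t₁) * h)
  have n13 : t₁ + t₃ ≠ 0 := fun h ↦ h13 (by linear_combination (t₃ - t₁) * h)
  have n23 : t₂ + t₃ ≠ 0 := fun h ↦ h23 (by linear_combination (t₃ - t₂) * h)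
  have hY := mul_ne_zero (mul_ne_zero n12 n13) n23
  have hT : (curve (x - t₁ ^ 2) (x - t₂ ^ 2) (x - t₃ ^ 2)).Nonsingular
      (x + (t₁ * t₂ + t₁ * t₃ + t₂ * t₃)) ((t₁ + t₂) * (t₁ + t₃) * (t₂ + t₃)) := by
    rw [← equation_iff_nonsingular, equation_iff_prod]
    ring
  have hne : (t₁ + t₂) * (t₁ + t₃) * (t₂ + t₃) ≠
      (curve (x - t₁ ^ 2) (x - t₂ ^ 2) (x - t₃ ^ 2)).negY
        (x + (t₁ * t₂ + t₁ * t₃ + t₂ * t₃)) ((t₁ + t₂) * (t₁ + t₃) * (t₂ + t₃)) := by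
    simp only [negY, curve_a₁, curve_a₃]
    intro h
    exact hY (by linarith)
  refine ⟨.some _ _ hT, ?_⟩
  rw [Point.add_self_of_Y_ne hne]
  have hs : (curve (x - t₁ ^ 2) (x - t₂ ^ 2) (x - t₃ ^ 2)).slope
      (x + (t₁ * t₂ + t₁ * t₃ + t₂ * t₃)) (x + (t₁ * t₂ + t₁ * t₃ + t₂ * t₃))
      ((t₁ + t₂) * (t₁ + t₃) * (t₂ + t₃)) ((t₁ + t₂) * (t₁ + t₃) * (t₂ + t₃))
      = t₁ + t₂ + t₃ := by
    rw [slope_of_Y_ne rfl hne, div_eq_iff (sub_ne_zero.mpr hne)]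
    simp only [negY, curve_a₁, curve_a₂, curve_a₃, curve_a₄]
    ring
  simp only [hs, Point.some.injEq, addX, addY, negAddY, negY, curve_a₁, curve_a₂, curve_a₃]
  subst hy
  constructor <;> ring

/-- The points of the curve which are not two-torsion and whose `x - eᵢ` have square class `dᵢ`. -/
def squareClass (e₁ e₂ e₃ : ℚ) (d : ℤ × ℤ × ℤ) : Set (curve e₁ e₂ e₃).Point :=
  {P | ∃ x y h, P = .some x y h ∧ y ≠ 0 ∧ (∃ r : ℚ, x - e₁ = d.1 * r ^ 2) ∧
    (∃ r : ℚ, x - e₂ = d.2.1 * r ^ 2) ∧ ∃ r : ℚ, x - e₃ = d.2.2 * r ^ 2}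

private lemma exists_root {x₁ x₂ x₃ l e d : ℚ} (hx1 : x₁ - e ≠ 0) (hx2 : x₂ - e ≠ 0)
    (h1 : ∃ r : ℚ, x₁ - e = d * r ^ 2) (h2 : ∃ r : ℚ, x₂ - e = d * r ^ 2)
    (h : (x₃ - e) * ((x₁ - e) * (x₂ - e)) = l ^ 2) : ∃ t : ℚ, x₃ - e = t ^ 2 := by
  obtain ⟨r, hr⟩ := h1
  obtain ⟨s, hs⟩ := h2
  have hz : d * r * s ≠ 0 := by
    intro h0
    have : (x₁ - e) * (x₂ - e) = (d * r * s) ^ 2 := by rw [hr, hs]; ring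
    rw [h0] at this
    exact mul_ne_zero hx1 hx2 (by simpa using this)
  refine ⟨l / (d * r * s), ?_⟩
  rw [div_pow, ← h, eq_div_iff (pow_ne_zero 2 hz), hr, hs]
  ring

private lemma exists_roots {d : ℤ × ℤ × ℤ} {x₁ y₁ x₂ y₂ ℓ : ℚ} (hy1 : y₁ ≠ 0) (hy2 : y₂ ≠ 0)
    (hx : x₁ ≠ x₂)
    (a1 : ∃ r : ℚ, x₁ - e₁ = d.1 * r ^ 2) (a2 : ∃ r : ℚ, x₁ - e₂ = d.2.1 * r ^ 2)
    (a3 : ∃ r : ℚ, x₁ - e₃ = d.2.2 * r ^ 2)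
    (b1 : ∃ r : ℚ, x₂ - e₁ = d.1 * r ^ 2) (b2 : ∃ r : ℚ, x₂ - e₂ = d.2.1 * r ^ 2)
    (b3 : ∃ r : ℚ, x₂ - e₃ = d.2.2 * r ^ 2)
    (hp : y₁ ^ 2 = (x₁ - e₁) * (x₁ - e₂) * (x₁ - e₃))
    (hq : y₂ ^ 2 = (x₂ - e₁) * (x₂ - e₂) * (x₂ - e₃)) (hl : ℓ * (x₁ - x₂) = y₁ - y₂) :
    ∃ t₁ t₂ t₃ : ℚ, ℓ ^ 2 + (e₁ + e₂ + e₃) - x₁ - x₂ - e₁ = t₁ ^ 2 ∧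
      ℓ ^ 2 + (e₁ + e₂ + e₃) - x₁ - x₂ - e₂ = t₂ ^ 2 ∧
      ℓ ^ 2 + (e₁ + e₂ + e₃) - x₁ - x₂ - e₃ = t₃ ^ 2 := by
  have hd : x₁ - x₂ ≠ 0 := sub_ne_zero.mpr hx
  obtain rfl : y₂ = y₁ - ℓ * (x₁ - x₂) := by linear_combination hl
  have key : 2 * y₁ * ℓ - ℓ ^ 2 * (x₁ - x₂) =
      (x₁ ^ 2 + x₁ * x₂ + x₂ ^ 2) - (e₁ + e₂ + e₃) * (x₁ + x₂)
        + (e₁ * e₂ + e₁ * e₃ + e₂ * e₃) := by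
    apply mul_right_cancel₀ hd
    linear_combination hp - hq
  have ne1 : (x₁ - e₁) * (x₁ - e₂) * (x₁ - e₃) ≠ 0 := by rw [← hp]; exact pow_ne_zero 2 hy1
  have ne2 : (x₂ - e₁) * (x₂ - e₂) * (x₂ - e₃) ≠ 0 := by rw [← hq]; exact pow_ne_zero 2 hy2
  obtain ⟨t₁, ht1⟩ := exists_root (x₃ := ℓ ^ 2 + (e₁ + e₂ + e₃) - x₁ - x₂)
    (l := y₁ + ℓ * (e₁ - x₁))
    (left_ne_zero_of_mul (left_ne_zero_of_mul ne1)) (left_ne_zero_of_mul (left_ne_zero_of_mul ne2))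
    a1 b1 (by linear_combination (x₁ - e₁) * key - hp)
  obtain ⟨t₂, ht2⟩ := exists_root (x₃ := ℓ ^ 2 + (e₁ + e₂ + e₃) - x₁ - x₂)
    (l := y₁ + ℓ * (e₂ - x₁))
    (right_ne_zero_of_mul (left_ne_zero_of_mul ne1))
    (right_ne_zero_of_mul (left_ne_zero_of_mul ne2))
    a2 b2 (by linear_combination (x₁ - e₂) * key - hp)
  obtain ⟨t₃, ht3⟩ := exists_root (x₃ := ℓ ^ 2 + (e₁ + e₂ + e₃) - x₁ - x₂)
    (l := y₁ + ℓ * (e₃ - x₁))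
    (right_ne_zero_of_mul ne1) (right_ne_zero_of_mul ne2)
    a3 b3 (by linear_combination (x₁ - e₃) * key - hp)
  exact ⟨t₁, t₂, t₃, ht1, ht2, ht3⟩

lemma exists_add_self_eq_sub (h12 : e₁ ≠ e₂) (h13 : e₁ ≠ e₃) (h23 : e₂ ≠ e₃) {d : ℤ × ℤ × ℤ}
    {P Q : (curve e₁ e₂ e₃).Point} (hP : P ∈ squareClass e₁ e₂ e₃ d)
    (hQ : Q ∈ squareClass e₁ e₂ e₃ d) : ∃ T, T + T = P - Q := by
  have := isElliptic h12 h13 h23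
  obtain ⟨x₁, y₁, p, rfl, hy1, a1, a2, a3⟩ := hP
  obtain ⟨x₂, y₂, q, rfl, hy2, b1, b2, b3⟩ := hQ
  by_cases hx : x₁ = x₂
  · rcases Point.eq_or_eq_neg_of_xRep_eq_xRep
      (P := Point.some x₁ y₁ p) (Q := .some x₂ y₂ q) (by simp [hx]) with h | h
    · exact ⟨0, by rw [h, sub_self, add_zero]⟩
    · exact ⟨.some x₁ y₁ p, by rw [sub_eq_add_neg, ← h]⟩
  suffices h : ∃ T, T + T = Point.some x₁ y₁ p + .some x₂ y₂ q by
    obtain ⟨T, hT⟩ := h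
    refine ⟨T - .some x₂ y₂ q, ?_⟩
    generalize Point.some x₂ y₂ q = Q at *
    rw [show T - Q + (T - Q) = T + T - Q - Q by abel, hT, add_sub_cancel_right]
  rw [Point.add_of_X_ne hx]
  have hn := nonsingular_add p q fun hxy ↦ hx hxy.left
  have hl : (curve e₁ e₂ e₃).slope x₁ x₂ y₁ y₂ * (x₁ - x₂) = y₁ - y₂ := by
    rw [slope_of_X_ne hx, div_mul_cancel₀ _ (sub_ne_zero.mpr hx)]
  obtain ⟨t₁, t₂, t₃, ht1, ht2, ht3⟩ := exists_roots hy1 hy2 hx a1 a2 a3 b1 b2 b3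
    (equation_iff_prod.mp p.1) (equation_iff_prod.mp q.1) hl
  have hx3 : (curve e₁ e₂ e₃).addX x₁ x₂ ((curve e₁ e₂ e₃).slope x₁ x₂ y₁ y₂) =
      (curve e₁ e₂ e₃).slope x₁ x₂ y₁ y₂ ^ 2 + (e₁ + e₂ + e₃) - x₁ - x₂ := by
    simp only [addX, curve_a₁, curve_a₂]
    ring
  rw [← hx3] at ht1 ht2 ht3
  have hsq := equation_iff_prod.mp hn.1
  rw [ht1, ht2, ht3, ← mul_pow, ← mul_pow] at hsq
  rcases sq_eq_sq_iff_eq_or_eq_neg.mp hsq with h | h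
  · exact exists_add_self_of_squares h12 h13 h23 hn ht1 ht2 ht3 h
  · exact exists_add_self_of_squares h12 h13 h23 hn (t₁ := -t₁) (t₂ := -t₂) (t₃ := -t₃)
      (ht1.trans (neg_sq _).symm) (ht2.trans (neg_sq _).symm) (ht3.trans (neg_sq _).symm)
      (h.trans (by ring))

end SplitCurve

namespace SplitCurve

open WeierstrassCurve WeierstrassCurve.Affine

private lemma exists_squarefree_mul_sq {a : ℤ} (ha : a ≠ 0) :
    ∃ d r : ℤ, Squarefree d ∧ r ≠ 0 ∧ a = d * r ^ 2 := by
  obtain ⟨b, c, h, hb⟩ := Nat.sq_mul_squarefree a.natAbs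
  have hc : c ≠ 0 := by
    rintro rfl
    simp at h
    exact ha (Int.natAbs_eq_zero.mp h.symm)
  refine ⟨a.sign * b, c, ?_, by exact_mod_cast hc, ?_⟩
  · rw [← Int.squarefree_natAbs, Int.natAbs_mul, Int.natAbs_sign_of_ne_zero ha, one_mul,
      Int.natAbs_natCast]
    exact hb
  · conv_lhs => rw [← Int.sign_mul_natAbs a, ← h]
    push_cast
    ring

private lemma dvd_of_squarefree_mul_sq {d r N z : ℤ} (hd : Squarefree d) (hr : r ≠ 0)
    (h : z ^ 2 = d * r ^ 2 * N) : d ∣ N := by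
  have h1 : r ∣ z := by
    rw [← Int.pow_dvd_pow_iff two_ne_zero, h]
    exact ⟨d * N, by ring⟩
  obtain ⟨w, rfl⟩ := h1
  have h2 : w ^ 2 = d * N := by
    apply mul_left_cancel₀ (pow_ne_zero 2 hr)
    linear_combination h
  obtain ⟨v, rfl⟩ := (hd.dvd_pow_iff_dvd two_ne_zero).mp (Dvd.intro _ h2.symm)
  have h3 : N = d * v ^ 2 := by
    apply mul_left_cancel₀ hd.ne_zero
    linear_combination -h2
  exact ⟨_, h3⟩

/-- The square class of `x - e` divides the product of the differences of the roots. -/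
lemma exists_dvd_sub_eq_mul_sq {e f g : ℤ} {x y : ℚ}
    (h : y ^ 2 = (x - e) * (x - f) * (x - g)) (hy : y ≠ 0) :
    ∃ d : ℤ, d ∣ (e - f) * (e - g) ∧ ∃ r : ℚ, x - e = d * r ^ 2 := by
  obtain ⟨n, hn⟩ : ∃ n : ℤ, n = x.num := ⟨_, rfl⟩
  obtain ⟨m, hm⟩ : ∃ m : ℤ, m = x.den := ⟨_, rfl⟩
  have hm0 : m ≠ 0 := by simp [hm]
  have hmq : (m : ℚ) ≠ 0 := by exact_mod_cast hm0
  have hx : x = n / m := by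
    rw [hn, hm]
    exact_mod_cast (Rat.num_div_den x).symm
  have hcop : IsCoprime n m := by
    rw [hn, hm]
    exact Rat.isCoprime_num_den x
  clear hn hm
  subst hx
  set A := n - e * m with hA
  have hsq : ((y * m ^ 2) : ℚ) ^ 2 = ((A * m * ((n - f * m) * (n - g * m)) : ℤ) : ℚ) := by
    rw [mul_pow, h]
    push_cast [hA]
    field_simp
  have hA0 : A * m ≠ 0 := by
    refine mul_ne_zero (fun h0 ↦ ?_) hm0
    rw [h0] at hsq
    simp [hmq, hy] at hsq
  have hz : ∃ z : ℤ, z ^ 2 = A * m * ((n - f * m) * (n - g * m)) := by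
    have : IsSquare ((A * m * ((n - f * m) * (n - g * m)) : ℤ) : ℚ) := ⟨y * m ^ 2, by rw [← hsq, sq]⟩
    rw [Rat.isSquare_intCast_iff] at this
    obtain ⟨z, hz⟩ := this
    exact ⟨z, by rw [sq, hz]⟩
  obtain ⟨z, hz⟩ := hz
  obtain ⟨d, r, hd, hr, hdr⟩ := exists_squarefree_mul_sq hA0
  rw [hdr] at hz
  have hBC := dvd_of_squarefree_mul_sq hd hr hz
  have hcopd : IsCoprime d m := by
    have h1 : IsCoprime ((n - f * m) * (n - g * m)) m := by
      refine IsCoprime.mul_left ?_ ?_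
      · simpa [sub_eq_add_neg] using hcop.add_mul_right_left (-f)
      · simpa [sub_eq_add_neg] using hcop.add_mul_right_left (-g)
    exact h1.of_isCoprime_of_dvd_left hBC
  have hdA : d ∣ A := hcopd.dvd_of_dvd_mul_right (hdr ▸ Dvd.intro _ rfl)
  refine ⟨d, ?_, r / m, ?_⟩
  · have : d ∣ ((e - f) * (e - g)) * m ^ 2 := by
      have e1 : ((e - f) * (e - g)) * m ^ 2 = (n - f * m) * (n - g * m)
          - A * (2 * n - f * m - g * m - A) := by rw [hA]; ring
      rw [e1]
      exact dvd_sub hBC (hdA.mul_right _)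
    exact (hcopd.pow_right).dvd_of_dvd_mul_right this
  · have : (A * m : ℚ) = d * r ^ 2 := by exact_mod_cast hdr
    rw [div_pow, mul_div, ← this, hA]
    push_cast
    field_simp

variable {e₁ e₂ e₃ : ℤ}

theorem finiteIndex_two (h12 : e₁ ≠ e₂) (h13 : e₁ ≠ e₃) (h23 : e₂ ≠ e₃) :
    (nsmulAddMonoidHom (α := (curve e₁ e₂ e₃).Point) 2).range.FiniteIndex := by
  have q12 : (e₁ : ℚ) ≠ e₂ := by exact_mod_cast h12
  have q13 : (e₁ : ℚ) ≠ e₃ := by exact_mod_cast h13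
  have q23 : (e₂ : ℚ) ≠ e₃ := by exact_mod_cast h23
  have := isElliptic q12 q13 q23
  set H := (nsmulAddMonoidHom (α := (curve e₁ e₂ e₃).Point) 2).range with hH
  have n1 := mul_ne_zero (sub_ne_zero.mpr h12) (sub_ne_zero.mpr h13)
  have n2 := mul_ne_zero (sub_ne_zero.mpr h12.symm) (sub_ne_zero.mpr h23)
  have n3 := mul_ne_zero (sub_ne_zero.mpr h13.symm) (sub_ne_zero.mpr h23.symm)
  have hdiv (N : ℤ) (hN : N ≠ 0) : {d : ℤ | d ∣ N}.Finite :=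
    (Set.finite_Icc (-|N|) |N|).subset fun d hd ↦ by
      have := Int.le_of_dvd (abs_pos.mpr hN) ((abs_dvd_abs d N).mpr hd)
      exact Set.mem_Icc.mpr (abs_le.mp this)
  set S : Set (ℤ × ℤ × ℤ) := {d | d ∣ (e₁ - e₂) * (e₁ - e₃)} ×ˢ
    ({d | d ∣ (e₂ - e₁) * (e₂ - e₃)} ×ˢ {d | d ∣ (e₃ - e₁) * (e₃ - e₂)}) with hS
  have hSf : S.Finite := (hdiv _ n1).prod ((hdiv _ n2).prod (hdiv _ n3))
  set X : Set (curve e₁ e₂ e₃).Point := {P | P = 0 ∨ ∃ x h, P = .some x 0 h} with hX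
  have hXf : X.Finite := by
    have hf : ((fun x : ℚ ↦ ![x, 1]) '' {(e₁ : ℚ), (e₂ : ℚ), (e₃ : ℚ)} ∪ {![1, 0]}).Finite :=
      ((Set.toFinite _).image _).union (Set.finite_singleton _)
    refine (hf.preimage' (f := Point.xRep (W' := curve e₁ e₂ e₃)) fun v _ ↦ ?_).subset ?_
    · by_cases hv : ∃ P : (curve e₁ e₂ e₃).Point, P.xRep = v
      · obtain ⟨P, rfl⟩ := hv
        refine (Set.toFinite {P, -P}).subset fun Q hQ ↦ ?_
        exact Point.eq_or_eq_neg_of_xRep_eq_xRep hQ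
      · exact Set.finite_empty.subset fun P hP ↦ hv ⟨P, hP⟩
    · rintro P (rfl | ⟨x, h, rfl⟩)
      · right; rfl
      · left
        refine ⟨x, ?_, rfl⟩
        have := equation_iff_prod.mp h.1
        simp only [ne_eq, OfNat.ofNat_ne_zero, not_false_eq_true, zero_pow, zero_eq_mul,
          mul_eq_zero, sub_eq_zero] at this
        simp only [Set.mem_insert_iff, Set.mem_singleton_iff]
        tauto
  have hcover : ∀ P, P ∈ X ∨ ∃ d ∈ S, P ∈ squareClass e₁ e₂ e₃ d := by
    rintro (_ | ⟨x, y, h⟩)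
    · left; left; rfl
    by_cases hy : y = 0
    · subst hy
      exact .inl (.inr ⟨x, h, rfl⟩)
    right
    have eq := equation_iff_prod.mp h.1
    obtain ⟨d₁, hd1, r1⟩ := exists_dvd_sub_eq_mul_sq (e := e₁) (f := e₂) (g := e₃) eq hy
    obtain ⟨d₂, hd2, r2⟩ := exists_dvd_sub_eq_mul_sq (e := e₂) (f := e₁) (g := e₃)
      (eq.trans (by ring)) hy
    obtain ⟨d₃, hd3, r3⟩ := exists_dvd_sub_eq_mul_sq (e := e₃) (f := e₁) (g := e₂)
      (eq.trans (by ring)) hy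
    exact ⟨(d₁, d₂, d₃), ⟨hd1, hd2, hd3⟩, x, y, h, rfl, hy, r1, r2, r3⟩
  let q : (curve e₁ e₂ e₃).Point → (curve e₁ e₂ e₃).Point ⧸ H := QuotientAddGroup.mk
  have hfin : (Set.univ : Set ((curve e₁ e₂ e₃).Point ⧸ H)).Finite := by
    refine ((hXf.image q).union
      (hSf.biUnion (t := fun d ↦ q '' squareClass e₁ e₂ e₃ d) fun d _ ↦ ?_)).subset ?_
    · refine Set.Subsingleton.finite ?_
      rintro _ ⟨P, hP, rfl⟩ _ ⟨Q, hQ, rfl⟩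
      obtain ⟨T, hT⟩ := exists_add_self_eq_sub q12 q13 q23 hQ hP
      refine QuotientAddGroup.eq.mpr ⟨T, ?_⟩
      rw [neg_add_eq_sub, ← hT]
      exact two_nsmul T
    · rintro z -
      obtain ⟨P, rfl⟩ := QuotientAddGroup.mk_surjective z
      rcases hcover P with h | ⟨d, hd, h⟩
      · exact .inl ⟨P, h, rfl⟩
      · exact .inr (Set.mem_biUnion hd ⟨P, h, rfl⟩)
  have : Finite ((curve e₁ e₂ e₃).Point ⧸ H) := Set.finite_univ_iff.mp hfin
  exact AddSubgroup.finiteIndex_of_finite_quotient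

/-- The Mordell–Weil theorem over `ℚ` for curves with rational two-torsion. -/
theorem fg_point (h12 : e₁ ≠ e₂) (h13 : e₁ ≠ e₃) (h23 : e₂ ≠ e₃) :
    AddGroup.FG (curve e₁ e₂ e₃).Point := by
  have := isElliptic (e₁ := e₁) (e₂ := e₂) (e₃ := e₃) (by exact_mod_cast h12)
    (by exact_mod_cast h13) (by exact_mod_cast h23)
  obtain ⟨C, hC⟩ := ShortCurve.exists_parallelogram (W := curve e₁ e₂ e₃) rfl rfl
  exact AddCommGroup.fg_of_descent' (finiteIndex_two h12 h13 h23) ShortCurve.naiveHeight_nonneg hC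

end SplitCurve

namespace ApproxQuadratic

open Filter Topology Matrix

variable {G : Type*} [AddCommGroup G]

/-- Tate's limit: a function satisfying the parallelogram law up to a constant is at bounded
distance from one satisfying it exactly. -/
theorem exists_exact {h : G → ℝ} {C : ℝ} (h0 : ∀ x, 0 ≤ h x)
    (hC : ∀ x y, |h (x + y) + h (x - y) - 2 * (h x + h y)| ≤ C) :
    ∃ (q : G → ℝ) (C' : ℝ), (∀ x, 0 ≤ q x) ∧ (∀ x, |h x - q x| ≤ C') ∧
      ∀ x y, q (x + y) + q (x - y) = 2 * (q x + q y) := by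
  set K := C + h 0 with hK
  have hdbl (x : G) : |h (2 • x) - 4 * h x| ≤ K := by
    have := hC x x
    rw [sub_self, ← two_nsmul, abs_le] at this
    have := h0 0
    rw [abs_le]
    constructor <;> linarith
  have hstep (x : G) (n : ℕ) :
      dist (h (2 ^ n • x) / 4 ^ n) (h (2 ^ (n + 1) • x) / 4 ^ (n + 1)) ≤ K / 4 * (1 / 4) ^ n := by
    have e : h (2 ^ n • x) / 4 ^ n - h (2 ^ (n + 1) • x) / 4 ^ (n + 1)
        = -((h (2 • (2 ^ n • x)) - 4 * h (2 ^ n • x)) * (1 / 4 * (1 / 4) ^ n)) := by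
      rw [← mul_smul, ← pow_succ', pow_succ (4 : ℝ), _root_.one_div_pow]
      field_simp
      ring
    rw [Real.dist_eq, e, abs_neg, abs_mul, abs_of_nonneg (a := 1 / 4 * (1 / 4 : ℝ) ^ n)
      (by positivity)]
    calc _ ≤ K * (1 / 4 * (1 / 4 : ℝ) ^ n) :=
          mul_le_mul_of_nonneg_right (hdbl _) (by positivity)
      _ = _ := by ring
  have hlim (x : G) : ∃ l, Tendsto (fun n : ℕ ↦ h (2 ^ n • x) / 4 ^ n) atTop (𝓝 l) :=
    cauchySeq_tendsto_of_complete (cauchySeq_of_le_geometric _ _ (by norm_num) (hstep x))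
  choose q hq using hlim
  refine ⟨q, K / 4 / (1 - 1 / 4), fun x ↦ ?_, fun x ↦ ?_, fun x y ↦ ?_⟩
  · exact ge_of_tendsto' (hq x) fun n ↦ div_nonneg (h0 _) (by positivity)
  · have := dist_le_of_le_geometric_of_tendsto₀ _ _ (by norm_num) (hstep x) (hq x)
    simpa [Real.dist_eq] using this
  · have hl := ((hq (x + y)).add (hq (x - y))).sub (((hq x).add (hq y)).const_mul 2)
    have hz : Tendsto (fun n : ℕ ↦ C * (1 / 4 : ℝ) ^ n) atTop (𝓝 0) := by
      simpa using (tendsto_pow_atTop_nhds_zero_of_lt_one (r := (1 / 4 : ℝ)) (by norm_num)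
        (by norm_num)).const_mul C
    refine sub_eq_zero.mp (tendsto_nhds_unique hl (squeeze_zero_norm (fun n : ℕ ↦ ?_) hz))
    have e : h (2 ^ n • (x + y)) / 4 ^ n + h (2 ^ n • (x - y)) / 4 ^ n
        - 2 * (h (2 ^ n • x) / 4 ^ n + h (2 ^ n • y) / 4 ^ n)
        = (h (2 ^ n • x + 2 ^ n • y) + h (2 ^ n • x - 2 ^ n • y)
          - 2 * (h (2 ^ n • x) + h (2 ^ n • y))) * (1 / 4) ^ n := by
      rw [smul_add, smul_sub, _root_.one_div_pow]
      ring
    rw [e, Real.norm_eq_abs, abs_mul, abs_of_nonneg (a := (1 / 4 : ℝ) ^ n) (by positivity)]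
    exact mul_le_mul_of_nonneg_right (hC _ _) (by positivity)

/-- The polarization of a function satisfying the parallelogram law. -/
theorem exists_polarization {q : G → ℝ}
    (hq : ∀ x y, q (x + y) + q (x - y) = 2 * (q x + q y)) :
    ∃ L : G →+ G →+ ℝ, (∀ x y, L x y = L y x) ∧ ∀ x, L x x = q x := by
  have z : q 0 = 0 := by
    have := hq 0 0
    simp only [add_zero, sub_zero] at this
    linarith
  have three (x y w : G) : q (x + y + w) = q (x + y) + q (y + w) + q (x + w) - q x - q y - q w := by
    have h1 := hq (x + w) y
    have h2 := hq (y + w) x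
    have h3 := hq w (x - y)
    have h4 := hq x y
    rw [show x + w + y = x + y + w by abel] at h1
    rw [show y + w + x = x + y + w by abel] at h2
    rw [show w + (x - y) = x + w - y by abel, show w - (x - y) = y + w - x by abel] at h3
    linarith
  have sym (x y : G) : (q (x + y) - q x - q y) / 2 = (q (y + x) - q y - q x) / 2 := by
    rw [add_comm]; ring
  have hadd (x y w : G) : (q (x + (y + w)) - q x - q (y + w)) / 2 =
      (q (x + y) - q x - q y) / 2 + (q (x + w) - q x - q w) / 2 := by
    rw [← add_assoc, three]; ring
  refine ⟨AddMonoidHom.mk' (fun x ↦ AddMonoidHom.mk' (fun y ↦ (q (x + y) - q x - q y) / 2)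
    (hadd x)) fun x y ↦ ?_, sym, fun x ↦ ?_⟩
  · ext w
    simp only [AddMonoidHom.mk'_apply, AddMonoidHom.add_apply]
    rw [sym, hadd, sym w x, sym w y]
  · have := hq x x
    simp only [AddMonoidHom.mk'_apply]
    rw [sub_self, z] at this
    linarith

private lemma nonneg_of_int {r : ℕ} {A : Matrix (Fin r) (Fin r) ℝ}
    (h : ∀ v : Fin r → ℤ, 0 ≤ (fun i ↦ (v i : ℝ)) ⬝ᵥ (A *ᵥ fun i ↦ (v i : ℝ)))
    (x : Fin r → ℝ) : 0 ≤ x ⬝ᵥ (A *ᵥ x) := by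
  have hx : Tendsto (fun (n : ℕ) i ↦ (⌊(n : ℝ) * x i⌋ : ℝ) / n) atTop (𝓝 x) := by
    rw [tendsto_pi_nhds]
    intro i
    have h1 : Tendsto (fun n : ℕ ↦ x i - 1 / (n : ℝ)) atTop (𝓝 (x i)) := by
      simpa using (tendsto_const_div_atTop_nhds_zero_nat (1 : ℝ)).const_sub (x i)
    refine tendsto_of_tendsto_of_tendsto_of_le_of_le' h1 tendsto_const_nhds ?_ ?_
    · filter_upwards [eventually_gt_atTop 0] with n hn
      have hn' : (0 : ℝ) < n := by exact_mod_cast hn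
      rw [le_div_iff₀ hn', sub_mul, one_div_mul_cancel hn'.ne', mul_comm]
      exact (Int.sub_one_lt_floor _).le
    · filter_upwards [eventually_gt_atTop 0] with n hn
      have hn' : (0 : ℝ) < n := by exact_mod_cast hn
      rw [div_le_iff₀ hn', mul_comm]
      exact Int.floor_le _
  have hc : Continuous fun y : Fin r → ℝ ↦ y ⬝ᵥ (A *ᵥ y) := by fun_prop
  refine ge_of_tendsto' ((hc.tendsto x).comp hx) fun n ↦ ?_
  have e : (fun i ↦ (⌊(n : ℝ) * x i⌋ : ℝ) / n) = (n : ℝ)⁻¹ • fun i ↦ (⌊(n : ℝ) * x i⌋ : ℝ) := by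
    ext i
    simp [div_eq_inv_mul]
  simp only [Function.comp_apply, e, mulVec_smul, dotProduct_smul, smul_dotProduct, smul_eq_mul]
  have := h fun i ↦ ⌊(n : ℝ) * x i⌋
  positivity

/-- On a finitely generated group, an approximately quadratic function is up to a constant
the square of a Euclidean norm. -/
theorem exists_euclidean [AddGroup.FG G] {h : G → ℝ} {C : ℝ} (h0 : ∀ x, 0 ≤ h x)
    (hC : ∀ x y, |h (x + y) + h (x - y) - 2 * (h x + h y)| ≤ C) :
    ∃ (r : ℕ) (w : G → EuclideanSpace ℝ (Fin r)) (C' : ℝ),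
      (∀ x, |h x - ‖w x‖ ^ 2| ≤ C') ∧ ∀ x y, |h (x + y) - ‖w x + w y‖ ^ 2| ≤ C' := by
  obtain ⟨q, C', q0, hqC, hq⟩ := exists_exact h0 hC
  obtain ⟨L, Lsym, Lq⟩ := exists_polarization hq
  have : Module.Finite ℤ G := Module.Finite.iff_addGroup_fg.mpr inferInstance
  obtain ⟨r, f, hf⟩ := Module.Finite.exists_fin' ℤ G
  let g : Fin r → G := fun i ↦ f fun j ↦ if i = j then 1 else 0
  let A : Matrix (Fin r) (Fin r) ℝ := .of fun i j ↦ L (g i) (g j)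
  have hA (v : Fin r → ℤ) : q (f v) = (fun i ↦ (v i : ℝ)) ⬝ᵥ (A *ᵥ fun i ↦ (v i : ℝ)) := by
    rw [← Lq, f.pi_apply_eq_sum_univ v]
    simp only [map_sum, map_zsmul, AddMonoidHom.finsetSum_apply, AddMonoidHom.smul_apply,
      dotProduct, mulVec, A, g, of_apply, Finset.mul_sum, zsmul_eq_mul]
    refine Finset.sum_congr rfl fun i _ ↦ Finset.sum_congr rfl fun j _ ↦ ?_
    ring_nf
    rw [Lsym]
  have hpos : A.PosSemidef := by
    refine .of_dotProduct_mulVec_nonneg ?_ fun x ↦ ?_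
    · ext i j
      simp [A, Lsym (g j) (g i)]
    · simpa using nonneg_of_int (fun v ↦ (hA v) ▸ q0 _) x
  open scoped MatrixOrder in
  obtain ⟨M, hM⟩ := CStarAlgebra.nonneg_iff_eq_star_mul_self.mp hpos.nonneg
  have hnorm (v : Fin r → ℝ) : ‖WithLp.toLp 2 (M *ᵥ v)‖ ^ 2 = v ⬝ᵥ (A *ᵥ v) := by
    rw [hM, ← mulVec_mulVec, star_eq_conjTranspose, EuclideanSpace.norm_sq_eq, dotProduct_mulVec,
      conjTranspose_eq_transpose_of_trivial, vecMul_transpose, dotProduct]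
    simp [sq]
  choose n hn using hf
  refine ⟨r, fun x ↦ WithLp.toLp 2 (M *ᵥ fun i ↦ (n x i : ℝ)), C', fun x ↦ ?_, fun x y ↦ ?_⟩
  · rw [hnorm, ← hA, hn]
    exact hqC x
  · rw [← WithLp.toLp_add, ← mulVec_add, hnorm]
    have := hA (n x + n y)
    simp only [map_add, hn, Pi.add_apply, Int.cast_add] at this
    rw [show ((fun i ↦ (n x i : ℝ)) + fun i ↦ (n y i : ℝ)) = fun i ↦ (n x i : ℝ) + n y i from rfl,
      ← this]
    exact hqC (x + y)

end ApproxQuadratic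

section Directions

variable {E : Type*} [NormedAddCommGroup E] [InnerProductSpace ℝ E]

private lemma norm_mul_norm_le_inner {a b : E} {δ : ℝ}
    (h : dist (‖a‖⁻¹ • a) (‖b‖⁻¹ • b) ≤ δ) :
    (1 - δ ^ 2 / 2) * (‖a‖ * ‖b‖) ≤ inner ℝ a b := by
  rcases eq_or_ne a 0 with rfl | ha
  · simp
  rcases eq_or_ne b 0 with rfl | hb
  · simp
  have ha' := norm_pos_iff.mpr ha
  have hb' := norm_pos_iff.mpr hb
  have h1 : ‖‖a‖⁻¹ • a - ‖b‖⁻¹ • b‖ ^ 2 ≤ δ ^ 2 := by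
    rw [← dist_eq_norm]
    exact pow_le_pow_left₀ dist_nonneg h 2
  rw [norm_sub_sq_real, norm_smul, norm_smul, inner_smul_left, inner_smul_right, norm_inv,
    norm_inv, norm_norm, norm_norm, inv_mul_cancel₀ ha'.ne', inv_mul_cancel₀ hb'.ne'] at h1
  have h2 : ‖a‖⁻¹ * (‖b‖⁻¹ * inner ℝ a b) * (‖a‖ * ‖b‖) = inner ℝ a b := by
    field_simp
  have h3 : 1 - δ ^ 2 / 2 ≤ ‖a‖⁻¹ * (‖b‖⁻¹ * inner ℝ a b) := by
    simp only [RCLike.conj_to_real] at h1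
    linarith
  rw [← h2]
  exact mul_le_mul_of_nonneg_right h3 (by positivity)

private lemma norm_add_sq_ge {a b : E} {s t C : ℝ} (hC : 0 ≤ C) (hs : 1000 * C ≤ s)
    (ht : 1000 * C ≤ t) (ha : |2 * s - ‖a‖ ^ 2| ≤ C) (hb : |2 * t - ‖b‖ ^ 2| ≤ C)
    (h : dist (‖a‖⁻¹ • a) (‖b‖⁻¹ • b) ≤ 0.08) :
    2 * s + 2 * t + 3.96 * √(s * t) - 2 * C ≤ ‖a + b‖ ^ 2 := by
  have hi := norm_mul_norm_le_inner h
  rw [abs_le] at ha hb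
  have hs0 : 0 ≤ s := by linarith
  have ht0 : 0 ≤ t := by linarith
  have h1 : 1.998 * √(s * t) ≤ ‖a‖ * ‖b‖ := by
    refine abs_le_of_sq_le_sq' ?_ (by positivity) |>.2
    rw [mul_pow, mul_pow, Real.sq_sqrt (by positivity)]
    calc (1.998 : ℝ) ^ 2 * (s * t) = (1.998 * s) * (1.998 * t) := by ring
      _ ≤ ‖a‖ ^ 2 * ‖b‖ ^ 2 := by
        apply mul_le_mul _ _ (by positivity) (by positivity) <;> linarith
  have h2 := Real.sqrt_nonneg (s * t)
  rw [norm_add_sq_real]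
  norm_num at hi h1 ⊢
  linarith

end Directions

/-- Among infinitely many points, two of very different and large heights have nearly parallel
images in two Euclidean spaces. -/
theorem exists_nearly_parallel {α E F : Type*} [NormedAddCommGroup E] [InnerProductSpace ℝ E]
    [FiniteDimensional ℝ E] [NormedAddCommGroup F] [InnerProductSpace ℝ F] [FiniteDimensional ℝ F]
    [Infinite α] {h : α → ℝ} (hfin : ∀ B, {s | h s ≤ B}.Finite)
    {v : α → E} {w : α → F} {C : ℝ} (hC : 0 ≤ C) (hv : ∀ s, |2 * h s - ‖v s‖ ^ 2| ≤ C)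
    (hw : ∀ s, |2 * h s - ‖w s‖ ^ 2| ≤ C) (B : ℝ) :
    ∃ s t, B ≤ h s ∧ 1600 * h s ≤ h t ∧
      2 * h s + 2 * h t + 3.96 * √(h s * h t) - 2 * C ≤ ‖v s + v t‖ ^ 2 ∧
      2 * h s + 2 * h t + 3.96 * √(h s * h t) - 2 * C ≤ ‖w s + w t‖ ^ 2 := by
  let d : α → E × F := fun s ↦ (‖v s‖⁻¹ • v s, ‖w s‖⁻¹ • w s)
  have hd (s : α) : d s ∈ Metric.closedBall (0 : E × F) 1 := by
    rw [mem_closedBall_zero_iff, Prod.norm_def]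
    simp only [d, norm_smul, norm_inv, norm_norm, sup_le_iff]
    exact ⟨inv_mul_le_one, inv_mul_le_one⟩
  have : ProperSpace (E × F) := FiniteDimensional.proper ℝ _
  obtain ⟨T, hT, hcov⟩ := Metric.totallyBounded_iff.mp
    (isCompact_closedBall (0 : E × F) 1).totallyBounded 0.04 (by norm_num)
  obtain ⟨z, hz⟩ : ∃ z, {s | dist (d s) z < 0.04}.Infinite := by
    by_contra! hc
    refine Set.infinite_univ ((hT.biUnion fun z _ ↦ hc z).subset fun s _ ↦ ?_)
    obtain ⟨z, hz, hsz⟩ := Set.mem_iUnion₂.mp (hcov (hd s))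
    exact Set.mem_biUnion hz hsz
  have pick (B : ℝ) : ∃ s, dist (d s) z < 0.04 ∧ B < h s := by
    obtain ⟨s, hs, hsB⟩ := (hz.sdiff (hfin B)).nonempty
    exact ⟨s, hs, lt_of_not_ge hsB⟩
  obtain ⟨s, hsz, hsB⟩ := pick (max B (1000 * C))
  obtain ⟨t, htz, htB⟩ := pick (max (1600 * h s) (1000 * C))
  rw [max_lt_iff] at hsB htB
  have hdist : dist (d s) (d t) ≤ 0.08 := by
    have := dist_triangle_right (d s) (d t) z
    norm_num at this hsz htz ⊢
    linarith
  rw [Prod.dist_eq, max_le_iff] at hdist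
  exact ⟨s, t, hsB.1.le, htB.1.le, norm_add_sq_ge hC hsB.2.le htB.2.le (hv s) (hv t) hdist.1,
    norm_add_sq_ge hC hsB.2.le htB.2.le (hw s) (hw t) hdist.2⟩

namespace SplitCurve

open WeierstrassCurve WeierstrassCurve.Affine ShortCurve

/-- A family of points on a cubic with rational two-torsion, whose heights are `2 * h` up to a
constant, maps to a Euclidean space compatibly with the height of the `x`-coordinate of sums. -/
theorem exists_euclidean_family {e₁ e₂ e₃ : ℤ} (h12 : e₁ ≠ e₂) (h13 : e₁ ≠ e₃) (h23 : e₂ ≠ e₃)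
    {α : Type*} {h : α → ℝ} {x y : α → ℚ} {B : ℝ}
    (heq : ∀ s, y s ^ 2 = (x s - e₁) * (x s - e₂) * (x s - e₃))
    (hh : ∀ s, |Real.log (ratHeight (x s)) - 2 * h s| ≤ B) :
    ∃ (r : ℕ) (w : α → EuclideanSpace ℝ (Fin r)) (C : ℝ), (∀ s, |2 * h s - ‖w s‖ ^ 2| ≤ C) ∧
      ∀ s t, x s ≠ x t → ‖w s + w t‖ ^ 2 - C ≤
        Real.log (ratHeight (((y s - y t) / (x s - x t)) ^ 2 + (e₁ + e₂ + e₃) - x s - x t)) := by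
  have h12' : (e₁ : ℚ) ≠ e₂ := mod_cast h12
  have h13' : (e₁ : ℚ) ≠ e₃ := mod_cast h13
  have h23' : (e₂ : ℚ) ≠ e₃ := mod_cast h23
  have := isElliptic h12' h13' h23'
  have := fg_point h12 h13 h23
  obtain ⟨C₀, hC₀⟩ := exists_parallelogram (W := curve e₁ e₂ e₃) rfl rfl
  obtain ⟨r, w, C, hw, hadd⟩ := ApproxQuadratic.exists_euclidean naiveHeight_nonneg hC₀
  have ns (s : α) : (curve e₁ e₂ e₃).Nonsingular (x s) (y s) :=
    equation_iff_nonsingular.mp (equation_iff_prod.mpr (heq s))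
  refine ⟨r, fun s ↦ w (.some _ _ (ns s)), B + C, fun s ↦ ?_, fun s t hst ↦ ?_⟩
  · have h1 := hw (.some _ _ (ns s))
    have h2 := hh s
    rw [naiveHeight_some] at h1
    rw [abs_le] at h1 h2 ⊢
    constructor <;> linarith
  · have h1 := hadd (.some _ _ (ns s)) (.some _ _ (ns t))
    have h2 := (abs_nonneg _).trans (hh s)
    rw [Point.add_of_X_ne hst, naiveHeight_some, slope_of_X_ne hst] at h1
    simp only [addX, curve_a₁, curve_a₂] at h1
    rw [show ((y s - y t) / (x s - x t)) ^ 2 + 0 * ((y s - y t) / (x s - x t))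
      - -((e₁ : ℚ) + e₂ + e₃) - x s - x t
      = ((y s - y t) / (x s - x t)) ^ 2 + (e₁ + e₂ + e₃) - x s - x t by ring] at h1
    rw [abs_le] at h1
    linarith

end SplitCurve

section Heights

open Height

lemma abs_log_ratHeight_mul_sub_le {c : ℚ} (hc : c ≠ 0) (x : ℚ) :
    |Real.log (ratHeight (c * x)) - Real.log (ratHeight x)| ≤ Real.log (ratHeight c) := by
  have e (q : ℚ) : Real.log (ratHeight q) = logHeight₁ q := (Rat.logHeight₁_eq_log_max q).symm
  simp only [e]
  have h1 := logHeight₁_mul_le c x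
  have h2 := logHeight₁_mul_le c⁻¹ (c * x)
  rw [inv_mul_cancel_left₀ hc, logHeight₁_inv] at h2
  rw [abs_le]
  constructor <;> linarith

lemma log_ratHeight_sq (x : ℚ) :
    Real.log (ratHeight (x ^ 2)) = 2 * Real.log (ratHeight x) := by
  have e (q : ℚ) : Real.log (ratHeight q) = logHeight₁ q := (Rat.logHeight₁_eq_log_max q).symm
  simp only [e]
  rw [logHeight₁_pow]
  norm_num

lemma log_ratHeight_inv (x : ℚ) :
    Real.log (ratHeight x⁻¹) = Real.log (ratHeight x) := by
  have e (q : ℚ) : Real.log (ratHeight q) = logHeight₁ q := (Rat.logHeight₁_eq_log_max q).symm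
  simp only [e]
  exact logHeight₁_inv x

lemma finite_log_ratHeight_le (B : ℝ) : {x : ℚ | Real.log (ratHeight x) ≤ B}.Finite := by
  have e (q : ℚ) : Real.log (ratHeight q) = logHeight₁ q := (Rat.logHeight₁_eq_log_max q).symm
  simp only [e]
  exact NumberField.finite_setOfPred_logHeight₁_le (K := ℚ) B

end Heights

private lemma aeval_evenSextic_rat (c₀ c₁ c₂ c₃ : ℤ) (x : ℚ) :
    aeval x (evenSextic c₀ c₁ c₂ c₃) = c₀ + c₁ * x ^ 2 + c₂ * x ^ 4 + c₃ * x ^ 6 := by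
  simp only [evenSextic, map_add, map_mul, map_pow, aeval_X, map_intCast]
  ring

private lemma eq_xiOne {c₀ c₁ c₂ c₃ : ℤ} (h3 : c₃ ≠ 0) {u v Y Z : ℚ} (huv : u ^ 2 ≠ v ^ 2)
    (hu : Y ^ 2 = aeval u (evenSextic c₀ c₁ c₂ c₃))
    (hv : Z ^ 2 = aeval v (evenSextic c₀ c₁ c₂ c₃)) :
    ((c₃ * Y - c₃ * Z) / (c₃ * u ^ 2 - c₃ * v ^ 2)) ^ 2 - c₂ - c₃ * u ^ 2 - c₃ * v ^ 2 =
      SecRing.xiOne c₀ c₁ c₂ c₃ u v (Y * -Z) := by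
  rw [aeval_evenSextic_rat] at hu hv
  have h3' : (c₃ : ℚ) ≠ 0 := mod_cast h3
  have hd : u ^ 2 - v ^ 2 ≠ 0 := sub_ne_zero.mpr huv
  have hd1 : v - u ≠ 0 := fun h ↦ hd (by linear_combination (-u - v) * h)
  have hd2 : u + v ≠ 0 := fun h ↦ hd (by linear_combination (u - v) * h)
  rw [← mul_sub, ← mul_sub, mul_div_mul_left _ _ h3', SecRing.xiOne, div_pow,
    show (v - u) ^ 2 * (u + v) ^ 2 = (u ^ 2 - v ^ 2) ^ 2 by ring, eq_div_iff (pow_ne_zero 2 hd),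
    sub_mul, sub_mul, sub_mul, div_mul_cancel₀ _ (pow_ne_zero 2 hd)]
  linear_combination hu + hv

private lemma eq_xiTwo {c₀ c₁ c₂ c₃ : ℤ} (h0 : c₀ ≠ 0) {u v Y Z : ℚ} (hu0 : u ≠ 0) (hv0 : v ≠ 0)
    (huv : u ^ 2 ≠ v ^ 2)
    (hu : Y ^ 2 = aeval u (evenSextic c₀ c₁ c₂ c₃))
    (hv : Z ^ 2 = aeval v (evenSextic c₀ c₁ c₂ c₃)) :
    ((c₀ * (Y / u ^ 3) - c₀ * (Z / v ^ 3)) / (c₀ * (u ^ 2)⁻¹ - c₀ * (v ^ 2)⁻¹)) ^ 2 - c₁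
      - c₀ * (u ^ 2)⁻¹ - c₀ * (v ^ 2)⁻¹ = SecRing.xiTwo c₀ c₁ c₂ c₃ u v (Y * -Z) := by
  rw [aeval_evenSextic_rat] at hu hv
  have h0' : (c₀ : ℚ) ≠ 0 := mod_cast h0
  have hd : u ^ 2 - v ^ 2 ≠ 0 := sub_ne_zero.mpr huv
  have hd1 : v - u ≠ 0 := fun h ↦ hd (by linear_combination (-u - v) * h)
  have hd2 : u + v ≠ 0 := fun h ↦ hd (by linear_combination (u - v) * h)
  have e : (Y / u ^ 3 - Z / v ^ 3) / ((u ^ 2)⁻¹ - (v ^ 2)⁻¹)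
      = (Z * u ^ 3 - Y * v ^ 3) / (u * v * (u ^ 2 - v ^ 2)) := by
    have : (u ^ 2)⁻¹ - (v ^ 2)⁻¹ = -(u ^ 2 - v ^ 2) / (u ^ 2 * v ^ 2) := by
      field_simp
      ring
    rw [this, div_div_eq_mul_div, div_eq_div_iff (neg_ne_zero.mpr hd) (by positivity)]
    field_simp
    ring
  rw [← mul_sub, ← mul_sub, mul_div_mul_left _ _ h0', e, SecRing.xiTwo, div_pow,
    show (v - u) ^ 2 * (u + v) ^ 2 = (u ^ 2 - v ^ 2) ^ 2 by ring, eq_div_iff (pow_ne_zero 2 hd)]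
  field_simp
  linear_combination u ^ 6 * hv + v ^ 6 * hu

lemma finite_sq_eq (c : ℚ) : {x : ℚ | x ^ 2 = c}.Finite := by
  by_cases h : ∃ x, x ^ 2 = c
  · obtain ⟨x, rfl⟩ := h
    exact (Set.toFinite {x, -x}).subset fun y hy ↦ sq_eq_sq_iff_eq_or_eq_neg.mp hy
  · exact Set.finite_empty.subset fun y hy ↦ h ⟨y, hy⟩

lemma finite_fst_mem {f : ℚ → ℚ} {U : Set ℚ} (hU : U.Finite) :
    {z : ℚ × ℚ | z.2 ^ 2 = f z.1 ∧ z.1 ∈ U}.Finite := by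
  refine (hU.biUnion fun u _ ↦ (finite_sq_eq (f u)).image (Prod.mk u)).subset ?_
  rintro ⟨u, y⟩ ⟨h, hu⟩
  exact Set.mem_biUnion hu ⟨y, h, rfl⟩

private lemma evenSextic_eq_prod (a₁ a₂ a₃ b₁ b₂ b₃ : ℤ) :
    evenSextic (b₁ * b₂ * b₃) (a₁ * b₂ * b₃ + a₂ * b₁ * b₃ + a₃ * b₁ * b₂)
      (b₁ * a₂ * a₃ + b₂ * a₁ * a₃ + b₃ * a₁ * a₂) (a₁ * a₂ * a₃) =
    (C a₁ * X ^ 2 + C b₁) * (C a₂ * X ^ 2 + C b₂) * (C a₃ * X ^ 2 + C b₃) := by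
  simp only [evenSextic, eq_intCast]
  push_cast
  ring

/-- A product of three pairwise coprime nondegenerate even quadratics is not a square up to
constants. -/
private lemma eq_zero_of_sq_eq {a₁ a₂ a₃ b₁ b₂ b₃ : ℤ} (ha1 : a₁ ≠ 0) (hb1 : b₁ ≠ 0)
    (h12 : a₁ * b₂ ≠ a₂ * b₁) (h13 : a₁ * b₃ ≠ a₃ * b₁) {a b : ℤ[X]} {c : ℤ} (hc : c ≠ 0)
    (h : a ^ 2 = b ^ 2 * ((C a₁ * X ^ 2 + C b₁) * (C a₂ * X ^ 2 + C b₂) *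
      (C a₃ * X ^ 2 + C b₃) * C c)) : b = 0 := by
  by_contra hb
  have ha1' : (a₁ : ℂ) ≠ 0 := mod_cast ha1
  have hb1' : (b₁ : ℂ) ≠ 0 := mod_cast hb1
  obtain ⟨z, hz⟩ := IsAlgClosed.exists_pow_nat_eq (-(b₁ : ℂ) / a₁) (n := 2) (by norm_num)
  have hz' : (a₁ : ℂ) * z ^ 2 = -b₁ := by
    rw [hz]; field_simp
  have hz0 : z ≠ 0 := by
    rintro rfl
    simp [hb1'] at hz'
  have hne {a' b' : ℤ} (hab : a₁ * b' ≠ a' * b₁) : (a' : ℂ) * z ^ 2 + b' ≠ 0 := fun h0 ↦ by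
    have : (a₁ : ℂ) * b' = a' * b₁ := by linear_combination a₁ * h0 - a' * hz'
    exact hab (mod_cast this)
  have inj : Function.Injective (Polynomial.map (Int.castRingHom ℂ)) :=
    map_injective _ (RingHom.injective_int _)
  have hbC : b.map (Int.castRingHom ℂ) ≠ 0 := fun h0 ↦ hb (inj (by simpa using h0))
  obtain ⟨A, hA⟩ : ∃ A, A = a.map (Int.castRingHom ℂ) := ⟨_, rfl⟩
  obtain ⟨B, hB⟩ : ∃ B, B = b.map (Int.castRingHom ℂ) := ⟨_, rfl⟩
  have hm : A ^ 2 = B ^ 2 * ((X - C z) * ((C (a₁ : ℂ) * X + C (a₁ * z)) *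
      (C (a₂ : ℂ) * X ^ 2 + C (b₂ : ℂ)) * (C (a₃ : ℂ) * X ^ 2 + C (b₃ : ℂ)) * C (c : ℂ))) := by
    have h1 := congrArg (Polynomial.map (Int.castRingHom ℂ)) h
    have h2 : (X - C z) * (C (a₁ : ℂ) * X + C (a₁ * z)) = C (a₁ : ℂ) * X ^ 2 + C (b₁ : ℂ) := by
      rw [show (b₁ : ℂ) = -(a₁ * z ^ 2) by rw [hz', neg_neg]]
      simp only [map_mul, map_neg, map_pow]
      ring
    simp only [Polynomial.map_pow, Polynomial.map_mul, Polynomial.map_add, map_X,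
      eq_intCast, Polynomial.map_intCast, ← hA, ← hB] at h1
    rw [h1, ← mul_assoc (X - C z), ← mul_assoc (X - C z), ← mul_assoc (X - C z), h2]
    simp only [map_intCast]
  rw [← hB] at hbC
  generalize hG : (C (a₁ : ℂ) * X + C (a₁ * z)) *
      (C (a₂ : ℂ) * X ^ 2 + C (b₂ : ℂ)) * (C (a₃ : ℂ) * X ^ 2 + C (b₃ : ℂ)) * C (c : ℂ) = G at hm
  have hGz : G.eval z ≠ 0 := by
    have hc' : (c : ℂ) ≠ 0 := mod_cast hc
    have h2 : (a₁ : ℂ) * z + a₁ * z ≠ 0 := by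
      rw [← two_mul]
      exact mul_ne_zero two_ne_zero (mul_ne_zero ha1' hz0)
    rw [← hG]
    simp only [eval_mul, eval_add, eval_C, eval_X, eval_pow]
    exact mul_ne_zero (mul_ne_zero (mul_ne_zero h2 (hne h12)) (hne h13)) hc'
  have hG0 : G ≠ 0 := by rintro rfl; simp at hGz
  have hX : (X - C z) * G ≠ 0 := mul_ne_zero (X_sub_C_ne_zero z) hG0
  have h0 : B ^ 2 * ((X - C z) * G) ≠ 0 := mul_ne_zero (pow_ne_zero 2 hbC) hX
  have hr := congrArg (rootMultiplicity z) hm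
  have hA0 : A * A ≠ 0 := by rw [← sq, hm]; exact h0
  rw [rootMultiplicity_mul h0, rootMultiplicity_mul hX, rootMultiplicity_X_sub_C_self,
    rootMultiplicity_eq_zero hGz, sq, sq, rootMultiplicity_mul hA0,
    rootMultiplicity_mul (mul_ne_zero hbC hbC)] at hr
  omega

/-- The curve `y² = (a₁x² + b₁)(a₂x² + b₂)(a₃x² + b₃)` of genus two has finitely many rational
points. -/
theorem finite_rational_points {a₁ a₂ a₃ b₁ b₂ b₃ : ℤ} (ha1 : a₁ ≠ 0) (ha2 : a₂ ≠ 0) (ha3 : a₃ ≠ 0)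
    (hb1 : b₁ ≠ 0) (hb2 : b₂ ≠ 0) (hb3 : b₃ ≠ 0) (h12 : a₁ * b₂ ≠ a₂ * b₁)
    (h13 : a₁ * b₃ ≠ a₃ * b₁) (h23 : a₂ * b₃ ≠ a₃ * b₂) :
    {z : ℚ × ℚ | z.2 ^ 2 = (a₁ * z.1 ^ 2 + b₁) * (a₂ * z.1 ^ 2 + b₂) *
      (a₃ * z.1 ^ 2 + b₃)}.Finite := by
  obtain ⟨c₀, hc0⟩ : ∃ c, c = b₁ * b₂ * b₃ := ⟨_, rfl⟩
  obtain ⟨c₁, hc1⟩ : ∃ c, c = a₁ * b₂ * b₃ + a₂ * b₁ * b₃ + a₃ * b₁ * b₂ := ⟨_, rfl⟩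
  obtain ⟨c₂, hc2⟩ : ∃ c, c = b₁ * a₂ * a₃ + b₂ * a₁ * a₃ + b₃ * a₁ * a₂ := ⟨_, rfl⟩
  obtain ⟨c₃, hc3⟩ : ∃ c, c = a₁ * a₂ * a₃ := ⟨_, rfl⟩
  have h0 : c₀ ≠ 0 := hc0 ▸ mul_ne_zero (mul_ne_zero hb1 hb2) hb3
  have h3 : c₃ ≠ 0 := hc3 ▸ mul_ne_zero (mul_ne_zero ha1 ha2) ha3
  have hprod : evenSextic c₀ c₁ c₂ c₃ = (C a₁ * X ^ 2 + C b₁) * (C a₂ * X ^ 2 + C b₂) *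
      (C a₃ * X ^ 2 + C b₃) := by
    rw [hc0, hc1, hc2, hc3, evenSextic_eq_prod]
  have hns (a b : ℤ[X]) (c : ℤ) (hc : c ≠ 0) (h : a ^ 2 = b ^ 2 * (evenSextic c₀ c₁ c₂ c₃ * C c)) :
      b = 0 := eq_zero_of_sq_eq ha1 hb1 h12 h13 hc (by rw [h, hprod])
  have hf (u : ℚ) : (a₁ * u ^ 2 + b₁) * (a₂ * u ^ 2 + b₂) * (a₃ * u ^ 2 + b₃) =
      aeval u (evenSextic c₀ c₁ c₂ c₃) := by
    simp [hprod]
  have hroot {a b : ℤ} (ha : a ≠ 0) : {u : ℚ | (a : ℚ) * u ^ 2 + b = 0}.Finite := by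
    have ha' : (a : ℚ) ≠ 0 := mod_cast ha
    refine (finite_sq_eq (-b / a)).subset fun u hu ↦ ?_
    rw [Set.mem_ofPred_eq] at hu ⊢
    rw [eq_div_iff ha']
    linear_combination hu
  have hE₁ {u y : ℚ} (hy : y ^ 2 = aeval u (evenSextic c₀ c₁ c₂ c₃)) :
      (c₃ * y) ^ 2 = (c₃ * u ^ 2 - (-b₁ * a₂ * a₃ : ℤ)) * (c₃ * u ^ 2 - (-b₂ * a₁ * a₃ : ℤ)) *
        (c₃ * u ^ 2 - (-b₃ * a₁ * a₂ : ℤ)) := by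
    rw [mul_pow, hy, ← hf, hc3]
    push_cast
    ring
  have hE₂ {u y : ℚ} (hu : u ≠ 0) (hy : y ^ 2 = aeval u (evenSextic c₀ c₁ c₂ c₃)) :
      (c₀ * (y / u ^ 3)) ^ 2 = (c₀ * (u ^ 2)⁻¹ - (-a₁ * b₂ * b₃ : ℤ)) *
        (c₀ * (u ^ 2)⁻¹ - (-a₂ * b₁ * b₃ : ℤ)) * (c₀ * (u ^ 2)⁻¹ - (-a₃ * b₁ * b₂ : ℤ)) := by
    rw [mul_pow, div_pow, hy, ← hf, hc0]
    push_cast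
    field_simp
    ring
  have hsum₁ : ((-b₁ * a₂ * a₃ : ℤ) : ℚ) + (-b₂ * a₁ * a₃ : ℤ) + (-b₃ * a₁ * a₂ : ℤ) = -c₂ := by
    rw [hc2]
    push_cast
    ring
  have hsum₂ : ((-a₁ * b₂ * b₃ : ℤ) : ℚ) + (-a₂ * b₁ * b₃ : ℤ) + (-a₃ * b₁ * b₂ : ℤ) = -c₁ := by
    rw [hc1]
    push_cast
    ring
  let α := {z : ℚ × ℚ // z.2 ^ 2 = aeval z.1 (evenSextic c₀ c₁ c₂ c₃) ∧ z.1 ≠ 0 ∧ z.2 ≠ 0}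
  have hα (hinf : Infinite α) : False := by
    let h (s : α) : ℝ := Real.log (ratHeight s.1.1)
    have hfin (B : ℝ) : {s | h s ≤ B}.Finite := by
      refine Set.Finite.of_finite_image (f := Subtype.val) ((finite_fst_mem
        (f := fun u ↦ aeval u (evenSextic c₀ c₁ c₂ c₃)) (finite_log_ratHeight_le B)).subset ?_)
        Subtype.val_injective.injOn
      rintro _ ⟨s, hs, rfl⟩
      exact ⟨s.2.1, hs⟩
    have h0' : (c₀ : ℚ) ≠ 0 := mod_cast h0
    have h3' : (c₃ : ℚ) ≠ 0 := mod_cast h3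
    obtain ⟨r₁, v, C₁, hv, hv'⟩ := SplitCurve.exists_euclidean_family (h := h)
      (e₁ := -b₁ * a₂ * a₃) (e₂ := -b₂ * a₁ * a₃) (e₃ := -b₃ * a₁ * a₂)
      (x := fun s : α ↦ c₃ * s.1.1 ^ 2) (y := fun s : α ↦ c₃ * s.1.2)
      (B := Real.log (ratHeight c₃))
      (fun e ↦ h12 (mul_right_cancel₀ ha3 (by linear_combination e)))
      (fun e ↦ h13 (mul_right_cancel₀ ha2 (by linear_combination e)))
      (fun e ↦ h23 (mul_right_cancel₀ ha1 (by linear_combination e)))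
      (fun s ↦ hE₁ s.2.1)
      (fun s ↦ by
        have := abs_log_ratHeight_mul_sub_le h3' (s.1.1 ^ 2)
        rwa [log_ratHeight_sq] at this)
    obtain ⟨r₂, w, C₂, hw, hw'⟩ := SplitCurve.exists_euclidean_family (h := h)
      (e₁ := -a₁ * b₂ * b₃) (e₂ := -a₂ * b₁ * b₃) (e₃ := -a₃ * b₁ * b₂)
      (x := fun s : α ↦ c₀ * (s.1.1 ^ 2)⁻¹) (y := fun s : α ↦ c₀ * (s.1.2 / s.1.1 ^ 3))
      (B := Real.log (ratHeight c₀))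
      (fun e ↦ h12 (mul_right_cancel₀ hb3 (by linear_combination -e)))
      (fun e ↦ h13 (mul_right_cancel₀ hb2 (by linear_combination -e)))
      (fun e ↦ h23 (mul_right_cancel₀ hb1 (by linear_combination -e)))
      (fun s ↦ hE₂ s.2.2.1 s.2.1)
      (fun s ↦ by
        have := abs_log_ratHeight_mul_sub_le h0' (s.1.1 ^ 2)⁻¹
        rwa [log_ratHeight_inv, log_ratHeight_sq] at this)
    obtain ⟨C, hC⟩ : ∃ C, C = max (max C₁ C₂) 0 := ⟨_, rfl⟩
    have hC1 : C₁ ≤ C := hC ▸ (le_max_left _ _).trans (le_max_left _ _)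
    have hC2 : C₂ ≤ C := hC ▸ (le_max_right _ _).trans (le_max_left _ _)
    have hC0 : 0 ≤ C := hC ▸ le_max_right _ _
    obtain ⟨H₀, hH₀, key⟩ := exists_gap_contradiction h0 hns (c := 3 * C) (by positivity)
    obtain ⟨s, t, hs, hst, hvst, hwst⟩ := exists_nearly_parallel hfin hC0
      (fun s ↦ (hv s).trans hC1) (fun s ↦ (hw s).trans hC2) H₀
    have hne : s.1.1 ^ 2 ≠ t.1.1 ^ 2 := fun e ↦ by
      have e' : h s = h t := by
        have := congrArg (fun q ↦ Real.log (ratHeight q)) e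
        simp only [log_ratHeight_sq] at this
        simp only [h]
        linarith
      linarith
    refine key s.1.1 t.1.1 s.1.2 (-t.1.2) s.2.1 (by rw [neg_sq]; exact t.2.1) s.2.2.2
      (neg_ne_zero.mpr t.2.2.2) hs hst fun ξ hξ ↦ ?_
    have h1 := hv' s t fun e ↦ hne (mul_left_cancel₀ h3' e)
    have h2 := hw' s t fun e ↦ hne (inv_injective (mul_left_cancel₀ h0' e))
    rw [hsum₁, ← sub_eq_add_neg, eq_xiOne h3 hne s.2.1 t.2.1] at h1
    rw [hsum₂, ← sub_eq_add_neg, eq_xiTwo h0 s.2.2.1 t.2.2.1 hne s.2.1 t.2.1] at h2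
    simp only [h] at hvst hwst
    rcases hξ with rfl | rfl <;> linarith
  simp only [hf]
  have hbad : ({0} ∪ {u : ℚ | (a₁ : ℚ) * u ^ 2 + b₁ = 0} ∪ {u : ℚ | (a₂ : ℚ) * u ^ 2 + b₂ = 0} ∪
    {u : ℚ | (a₃ : ℚ) * u ^ 2 + b₃ = 0}).Finite :=
    (((Set.finite_singleton 0).union (hroot ha1)).union (hroot ha2)).union (hroot ha3)
  have hfinα : {z : ℚ × ℚ | z.2 ^ 2 = aeval z.1 (evenSextic c₀ c₁ c₂ c₃) ∧ z.1 ≠ 0 ∧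
      z.2 ≠ 0}.Finite := by
    by_contra hinf
    exact hα (Set.infinite_coe_iff.mpr hinf)
  refine (hfinα.union (finite_fst_mem (f := fun u ↦ aeval u (evenSextic c₀ c₁ c₂ c₃))
    hbad)).subset fun z hz ↦ ?_
  by_cases hz1 : z.1 = 0
  · exact .inr ⟨hz, by simp [hz1]⟩
  by_cases hz2 : z.2 = 0
  · refine .inr ⟨hz, ?_⟩
    rw [Set.mem_ofPred_eq, hz2, ← hf, zero_pow two_ne_zero, eq_comm, mul_eq_zero, mul_eq_zero] at hz
    simp only [Set.mem_union, Set.mem_singleton_iff, Set.mem_ofPred_eq]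
    tauto
  · exact .inl ⟨hz, hz1, hz2⟩

/-- The curve `y² = (a₁x² + b₁)(a₂x² + b₂)(a₃x² + b₃)` with rational coefficients has finitely
many rational points. -/
theorem finite_rational_points_of_rat {a₁ a₂ a₃ b₁ b₂ b₃ : ℚ} (ha1 : a₁ ≠ 0) (ha2 : a₂ ≠ 0)
    (ha3 : a₃ ≠ 0) (hb1 : b₁ ≠ 0) (hb2 : b₂ ≠ 0) (hb3 : b₃ ≠ 0) (h12 : a₁ * b₂ ≠ a₂ * b₁)
    (h13 : a₁ * b₃ ≠ a₃ * b₁) (h23 : a₂ * b₃ ≠ a₃ * b₂) :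
    {z : ℚ × ℚ | z.2 ^ 2 = (a₁ * z.1 ^ 2 + b₁) * (a₂ * z.1 ^ 2 + b₂) *
      (a₃ * z.1 ^ 2 + b₃)}.Finite := by
  obtain ⟨N, hN, hNint⟩ : ∃ N : ℤ, N ≠ 0 ∧ ∀ c ∈ [a₁, a₂, a₃, b₁, b₂, b₃],
      ∃ n : ℤ, (N : ℚ) * c = n := by
    refine ⟨(([a₁, a₂, a₃, b₁, b₂, b₃].map Rat.den).prod : ℕ), ?_, fun c hc ↦ ?_⟩
    · simp
    · obtain ⟨k, hk⟩ := List.dvd_prod (List.mem_map_of_mem (f := Rat.den) hc)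
      refine ⟨k * c.num, ?_⟩
      rw [hk]
      push_cast
      rw [mul_right_comm, mul_comm _ c, Rat.mul_den_eq_num, mul_comm]
  have hN' : (N : ℚ) ≠ 0 := mod_cast hN
  have hsq (c : ℚ) (hc : c ∈ [a₁, a₂, a₃, b₁, b₂, b₃]) : ∃ n : ℤ, (n : ℚ) = N ^ 2 * c := by
    obtain ⟨n, hn⟩ := hNint c hc
    exact ⟨N * n, by push_cast; rw [← hn]; ring⟩
  obtain ⟨A₁, hA1⟩ := hsq a₁ (by simp)
  obtain ⟨A₂, hA2⟩ := hsq a₂ (by simp)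
  obtain ⟨A₃, hA3⟩ := hsq a₃ (by simp)
  obtain ⟨B₁, hB1⟩ := hsq b₁ (by simp)
  obtain ⟨B₂, hB2⟩ := hsq b₂ (by simp)
  obtain ⟨B₃, hB3⟩ := hsq b₃ (by simp)
  have hne {n : ℤ} {c : ℚ} (h : (n : ℚ) = N ^ 2 * c) (hc : c ≠ 0) : n ≠ 0 := by
    rintro rfl
    simp [hN', hc] at h
  have hdet {m n k l : ℤ} {a b c d : ℚ} (hm : (m : ℚ) = N ^ 2 * a) (hn : (n : ℚ) = N ^ 2 * b)
      (hk : (k : ℚ) = N ^ 2 * c) (hl : (l : ℚ) = N ^ 2 * d) (h : a * b ≠ c * d) :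
      m * n ≠ k * l := fun e ↦ by
    have e' : (m : ℚ) * n = k * l := mod_cast e
    rw [hm, hn, hk, hl] at e'
    exact h (mul_left_cancel₀ (pow_ne_zero 4 hN') (by linear_combination e'))
  have hfin := finite_rational_points (hne hA1 ha1) (hne hA2 ha2) (hne hA3 ha3) (hne hB1 hb1)
    (hne hB2 hb2) (hne hB3 hb3) (hdet hA1 hB2 hA2 hB1 h12) (hdet hA1 hB3 hA3 hB1 h13)
    (hdet hA2 hB3 hA3 hB2 h23)
  refine Set.Finite.of_finite_image (f := fun z : ℚ × ℚ ↦ (z.1, (N : ℚ) ^ 3 * z.2))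
    (hfin.subset ?_) fun z _ z' _ hzz' ↦ ?_
  · rintro _ ⟨⟨u, y⟩, hy, rfl⟩
    simp only [Set.mem_ofPred_eq] at hy ⊢
    rw [hA1, hA2, hA3, hB1, hB2, hB3, mul_pow, hy]
    ring
  · rw [Prod.mk.injEq] at hzz'
    exact Prod.ext hzz'.1 (mul_left_cancel₀ (pow_ne_zero 3 hN') hzz'.2)

private lemma finite_quadratic_roots {α β γ : ℚ} (h : α ≠ 0 ∨ β ≠ 0) :
    {p : ℚ | α * p ^ 2 + β * p + γ = 0}.Finite := by
  have hq : C α * X ^ 2 + C β * X + C γ ≠ 0 := fun h0 ↦ by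
    have h1 := congrArg (fun q ↦ q.coeff 1) h0
    have h2 := congrArg (fun q ↦ q.coeff 2) h0
    simp [coeff_C] at h1 h2
    tauto
  refine ((C α * X ^ 2 + C β * X + C γ).rootSet_finite ℚ).subset fun p hp ↦ ?_
  rw [mem_rootSet]
  exact ⟨hq, by simpa using hp⟩

/-- Finiteness for the intersection of two quartics that become diagonal, together with the
square of `p ^ 2 - k`, in two quadratic polynomials `p ^ 2 - v p + k`, `p ^ 2 - w p + k`. -/
theorem finite_of_diagonal {a₁ a₂ a₃ b₁ b₂ b₃ : ℚ} (ha1 : a₁ ≠ 0) (ha2 : a₂ ≠ 0)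
    (ha3 : a₃ ≠ 0) (hb1 : b₁ ≠ 0) (hb2 : b₂ ≠ 0) (hb3 : b₃ ≠ 0) (h12 : a₁ * b₂ ≠ a₂ * b₁)
    (h13 : a₁ * b₃ ≠ a₃ * b₁) (h23 : a₂ * b₃ ≠ a₃ * b₂) {k v w m n : ℚ} (hvw : v ≠ w)
    (hm : m ≠ 0) (hn : n ≠ 0)
    (hD : ∀ p, (p ^ 2 - k) ^ 2 = a₁ * (p ^ 2 - v * p + k) ^ 2 + b₁ * (p ^ 2 - w * p + k) ^ 2)
    {T : Set (ℚ × ℚ × ℚ)}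
    (hf : ∀ x ∈ T, x.2.1 ^ 2 =
      m ^ 2 * (a₂ * (x.1 ^ 2 - v * x.1 + k) ^ 2 + b₂ * (x.1 ^ 2 - w * x.1 + k) ^ 2))
    (hg : ∀ x ∈ T, x.2.2 ^ 2 =
      n ^ 2 * (a₃ * (x.1 ^ 2 - v * x.1 + k) ^ 2 + b₃ * (x.1 ^ 2 - w * x.1 + k) ^ 2)) :
    T.Finite := by
  have hfin := (finite_rational_points_of_rat ha1 ha2 ha3 hb1 hb2 hb3 h12 h13 h23).image Prod.fst
  have hP : ({p : ℚ | 1 * p ^ 2 + -w * p + k = 0} ∪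
      ⋃ u ∈ Prod.fst '' {z : ℚ × ℚ | z.2 ^ 2 = (a₁ * z.1 ^ 2 + b₁) * (a₂ * z.1 ^ 2 + b₂) *
        (a₃ * z.1 ^ 2 + b₃)},
      {p : ℚ | (1 - u) * p ^ 2 + (u * w - v) * p + (1 - u) * k = 0}).Finite := by
    refine (finite_quadratic_roots (.inl one_ne_zero)).union
      (hfin.biUnion fun u _ ↦ finite_quadratic_roots ?_)
    by_contra! h
    exact hvw (by linear_combination -h.2 - w * h.1)
  refine (hP.biUnion fun p _ ↦ ((finite_sq_eq
      (m ^ 2 * (a₂ * (p ^ 2 - v * p + k) ^ 2 + b₂ * (p ^ 2 - w * p + k) ^ 2))).prod (finite_sq_eq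
      (n ^ 2 * (a₃ * (p ^ 2 - v * p + k) ^ 2 + b₃ * (p ^ 2 - w * p + k) ^ 2)))).image
    (Prod.mk p)).subset ?_
  rintro ⟨p, S, S'⟩ hx
  have hS := hf _ hx
  have hS' := hg _ hx
  refine Set.mem_biUnion ?_ ⟨(S, S'), ⟨hS, hS'⟩, rfl⟩
  by_cases hV : p ^ 2 - w * p + k = 0
  · exact .inl (by rw [Set.mem_ofPred_eq]; linear_combination hV)
  refine .inr (Set.mem_biUnion ⟨((p ^ 2 - v * p + k) / (p ^ 2 - w * p + k),
    (p ^ 2 - k) * S * S' / (m * n * (p ^ 2 - w * p + k) ^ 3)), ?_, rfl⟩ ?_)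
  · dsimp only at hS hS'
    rw [Set.mem_ofPred_eq, div_pow, mul_pow, mul_pow, hD, hS, hS']
    generalize p ^ 2 - w * p + k = V at hV
    field_simp
  · rw [Set.mem_ofPred_eq]
    linear_combination -div_mul_cancel₀ (p ^ 2 - v * p + k) hV

private lemma sq_pow_ne_one {t : ℚ} (ht1 : t ≠ -1) (ht2 : t ≠ 1) {n : ℕ} (hn : n ≠ 0) :
    t ^ (2 * n) - 1 ≠ 0 := fun h ↦ by
  have : (t ^ 2) ^ n = 1 := by rw [← pow_mul]; linear_combination h
  rw [pow_eq_one_iff_of_nonneg (sq_nonneg t) hn, sq_eq_one_iff] at this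
  tauto

private lemma mul_ne_mul_of_add_eq_one {a b c d : ℚ} (hab : a + b = 1) (hcd : c + d = 1)
    (h : a ≠ c) : a * d ≠ c * b := fun e ↦
  h (by linear_combination e + c * hab - a * hcd)

/-- For fixed `t ∉ {-1, 0, 1}`, the set of rational points `(p, S, S′)` with
`S² = H_t(p)` and `S′² = H′_t(p)` (a curve of genus 5) is finite. -/
theorem genus_five_curve_finitely_many_points
    (t : ℚ) (ht1 : t ≠ -1) (ht0 : t ≠ 0) (ht2 : t ≠ 1) :
    {x : ℚ × ℚ × ℚ |
      x.2.1 ^ 2 = t ^ 8 * (1 + t ^ 4) ^ 2 * x.1 ^ 4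
        + 4 * t ^ 5 * (1 + 2 * t ^ 4 + 2 * t ^ 8 + t ^ 12) * x.1 ^ 3
        - 2 * t ^ 4 * (4 + 3 * t ^ 2 + 9 * t ^ 4 + 4 * t ^ 6 + 9 * t ^ 8
            + 3 * t ^ 10 + 4 * t ^ 12) * x.1 ^ 2
        + 4 * t ^ 3 * (1 - t ^ 2 + t ^ 4) * (1 + t ^ 2 + t ^ 4) ^ 2 * x.1
        + t ^ 4 * (1 + t ^ 2 + t ^ 4) ^ 2 ∧
      x.2.2 ^ 2 = t ^ 10 * (1 + t ^ 4) ^ 2 * x.1 ^ 4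
        + 4 * t ^ 5 * (1 + t ^ 2 + 2 * t ^ 4 + 2 * t ^ 6 + 2 * t ^ 8
            + 2 * t ^ 10 + 2 * t ^ 12 + t ^ 14 + t ^ 16) * x.1 ^ 3
        - 2 * t ^ 4 * (4 + 6 * t ^ 2 + 11 * t ^ 4 + 11 * t ^ 6 + 12 * t ^ 8
            + 11 * t ^ 10 + 11 * t ^ 12 + 6 * t ^ 14 + 4 * t ^ 16) * x.1 ^ 2
        + 4 * t ^ 3 * (1 + 2 * t ^ 2 + 3 * t ^ 4 + 3 * t ^ 6 + 3 * t ^ 8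
            + 3 * t ^ 10 + 3 * t ^ 12 + 2 * t ^ 14 + t ^ 16) * x.1
        + t ^ 6 * (1 + t ^ 2 + t ^ 4) ^ 2}.Finite := by
  have e2 : t ^ 2 - 1 ≠ 0 := sq_pow_ne_one ht1 ht2 one_ne_zero
  have e4 : t ^ 4 - 1 ≠ 0 := sq_pow_ne_one ht1 ht2 two_ne_zero
  have e6 : t ^ 6 - 1 ≠ 0 := sq_pow_ne_one ht1 ht2 (n := 3) (by norm_num)
  have e8 : t ^ 8 - 1 ≠ 0 := sq_pow_ne_one ht1 ht2 (n := 4) (by norm_num)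
  have e10 : t ^ 10 - 1 ≠ 0 := sq_pow_ne_one ht1 ht2 (n := 5) (by norm_num)
  have e12 : t ^ 12 - 1 ≠ 0 := sq_pow_ne_one ht1 ht2 (n := 6) (by norm_num)
  have e14 : t ^ 14 - 1 ≠ 0 := sq_pow_ne_one ht1 ht2 (n := 7) (by norm_num)
  have e16 : t ^ 16 - 1 ≠ 0 := sq_pow_ne_one ht1 ht2 (n := 8) (by norm_num)
  have d4 : 1 + t ^ 4 ≠ 0 := by positivity
  have hc : (t ^ 4 - 1) * (t ^ 2 - 1) ≠ 0 := mul_ne_zero e4 e2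
  refine finite_of_diagonal
    (a₁ := -((t ^ 8 - 1) * (t ^ 2 - 1)) / (t ^ 2 * ((t ^ 4 - 1) * (t ^ 2 - 1))))
    (a₂ := -((t ^ 10 - 1) * (t ^ 4 - 1)) / (t ^ 4 * ((t ^ 4 - 1) * (t ^ 2 - 1))))
    (a₃ := -((t ^ 12 - 1) * (t ^ 6 - 1)) / (t ^ 6 * ((t ^ 4 - 1) * (t ^ 2 - 1))))
    (b₁ := (t ^ 6 - 1) * (t ^ 4 - 1) / (t ^ 2 * ((t ^ 4 - 1) * (t ^ 2 - 1))))
    (b₂ := (t ^ 8 - 1) * (t ^ 6 - 1) / (t ^ 4 * ((t ^ 4 - 1) * (t ^ 2 - 1))))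
    (b₃ := (t ^ 10 - 1) * (t ^ 8 - 1) / (t ^ 6 * ((t ^ 4 - 1) * (t ^ 2 - 1))))
    (k := (1 + t ^ 2 + t ^ 4) / (t ^ 2 * (1 + t ^ 4)))
    (v := 2 * (1 + t ^ 2 + t ^ 4) / (t * (1 + t ^ 4))) (w := 2 / t)
    (m := t ^ 4 * (1 + t ^ 4)) (n := t ^ 5 * (1 + t ^ 4))
    (div_ne_zero (neg_ne_zero.mpr (mul_ne_zero e8 e2)) (by positivity))
    (div_ne_zero (neg_ne_zero.mpr (mul_ne_zero e10 e4)) (by positivity))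
    (div_ne_zero (neg_ne_zero.mpr (mul_ne_zero e12 e6)) (by positivity))
    (by positivity) (by positivity) (by positivity) ?_ ?_ ?_ ?_ (by positivity) (by positivity)
    (fun p ↦ ?_) (fun x hx ↦ hx.1.trans ?_) fun x hx ↦ hx.2.trans ?_
  · refine mul_ne_mul_of_add_eq_one (by field_simp; ring) (by field_simp; ring) fun h ↦ ?_
    rw [div_eq_div_iff (by positivity) (by positivity)] at h
    refine mul_ne_zero (mul_ne_zero (pow_ne_zero 2 ht0) hc) (mul_ne_zero e12 e2) ?_
    linear_combination h
  · refine mul_ne_mul_of_add_eq_one (by field_simp; ring) (by field_simp; ring) fun h ↦ ?_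
    rw [div_eq_div_iff (by positivity) (by positivity)] at h
    refine mul_ne_zero (mul_ne_zero (pow_ne_zero 2 ht0) hc) (mul_ne_zero e14 e4) ?_
    linear_combination h
  · refine mul_ne_mul_of_add_eq_one (by field_simp; ring) (by field_simp; ring) fun h ↦ ?_
    rw [div_eq_div_iff (by positivity) (by positivity)] at h
    refine mul_ne_zero (mul_ne_zero (pow_ne_zero 4 ht0) hc) (mul_ne_zero e16 e2) ?_
    linear_combination h
  · intro h
    rw [div_eq_div_iff (by positivity) ht0] at h
    refine pow_ne_zero 3 ht0 ?_
    linear_combination h / 2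
  · field_simp
    ring
  · field_simp
    ring
  · field_simp
    ring
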